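/- Let n ≥ 1 be an integer, let p, q, t ∈ ℂ with 0 < |p| < 1, 0 < |q| < 1, 0 < |t| < 1, and let t_0,...,t_5 ∈ ℂ satisfy |t_r| < 1 for all r and t^{2n−2} t_0 t_1 t_2 t_3 t_4 t_5 = pq. Then ((p;p)_∞ (q;q)_∞ Γ(t;p,q))^n/(2^n · n!) · (1/(2π)^n) ∫_{[0,2π]^n} ∏_{1≤i<j≤n} Γ(t z_i^{±1} z_j^{±1};p,q)/Γ(z_i^{±1} z_j^{±1};p,q) · ∏_{i=1}^{n} ( ∏_{r=0}^{5} Γ(t_r z_i^{±1};p,q) )/Γ(z_i^{±2};p,q) dθ_1⋯dθ_n = ∏_{j=0}^{n−1} ( Γ(t^{j+1};p,q) · ∏_{0≤r<s≤5} Γ(t^j t_r t_s;p,q) ), where z_i = e^{iθ_i}. -/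

import Mathlib

open scoped BigOperators Real
open MeasureTheory

/-- The elliptic Gamma function `Γ(x;p,q)`. -/
noncomputable def ellGamma (x p q : ℂ) : ℂ :=
  ∏' jk : ℕ × ℕ, ((1 - p ^ (jk.1 + 1) * q ^ (jk.2 + 1) / x) / (1 - p ^ jk.1 * q ^ jk.2 * x))

/-- `(p;p)_∞`. -/
noncomputable def qPoch (p : ℂ) : ℂ := ∏' k : ℕ, (1 - p ^ (k + 1))

/-- `n`-fold contour integral over the unit torus. -/
noncomputable def torusInt (n : ℕ) (f : (Fin n → ℂ) → ℂ) : ℂ :=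
  ((1 / (2 * Real.pi) : ℝ) : ℂ) ^ n *
    ∫ θ in Set.univ.pi fun _ : Fin n => Set.Icc (0 : ℝ) (2 * Real.pi),
      f fun i => Complex.exp (Complex.I * (θ i))

namespace EllipticSelberg

/-! ### Infinite products -/

section Product

variable {ι : Type*} {a : ι → ℂ}

lemma multipliable_one_sub_mul (ha : Summable fun i => ‖a i‖) (x : ℂ) :
    Multipliable fun i => 1 - a i * x := by
  have h : Summable fun i => ‖-(a i * x)‖ := by
    simpa [norm_mul] using ha.mul_right ‖x‖
  simpa [sub_eq_add_neg] using multipliable_one_add_of_summable h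

lemma tprod_one_sub_mul_eq_zero_iff (ha : Summable fun i => ‖a i‖) (x : ℂ) :
    ∏' i, (1 - a i * x) = 0 ↔ ∃ i, 1 - a i * x = 0 := by
  refine ⟨fun h => ?_, fun h => tprod_of_exists_eq_zero h⟩
  by_contra! hne
  have hs : Summable fun i => ‖-(a i * x)‖ := by
    simpa [norm_mul] using ha.mul_right ‖x‖
  refine tprod_one_add_ne_zero_of_summable (f := fun i => -(a i * x)) ?_ hs ?_
  · simpa [sub_eq_add_neg] using hne
  · simpa [sub_eq_add_neg] using h

lemma differentiable_tprod_one_sub_mul (ha : Summable fun i => ‖a i‖) :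
    Differentiable ℂ fun x => ∏' i, (1 - a i * x) := by
  intro x
  have hmem : x ∈ Metric.ball (0 : ℂ) (‖x‖ + 1) := by simp
  have h : HasProdLocallyUniformlyOn (fun i x => 1 + -(a i * x))
      (fun x => ∏' i, (1 + -(a i * x))) (Metric.ball (0 : ℂ) (‖x‖ + 1)) := by
    refine Summable.hasProdLocallyUniformlyOn_one_add Metric.isOpen_ball
      (ha.mul_right (‖x‖ + 1)) (.of_forall fun i y hy => ?_) fun i => by fun_prop
    have : ‖y‖ ≤ ‖x‖ + 1 := by simpa using (mem_ball_zero_iff.mp hy).le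
    rw [norm_neg, norm_mul]
    gcongr
  have hd := h.differentiableOn (.of_forall fun s => by
    simpa [Finset.prod_fn] using DifferentiableOn.finsetProd (fun _ _ => by fun_prop))
    Metric.isOpen_ball
  simpa [sub_eq_add_neg] using hd.differentiableAt (Metric.isOpen_ball.mem_nhds hmem)

end Product

/-- The `q`-shifted factorial `(x;q)_∞`. -/
noncomputable def qFac (q x : ℂ) : ℂ := ∏' k : ℕ, (1 - q ^ k * x)

/-- The modified theta function `θ(x;q)`. -/
noncomputable def theta (q x : ℂ) : ℂ := qFac q x * qFac q (q / x)

/-- The double shifted factorial `(x;p,q)_∞`. -/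
noncomputable def dFac (p q x : ℂ) : ℂ := ∏' jk : ℕ × ℕ, (1 - p ^ jk.1 * q ^ jk.2 * x)

variable {p q : ℂ}

lemma summable_norm_pow (hq1 : ‖q‖ < 1) : Summable fun k : ℕ => ‖q ^ k‖ := by
  simpa using summable_geometric_of_lt_one (norm_nonneg _) hq1

lemma summable_norm_pow_mul_pow (hp1 : ‖p‖ < 1) (hq1 : ‖q‖ < 1) :
    Summable fun jk : ℕ × ℕ => ‖p ^ jk.1 * q ^ jk.2‖ := by
  simpa using (summable_geometric_of_lt_one (norm_nonneg p) hp1).mul_of_nonneg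
    (summable_geometric_of_lt_one (norm_nonneg q) hq1)
    (fun _ => by positivity) (fun _ => by positivity)

lemma differentiable_qFac (hq1 : ‖q‖ < 1) : Differentiable ℂ (qFac q) :=
  differentiable_tprod_one_sub_mul (summable_norm_pow hq1)

lemma differentiable_dFac (hp1 : ‖p‖ < 1) (hq1 : ‖q‖ < 1) : Differentiable ℂ (dFac p q) :=
  differentiable_tprod_one_sub_mul (summable_norm_pow_mul_pow hp1 hq1)

lemma qFac_eq_zero_iff (hq1 : ‖q‖ < 1) (x : ℂ) : qFac q x = 0 ↔ ∃ k : ℕ, q ^ k * x = 1 := by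
  rw [qFac, tprod_one_sub_mul_eq_zero_iff (summable_norm_pow hq1)]
  simp only [sub_eq_zero, eq_comm (a := (1 : ℂ))]

lemma dFac_eq_zero_iff (hp1 : ‖p‖ < 1) (hq1 : ‖q‖ < 1) (x : ℂ) :
    dFac p q x = 0 ↔ ∃ jk : ℕ × ℕ, p ^ jk.1 * q ^ jk.2 * x = 1 := by
  rw [dFac, tprod_one_sub_mul_eq_zero_iff (summable_norm_pow_mul_pow hp1 hq1)]
  simp only [sub_eq_zero, eq_comm (a := (1 : ℂ))]

lemma qFac_ne_zero (hq1 : ‖q‖ < 1) {x : ℂ} (hx : ‖x‖ < 1) : qFac q x ≠ 0 := by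
  rw [Ne, qFac_eq_zero_iff hq1]
  rintro ⟨k, hk⟩
  have h := congrArg norm hk
  have h1 : ‖q‖ ^ k ≤ 1 := pow_le_one₀ (norm_nonneg _) hq1.le
  simp only [norm_mul, norm_pow, norm_one] at h
  nlinarith [norm_nonneg x]

lemma dFac_ne_zero (hp1 : ‖p‖ < 1) (hq1 : ‖q‖ < 1) {x : ℂ} (hx : ‖x‖ < 1) :
    dFac p q x ≠ 0 := by
  rw [Ne, dFac_eq_zero_iff hp1 hq1]
  rintro ⟨k, hk⟩
  have h := congrArg norm hk
  have h1 : ‖p‖ ^ k.1 ≤ 1 := pow_le_one₀ (norm_nonneg _) hp1.le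
  have h2 : ‖q‖ ^ k.2 ≤ 1 := pow_le_one₀ (norm_nonneg _) hq1.le
  have h3 : ‖p‖ ^ k.1 * ‖q‖ ^ k.2 ≤ 1 := mul_le_one₀ h1 (by positivity) h2
  simp only [norm_mul, norm_pow, norm_one] at h
  nlinarith [norm_nonneg x]

lemma qFac_step (hq1 : ‖q‖ < 1) (x : ℂ) : qFac q x = (1 - x) * qFac q (q * x) := by
  have h := (multipliable_one_sub_mul (summable_norm_pow hq1) (q * x)).hasProd
  have h' : HasProd (fun k : ℕ => 1 - q ^ k * x) ((1 - q ^ 0 * x) * qFac q (q * x)) := by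
    refine HasProd.zero_mul (f := fun k : ℕ => 1 - q ^ k * x) ?_
    simpa [qFac, pow_succ, mul_assoc] using h
  simpa [qFac] using h'.tprod_eq

lemma dFac_swap (x : ℂ) : dFac p q x = dFac q p x := by
  rw [dFac, dFac, ← (Equiv.prodComm ℕ ℕ).tprod_eq]
  simp [mul_comm (p ^ _)]

lemma dFac_step (hp1 : ‖p‖ < 1) (hq1 : ‖q‖ < 1) (x : ℂ) :
    dFac p q x = qFac p x * dFac p q (q * x) := by
  have h1 := (multipliable_one_sub_mul (summable_norm_pow hp1) x).hasProd
  have h2 := (multipliable_one_sub_mul (summable_norm_pow_mul_pow hp1 hq1) (q * x)).hasProd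
  let e0 : ℕ → ℕ × ℕ := fun j => (j, 0)
  let e1 : ℕ × ℕ → ℕ × ℕ := fun jk => (jk.1, jk.2 + 1)
  have i0 : Function.Injective e0 := fun a b h => by simpa [e0] using h
  have i1 : Function.Injective e1 := fun a b h => by
    simpa [e1, Prod.ext_iff] using h
  have hc : IsCompl (Set.range e0) (Set.range e1) := by
    rw [isCompl_iff, Set.disjoint_iff, codisjoint_iff]
    refine ⟨?_, ?_⟩
    · rintro ⟨a, b⟩ ⟨⟨c, hc⟩, ⟨d, hd⟩⟩
      simp [e0, e1] at hc hd
      omega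
    · change Set.range e0 ∪ Set.range e1 = Set.univ
      ext ⟨a, b⟩
      rcases b with _ | b <;> simp [e0, e1]
  have h := HasProd.mul_isCompl (f := fun jk : ℕ × ℕ => 1 - p ^ jk.1 * q ^ jk.2 * x)
    (a := qFac p x) (b := dFac p q (q * x)) hc ?_ ?_
  · exact h.tprod_eq
  · rw [← (Equiv.ofInjective e0 i0).hasProd_iff]
    simpa [e0, Function.comp_def, qFac] using h1
  · rw [← (Equiv.ofInjective e1 i1).hasProd_iff]
    simpa [e1, Function.comp_def, dFac, pow_succ, mul_assoc] using h2

lemma dFac_step' (hp1 : ‖p‖ < 1) (hq1 : ‖q‖ < 1) (x : ℂ) :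
    dFac p q x = qFac q x * dFac p q (p * x) := by
  rw [dFac_swap, dFac_step hq1 hp1, dFac_swap]

/-! ### Theta functions -/

lemma theta_differentiableAt (hq1 : ‖q‖ < 1) {x : ℂ} (hx : x ≠ 0) :
    DifferentiableAt ℂ (theta q) x := by
  have := differentiable_qFac hq1
  exact (this x).mul ((this _).comp x (by fun_prop (disch := exact hx)))

lemma theta_one (hq1 : ‖q‖ < 1) : theta q 1 = 0 := by
  have : qFac q 1 = 0 := (qFac_eq_zero_iff hq1 1).2 ⟨0, by simp⟩
  simp [theta, this]

lemma theta_div_self (hq0 : q ≠ 0) (x : ℂ) : theta q (q / x) = theta q x := by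
  rw [theta, theta, mul_comm, div_div_cancel₀ hq0]

lemma theta_mul_self (hq0 : q ≠ 0) (hq1 : ‖q‖ < 1) {x : ℂ} (hx : x ≠ 0) :
    theta q (q * x) = -x⁻¹ * theta q x := by
  have h1 := qFac_step hq1 x
  have h2 := qFac_step hq1 (1 / x)
  have e1 : q / (q * x) = 1 / x := by field_simp
  have e2 : q * (1 / x) = q / x := by ring
  rw [theta, theta, h1, e1, h2, e2]
  field_simp
  ring

lemma theta_inv (hq0 : q ≠ 0) (hq1 : ‖q‖ < 1) {x : ℂ} (hx : x ≠ 0) :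
    theta q x⁻¹ = -x⁻¹ * theta q x := by
  rw [← theta_mul_self hq0 hq1 hx, ← theta_div_self hq0]
  simp

lemma theta_div_comm (hq0 : q ≠ 0) (hq1 : ‖q‖ < 1) {x y : ℂ} (hx : x ≠ 0) (hy : y ≠ 0) :
    theta q (x / y) = -(x / y) * theta q (y / x) := by
  have := theta_inv hq0 hq1 (div_ne_zero hy hx)
  rw [inv_div] at this
  exact this

lemma theta_div_base (hq0 : q ≠ 0) (hq1 : ‖q‖ < 1) {x : ℂ} (hx : x ≠ 0) :
    theta q (x / q) = -(x / q) * theta q x := by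
  have h := theta_mul_self hq0 hq1 (div_ne_zero hx hq0)
  rw [mul_div_cancel₀ _ hq0] at h
  rw [h]
  field_simp

lemma theta_eq_zero_iff (hq0 : q ≠ 0) (hq1 : ‖q‖ < 1) {x : ℂ} (hx : x ≠ 0) :
    theta q x = 0 ↔ ∃ k : ℤ, x = q ^ k := by
  rw [theta, mul_eq_zero, qFac_eq_zero_iff hq1, qFac_eq_zero_iff hq1]
  constructor
  · rintro (⟨k, hk⟩ | ⟨k, hk⟩)
    · exact ⟨-k, by rw [zpow_neg, zpow_natCast]; exact eq_inv_of_mul_eq_one_right hk⟩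
    · refine ⟨k + 1, ?_⟩
      rw [zpow_add_one₀ hq0, zpow_natCast]
      field_simp at hk
      exact hk.symm
  · rintro ⟨k, rfl⟩
    rcases k with k | k
    · rcases k with _ | k
      · left; exact ⟨0, by simp⟩
      · right
        refine ⟨k, ?_⟩
        simp only [Int.ofNat_eq_natCast, zpow_natCast, pow_succ]
        field_simp
    · left
      exact ⟨k + 1, by rw [zpow_negSucc]; exact mul_inv_cancel₀ (pow_ne_zero _ hq0)⟩

lemma theta_ne_zero_of_norm (hq1 : ‖q‖ < 1) {x : ℂ} (h1 : ‖q‖ < ‖x‖)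
    (h2 : ‖x‖ < 1) : theta q x ≠ 0 := by
  have hx : 0 < ‖x‖ := (norm_nonneg _).trans_lt h1
  refine mul_ne_zero (qFac_ne_zero hq1 h2) (qFac_ne_zero hq1 ?_)
  rw [norm_div, div_lt_one hx]
  exact h1

/-! ### The elliptic Gamma function -/

lemma ellGamma_eq (hp1 : ‖p‖ < 1) (hq1 : ‖q‖ < 1) (x : ℂ) :
    ellGamma x p q = dFac p q (p * q / x) / dFac p q x := by
  by_cases h : dFac p q x = 0
  · obtain ⟨jk, hjk⟩ := (dFac_eq_zero_iff hp1 hq1 x).1 h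
    rw [h, div_zero]
    exact tprod_of_exists_eq_zero ⟨jk, by simp [hjk]⟩
  · rw [dFac, dFac, ← (multipliable_one_sub_mul (summable_norm_pow_mul_pow hp1 hq1) _).tprod_div₀
      (multipliable_one_sub_mul (summable_norm_pow_mul_pow hp1 hq1) _) h, ellGamma]
    congr! 4 with jk
    ring

lemma ellGamma_mul (hp1 : ‖p‖ < 1) (hq0 : q ≠ 0) (hq1 : ‖q‖ < 1) {x : ℂ}
    (h1 : ‖x‖ < 1) : ellGamma (q * x) p q = theta p x * ellGamma x p q := by
  have h := qFac_ne_zero hp1 h1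
  have h' := dFac_ne_zero hp1 hq1 h1
  have e := dFac_step hp1 hq1 x
  have h'' : dFac p q (q * x) ≠ 0 := fun h0 => h' (by rw [e, h0, mul_zero])
  rw [ellGamma_eq hp1 hq1, ellGamma_eq hp1 hq1, theta]
  have e1 : p * q / (q * x) = p / x := by field_simp
  have e2 : q * (p / x) = p * q / x := by ring
  rw [e1, dFac_step hp1 hq1 (p / x), e2, e]
  field_simp

lemma ellGamma_reflection (hp0 : p ≠ 0) (hp1 : ‖p‖ < 1) (hq0 : q ≠ 0) (hq1 : ‖q‖ < 1) {x y : ℂ}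
    (hxy : x * y = p * q) (hx : ‖x‖ < 1) (hy : ‖y‖ < 1) :
    ellGamma x p q * ellGamma y p q = 1 := by
  have h0 : x * y ≠ 0 := by rw [hxy]; exact mul_ne_zero hp0 hq0
  have e1 : p * q / x = y := by rw [← hxy]; field_simp [left_ne_zero_of_mul h0]
  have e2 : p * q / y = x := by rw [← hxy]; field_simp [right_ne_zero_of_mul h0]
  have h1 := dFac_ne_zero hp1 hq1 hx
  have h2 := dFac_ne_zero hp1 hq1 hy
  rw [ellGamma_eq hp1 hq1, ellGamma_eq hp1 hq1, e1, e2]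
  field_simp

lemma ellGamma_mul_inv (hp1 : ‖p‖ < 1) (hq1 : ‖q‖ < 1) {x : ℂ}
    (hx : ‖x‖ = 1) :
    (ellGamma x p q * ellGamma x⁻¹ p q)⁻¹ = theta p x * theta q x⁻¹ := by
  have hx0 : x ≠ 0 := by rintro rfl; simp at hx
  have hpq : ‖p * q‖ < 1 := by
    rw [norm_mul]; exact mul_lt_one_of_nonneg_of_lt_one_left (norm_nonneg _) hp1 hq1.le
  have h1 : dFac p q (p * q / x) ≠ 0 := dFac_ne_zero hp1 hq1 (by simpa [hx] using hpq)
  have h2 : dFac p q (p * q * x) ≠ 0 := dFac_ne_zero hp1 hq1 (by simpa [hx] using hpq)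
  have e1 : dFac p q x = qFac p x * (qFac q (q * x) * dFac p q (p * q * x)) := by
    rw [dFac_step hp1 hq1, dFac_step' hp1 hq1 (q * x), mul_assoc p]
  have e2 : dFac p q x⁻¹ = qFac q x⁻¹ * (qFac p (p / x) * dFac p q (p * q / x)) := by
    rw [dFac_step' hp1 hq1, dFac_step hp1 hq1 (p * x⁻¹)]
    congr 3
    · ring
  rw [ellGamma_eq hp1 hq1, ellGamma_eq hp1 hq1, div_inv_eq_mul, theta, theta, e1, e2,
    div_inv_eq_mul,
    div_mul_div_comm, inv_div]
  generalize dFac p q (p * q / x) = A at *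
  generalize dFac p q (p * q * x) = B at *
  field_simp

lemma ellGamma_ne_zero (hp1 : ‖p‖ < 1) (hq1 : ‖q‖ < 1) {x : ℂ}
    (h1 : ‖p * q‖ < ‖x‖) (h2 : ‖x‖ < 1) : ellGamma x p q ≠ 0 := by
  rw [ellGamma_eq hp1 hq1]
  refine div_ne_zero (dFac_ne_zero hp1 hq1 ?_) (dFac_ne_zero hp1 hq1 h2)
  rw [norm_div, div_lt_one ((norm_nonneg _).trans_lt h1)]
  exact h1

lemma differentiableAt_ellGamma (hp1 : ‖p‖ < 1) (hq1 : ‖q‖ < 1) {x : ℂ}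
    (h0 : x ≠ 0) (h1 : ‖x‖ < 1) : DifferentiableAt ℂ (fun x => ellGamma x p q) x := by
  have h := differentiable_dFac hp1 hq1
  simp only [ellGamma_eq hp1 hq1]
  exact ((h _).comp x (by fun_prop (disch := exact h0))).div (h x) (dFac_ne_zero hp1 hq1 h1)

/-- The elliptic Gamma function with its pole at `x = 1` removed. -/
noncomputable def regGamma (p q x : ℂ) : ℂ :=
  dFac p q (p * q / x) / (qFac p (p * x) * dFac p q (q * x))

lemma regGamma_eq (hp1 : ‖p‖ < 1) (hq1 : ‖q‖ < 1) (x : ℂ) :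
    ellGamma x p q = regGamma p q x / (1 - x) := by
  rw [ellGamma_eq hp1 hq1, regGamma, dFac_step hp1 hq1 x, qFac_step hp1, div_div]
  ring

lemma regGamma_denom_ne_zero (hp1 : ‖p‖ < 1) (hq1 : ‖q‖ < 1) {x : ℂ} (hx : ‖x‖ ≤ 1) :
    qFac p (p * x) * dFac p q (q * x) ≠ 0 := by
  refine mul_ne_zero (qFac_ne_zero hp1 ?_) (dFac_ne_zero hp1 hq1 ?_)
  · rw [norm_mul]; exact mul_lt_one_of_nonneg_of_lt_one_left (norm_nonneg _) hp1 hx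
  · rw [norm_mul]; exact mul_lt_one_of_nonneg_of_lt_one_left (norm_nonneg _) hq1 hx

lemma continuousAt_regGamma (hp1 : ‖p‖ < 1) (hq1 : ‖q‖ < 1) {x : ℂ}
    (h0 : x ≠ 0) (h1 : ‖x‖ ≤ 1) : ContinuousAt (regGamma p q) x := by
  have h := (differentiable_dFac hp1 hq1).continuous
  have h' := (differentiable_qFac hp1).continuous
  refine ContinuousAt.div ?_ ?_ (regGamma_denom_ne_zero hp1 hq1 h1)
  · exact h.continuousAt.comp (by fun_prop (disch := exact h0))
  · fun_prop

lemma qPoch_eq (q : ℂ) : qPoch q = qFac q q := by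
  simp [qPoch, qFac, pow_succ]

lemma qPoch_ne_zero (hq1 : ‖q‖ < 1) : qPoch q ≠ 0 := by
  rw [qPoch_eq]; exact qFac_ne_zero hq1 hq1

lemma regGamma_one (hp1 : ‖p‖ < 1) (hq1 : ‖q‖ < 1) :
    regGamma p q 1 = (qPoch p * qPoch q)⁻¹ := by
  have hpq : ‖p * q‖ < 1 := by
    rw [norm_mul]; exact mul_lt_one_of_nonneg_of_lt_one_left (norm_nonneg _) hp1 hq1.le
  have h := dFac_ne_zero hp1 hq1 hpq
  have h1 := qPoch_ne_zero hp1
  have h2 := qPoch_ne_zero hq1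
  simp only [regGamma, mul_one, div_one]
  rw [dFac_step' hp1 hq1 q, ← qPoch_eq, ← qPoch_eq]
  field_simp

/-! ### Integration over the unit circle -/

instance : Fact (0 < 2 * π) := ⟨Real.two_pi_pos⟩

/-- The circle group `ℝ / 2πℤ`. -/
abbrev Circ := AddCircle (2 * π)

/-- The normalized Haar measure on the circle. -/
noncomputable abbrev circMeasure : Measure Circ := AddCircle.haarAddCircle

/-- The standard embedding of the circle into `ℂ`. -/
noncomputable def cis (x : Circ) : ℂ := AddCircle.toCircle x

@[simp] lemma norm_cis (x : Circ) : ‖cis x‖ = 1 := Circle.norm_coe _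

@[simp] lemma cis_ne_zero (x : Circ) : cis x ≠ 0 := Circle.coe_ne_zero _

lemma cis_add (x y : Circ) : cis (x + y) = cis x * cis y := by
  simp [cis, AddCircle.toCircle_add]

lemma cis_neg (x : Circ) : cis (-x) = (cis x)⁻¹ := by
  simp [cis, AddCircle.toCircle_neg]

@[fun_prop]
lemma continuous_cis : Continuous cis :=
  continuous_subtype_val.comp AddCircle.continuous_toCircle

lemma cis_coe (θ : ℝ) : cis (θ : Circ) = Complex.exp (Complex.I * θ) := by
  rw [cis, AddCircle.toCircle_apply_mk, Circle.coe_exp]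
  rw [div_self Real.two_pi_pos.ne']
  simp [mul_comm]

lemma cis_injective : Function.Injective cis :=
  Subtype.val_injective.comp (AddCircle.injective_toCircle Real.two_pi_pos.ne')

lemma exists_cis_eq {u : ℂ} (hu : ‖u‖ = 1) : ∃ x, cis x = u := by
  refine ⟨(Complex.arg u : ℝ), ?_⟩
  rw [cis_coe, mul_comm]
  simpa [hu] using Complex.norm_mul_exp_arg_mul_I u

lemma integral_cis (G : ℂ → ℂ) :
    ∫ x, G (cis x) ∂circMeasure = Real.circleAverage G 0 1 := by
  rw [AddCircle.integral_haarAddCircle, ← AddCircle.intervalIntegral_preimage _ 0,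
    Real.circleAverage_def]
  simp [cis_coe, circleMap, mul_comm]

lemma integral_shift {G : ℂ → ℂ} {c : ℂ} (hc0 : c ≠ 0) (hc1 : ‖c‖ ≤ 1)
    (hG : ∀ z, ‖c‖ ≤ ‖z‖ → ‖z‖ ≤ 1 → DifferentiableAt ℂ G z) :
    ∫ x, G (c * cis x) ∂circMeasure = ∫ x, G (cis x) ∂circMeasure := by
  have hc : 0 < ‖c‖ := norm_pos_iff.2 hc0
  obtain ⟨x₀, hx₀⟩ := exists_cis_eq (u := c / ‖c‖) (by simp [hc0])
  have e1 : ∀ x, c * cis x = ‖c‖ * cis (x₀ + x) := fun x => by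
    have : (‖c‖ : ℂ) ≠ 0 := by exact_mod_cast hc.ne'
    rw [cis_add, hx₀]; field_simp
  simp only [e1]
  rw [integral_add_left_eq_self fun x => G (‖c‖ * cis x),
    integral_cis fun z => G (‖c‖ * z), integral_cis]
  have e2 : Real.circleAverage (fun z => G (‖c‖ * z)) 0 1 = Real.circleAverage G 0 ‖c‖ := by
    simp [Real.circleAverage_def, circleMap]
  rw [e2, Real.circleAverage_eq_circleIntegral hc.ne',
    Real.circleAverage_eq_circleIntegral one_ne_zero,
    Complex.circleIntegral_sub_center_inv_smul_eq_of_differentiable_on_annulus_off_countable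
      hc hc1 Set.countable_empty]
  · intro z hz
    refine (hG z ?_ ?_).continuousAt.continuousWithinAt
    · simpa using hz.2
    · simpa using hz.1
  · intro z hz
    refine hG z ?_ ?_
    · simpa using (not_le.1 fun h => hz.1.2 (by simpa using h)).le
    · simpa using (mem_ball_zero_iff.1 hz.1.1).le

lemma integral_neg_cis (G : ℂ → ℂ) :
    ∫ x, G (cis x)⁻¹ ∂circMeasure = ∫ x, G (cis x) ∂circMeasure := by
  simp only [← cis_neg]
  exact integral_neg_eq_self (fun x => G (cis x)) circMeasure

lemma integral_shift_of_ne_zero {G : ℂ → ℂ} {c : ℂ} (hc : c ≠ 0)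
    (hG : ∀ z ≠ 0, DifferentiableAt ℂ G z) :
    ∫ x, G (c * cis x) ∂circMeasure = ∫ x, G (cis x) ∂circMeasure := by
  have hpos : ∀ {z : ℂ} {r : ℝ}, 0 < r → r ≤ ‖z‖ → z ≠ 0 := fun h h' =>
    norm_pos_iff.1 (h.trans_le h')
  rcases le_total ‖c‖ 1 with h | h
  · exact integral_shift hc h fun z hz _ => hG z (hpos (norm_pos_iff.2 hc) hz)
  · have hc' : c⁻¹ ≠ 0 := inv_ne_zero hc
    have := integral_shift (G := fun z => G (c * z)) hc' (by simpa using inv_le_one_of_one_le₀ h)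
      fun z hz _ => (hG _ (mul_ne_zero hc (hpos (norm_pos_iff.2 hc') hz))).comp z (by fun_prop)
    simpa [hc] using this.symm

/-- A function holomorphic on `ℂ \ {0}` all of whose Laurent coefficients vanish is zero. -/
lemma eq_zero_of_forall_integral_eq_zero {G : ℂ → ℂ} (hG : ∀ z ≠ 0, DifferentiableAt ℂ G z)
    (h : ∀ n : ℤ, ∫ x, G (cis x) * cis x ^ n ∂circMeasure = 0) {z : ℂ} (hz : z ≠ 0) :
    G z = 0 := by
  have hz' : ∀ x, z * cis x ≠ 0 := fun x => mul_ne_zero hz (cis_ne_zero x)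
  let f : C(Circ, ℂ) := ⟨fun x => G (z * cis x), continuous_iff_continuousAt.2 fun x =>
    ContinuousAt.comp (f := fun x => z * cis x) (hG _ (hz' x)).continuousAt (by fun_prop)⟩
  have hf : ∀ n, fourierCoeff f n = 0 := fun n => by
    have e : ∀ x : Circ, fourier (-n) x • f x =
        z ^ n * (fun w => G w * w ^ (-n)) (z * cis x) := fun x => by
      have : fourier (-n) x = cis x ^ (-n) := by
        rw [fourier_apply, AddCircle.toCircle_zsmul, Circle.coe_zpow, cis]
      rw [this]
      simp only [f, ContinuousMap.coe_mk, smul_eq_mul, mul_zpow, zpow_neg]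
      field_simp
    simp only [fourierCoeff, e]
    rw [integral_const_mul, integral_shift_of_ne_zero (G := fun w => G w * w ^ (-n)) hz
      fun w hw => (hG w hw).mul (differentiableAt_zpow.2 (.inl hw)), h, mul_zero]
  have hsum := has_pointwise_sum_fourier_series_of_summable (f := f)
    (by rw [show fourierCoeff f = 0 from funext hf]; exact summable_zero) 0
  simp only [hf, zero_smul] at hsum
  simpa [f, cis] using hsum.unique hasSum_zero

/-! ### Theta function identities -/

lemma continuous_comp_cis {G : ℂ → ℂ} (hG : ∀ z ≠ 0, DifferentiableAt ℂ G z) :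
    Continuous fun x => G (cis x) :=
  continuous_iff_continuousAt.2 fun x =>
    ContinuousAt.comp (f := cis) (hG _ (cis_ne_zero x)).continuousAt (by fun_prop)

/-- Holomorphic functions on `ℂ \ {0}` with a given degree two multiplier form a space of
dimension at most two. -/
lemma exists_linear_relation (hp0 : p ≠ 0) {κ : ℂ} (hκ : κ ≠ 0) {g : Fin 3 → ℂ → ℂ}
    (hg : ∀ i, ∀ z ≠ 0, DifferentiableAt ℂ (g i) z)
    (hgp : ∀ i, ∀ z ≠ 0, g i (p * z) = κ * z ^ (-2 : ℤ) * g i z) :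
    ∃ c : Fin 3 → ℂ, c ≠ 0 ∧ ∀ z ≠ 0, ∑ i, c i * g i z = 0 := by
  let a : ℤ → Fin 3 → ℂ := fun n i => ∫ x, g i (cis x) * cis x ^ n ∂circMeasure
  let M : Matrix (Fin 2) (Fin 3) ℂ := Matrix.of fun j i => a (j : ℕ) i
  have hker : LinearMap.ker M.mulVecLin ≠ ⊥ := by
    apply LinearMap.ker_ne_bot_of_finrank_lt
    simp
  obtain ⟨c, hc, hc0⟩ := (Submodule.ne_bot_iff _).1 hker
  refine ⟨c, hc0, ?_⟩
  let G : ℂ → ℂ := fun z => ∑ i, c i * g i z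
  have hG : ∀ z ≠ 0, DifferentiableAt ℂ G z := fun z hz => by
    have := fun i => hg i z hz
    fun_prop
  let b : ℤ → ℂ := fun n => ∫ x, G (cis x) * cis x ^ n ∂circMeasure
  have hb : ∀ n, b n = ∑ i, c i * a n i := fun n => by
    simp only [b, G, a, Finset.sum_mul]
    rw [integral_finsetSum]
    · simp only [mul_assoc, integral_const_mul]
    · intro i _
      refine (Continuous.mul ?_ ?_).integrable_of_hasCompactSupport
        (HasCompactSupport.of_compactSpace _)
      · exact continuous_const.mul (continuous_comp_cis (hg i))
      · exact continuous_comp_cis fun z hz => differentiableAt_zpow.2 (.inl hz)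
  have hzero : ∀ j : Fin 2, b (j : ℕ) = 0 := fun j => by
    have := congrFun (LinearMap.mem_ker.1 hc) j
    rw [hb]
    simpa [M, Matrix.mulVec, dotProduct, mul_comm] using this
  have hrec : ∀ n, b n = κ * p ^ n * b (n - 2) := fun n => by
    have h := integral_shift_of_ne_zero (G := fun z => G z * z ^ n) hp0
      fun z hz => (hG z hz).mul (differentiableAt_zpow.2 (.inl hz))
    simp only [b]
    rw [← h, ← integral_const_mul]
    congr 1 with x
    have : G (p * cis x) = κ * cis x ^ (-2 : ℤ) * G (cis x) := by
      simp only [G, Finset.mul_sum]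
      refine Finset.sum_congr rfl fun i _ => ?_
      rw [hgp i _ (cis_ne_zero x)]
      ring
    rw [this, mul_zpow, sub_eq_add_neg, zpow_add₀ (cis_ne_zero x)]
    ring
  have hall : ∀ n : ℕ, (b n = 0 ∧ b (n + 1 : ℕ) = 0) ∧
      (b (-n) = 0 ∧ b (-n + 1) = 0) := by
    intro n
    induction n with
    | zero => exact ⟨⟨hzero 0, hzero 1⟩, hzero 0, hzero 1⟩
    | succ n ih =>
      refine ⟨⟨ih.1.2, ?_⟩, ?_, ?_⟩
      · rw [hrec]
        have : ((n + 1 + 1 : ℕ) : ℤ) - 2 = n := by push_cast; ring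
        rw [this, ih.1.1, mul_zero]
      · have h := hrec (-n + 1)
        rw [ih.2.2, show (-n + 1 : ℤ) - 2 = -(n + 1 : ℕ) by push_cast; ring] at h
        exact (mul_eq_zero.1 h.symm).resolve_left (mul_ne_zero hκ (zpow_ne_zero _ hp0))
      · rw [show -((n + 1 : ℕ) : ℤ) + 1 = -n by push_cast; ring]
        exact ih.2.1
  intro z hz
  refine eq_zero_of_forall_integral_eq_zero hG (fun n => ?_) hz
  obtain ⟨m, rfl | rfl⟩ := n.eq_nat_or_neg
  · exact (hall m).1.1
  · exact (hall m).2.1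

lemma theta_pair_expansion (hp0 : p ≠ 0) (hp1 : ‖p‖ < 1) {c e u w : ℂ} (hc : c ≠ 0) (he : e ≠ 0)
    (hu : u ≠ 0) (hw : w ≠ 0) (huw : theta p (u / w) ≠ 0) (hcuw : theta p (c / (u * w)) ≠ 0) :
    ∃ A B : ℂ, ∀ x ≠ 0, theta p (x * e) * theta p (x * (c / e)) =
      A * (theta p (x * u) * theta p (x * (c / u))) +
        B * (theta p (x * w) * theta p (x * (c / w))) := by
  let v : Fin 3 → ℂ := ![e, u, w]
  have hv : ∀ i, v i ≠ 0 := by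
    intro i; fin_cases i <;> assumption
  obtain ⟨d, hd0, hd⟩ := exists_linear_relation (κ := c⁻¹) hp0 (inv_ne_zero hc)
    (g := fun i x => theta p (x * v i) * theta p (x * (c / v i))) (fun i z hz => by
      have h1 := theta_differentiableAt hp1 (mul_ne_zero hz (hv i))
      have h2 := theta_differentiableAt hp1 (mul_ne_zero hz (div_ne_zero hc (hv i)))
      exact (h1.comp (f := fun z => z * v i) z (by fun_prop)).mul
        (h2.comp (f := fun z => z * (c / v i)) z (by fun_prop)))
    (fun i z hz => by
      have := hv i
      rw [mul_assoc p, mul_assoc p, theta_mul_self hp0 hp1 (by positivity),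
        theta_mul_self hp0 hp1 (by positivity)]
      field_simp)
  simp only [Fin.sum_univ_three, v, Matrix.cons_val] at hd
  have hwu : theta p (w / u) ≠ 0 := by
    rw [theta_div_comm hp0 hp1 hw hu]
    exact mul_ne_zero (neg_ne_zero.2 (by positivity)) huw
  have h0 : d 0 ≠ 0 := by
    intro h0
    have h1 := hd u⁻¹ (by positivity)
    have h2 := hd w⁻¹ (by positivity)
    have e1 : u⁻¹ * u = 1 := by field_simp
    have e2 : w⁻¹ * w = 1 := by field_simp
    have e3 : u⁻¹ * w = w / u := by field_simp
    have e4 : w⁻¹ * u = u / w := by field_simp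
    have e5 : u⁻¹ * (c / w) = c / (u * w) := by field_simp
    have e6 : w⁻¹ * (c / u) = c / (u * w) := by field_simp
    rw [h0, e1, e3, e5, theta_one hp1] at h1
    rw [h0, e2, e4, e6, theta_one hp1] at h2
    simp [hwu, huw, hcuw] at h1 h2
    apply hd0
    ext i
    fin_cases i <;> simp [h0, h1, h2]
  refine ⟨-(d 1 / d 0), -(d 2 / d 0), fun x hx => ?_⟩
  have := hd x hx
  generalize theta p (x * e) * theta p (x * (c / e)) = X at this ⊢
  generalize theta p (x * u) * theta p (x * (c / u)) = Y at this ⊢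
  generalize theta p (x * w) * theta p (x * (c / w)) = Z at this ⊢
  field_simp
  linear_combination this

theorem sum_prod_theta_div_eq_zero (hp0 : p ≠ 0) (hp1 : ‖p‖ < 1) {ι : Type*} [DecidableEq ι]
    {s : Finset ι} {x : ι → ℂ} (hx : ∀ i, x i ≠ 0) {E : List ℂ} (hE : ∀ e ∈ E, e ≠ 0)
    (hcard : E.length = s.card) (h2 : 2 ≤ s.card)
    (hne : ∀ i ∈ s, ∀ j ∈ s, i ≠ j → theta p (x i / x j) ≠ 0)
    (hprod : (∏ i ∈ s, x i) * E.prod = 1) :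
    ∑ k ∈ s, (E.map fun e => theta p (x k * e)).prod / ∏ j ∈ s.erase k, theta p (x k / x j) = 0 := by
  obtain ⟨m, hm⟩ : ∃ m, s.card = m + 2 := ⟨s.card - 2, by omega⟩
  clear h2
  induction m generalizing s E with
  | zero =>
    obtain ⟨i, j, hij, rfl⟩ := Finset.card_eq_two.1 hm
    obtain ⟨e, f, rfl⟩ := List.length_eq_two.1 (hcard.trans hm)
    have he := hE e (by simp)
    have hf := hE f (by simp)
    have hi := hx i
    have hj := hx j
    have hnij := hne i (by simp) j (by simp) hij
    rw [Finset.prod_pair hij] at hprod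
    simp only [List.prod_cons, List.prod_nil, mul_one] at hprod
    rw [Finset.sum_pair hij, Finset.erase_insert (by simpa using hij), Finset.pair_comm,
      Finset.erase_insert (by simpa using hij.symm)]
    simp only [List.map_cons, List.map_nil, List.prod_cons, List.prod_nil, mul_one,
      Finset.prod_singleton]
    have e1 : x j * e = (x i * f)⁻¹ := eq_inv_of_mul_eq_one_left (by linear_combination hprod)
    have e2 : x j * f = (x i * e)⁻¹ := eq_inv_of_mul_eq_one_left (by linear_combination hprod)
    rw [e1, e2, theta_inv hp0 hp1 (by positivity), theta_inv hp0 hp1 (by positivity),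
      theta_div_comm hp0 hp1 hj hi]
    field_simp
    linear_combination (theta p (x i * e) * theta p (x i * f)) * hprod
  | succ m ih =>
    obtain ⟨e, f, E, rfl⟩ : ∃ e f E', E = e :: f :: E' := by
      match E, hcard.trans hm with
      | e :: f :: E', _ => exact ⟨e, f, E', rfl⟩
    have he := hE e (by simp)
    have hf := hE f (by simp)
    obtain ⟨i, hi⟩ : s.Nonempty := Finset.card_pos.1 (by omega)
    obtain ⟨j, hj, hij, hbad⟩ : ∃ j ∈ s, i ≠ j ∧ theta p (e * f * x i * x j) ≠ 0 := by
      have hc : 1 < (s.erase i).card := by rw [Finset.card_erase_of_mem hi]; omega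
      obtain ⟨j, hj, k, hk, hjk⟩ := Finset.one_lt_card.1 hc
      rw [Finset.mem_erase] at hj hk
      by_contra! hcon
      have hxi := hx i
      have hxj := hx j
      have hxk := hx k
      obtain ⟨a, ha⟩ := (theta_eq_zero_iff hp0 hp1 (by positivity)).1 (hcon j hj.2 hj.1.symm)
      obtain ⟨b, hb⟩ := (theta_eq_zero_iff hp0 hp1 (by positivity)).1 (hcon k hk.2 hk.1.symm)
      refine hne j hj.2 k hk.2 hjk ((theta_eq_zero_iff hp0 hp1 (by positivity)).2 ⟨a - b, ?_⟩)
      rw [zpow_sub₀ hp0, ← ha, ← hb]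
      field_simp
    have hxi := hx i
    have hxj := hx j
    have reduce : ∀ l ∈ s, ∑ k ∈ s, (theta p (x k * (x l)⁻¹) * theta p (x k * (e * f / (x l)⁻¹)) *
        (E.map fun e => theta p (x k * e)).prod) / ∏ j ∈ s.erase k, theta p (x k / x j) = 0 := by
      intro l hl
      have hxl := hx l
      have hcl : (s.erase l).card = m + 2 := by rw [Finset.card_erase_of_mem hl]; omega
      have h := ih (s := s.erase l) (E := (e * f * x l) :: E) (by
          intro a ha
          rcases List.mem_cons.1 ha with rfl | ha
          · positivity
          · exact hE a (by simp [ha]))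
        (by simp only [List.length_cons] at hcard ⊢; omega)
        (fun a ha b hb => hne a (Finset.mem_of_mem_erase ha) b (Finset.mem_of_mem_erase hb))
        (by
          rw [← hprod, ← Finset.mul_prod_erase s x hl]
          simp only [List.prod_cons]
          ring) hcl
      rw [← Finset.add_sum_erase s _ hl, mul_inv_cancel₀ hxl, theta_one hp1]
      simp only [zero_mul, zero_div, zero_add]
      refine Eq.trans (Finset.sum_congr rfl fun k hk => ?_) h
      have hkl := Finset.ne_of_mem_erase hk
      have hlk : l ∈ s.erase k := Finset.mem_erase.2 ⟨hkl.symm, hl⟩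
      rw [← Finset.mul_prod_erase _ _ hlk, Finset.erase_right_comm, ← div_eq_mul_inv, mul_assoc,
        mul_div_mul_left _ _ (hne k (Finset.mem_of_mem_erase hk) l hl hkl)]
      simp only [List.map_cons, List.prod_cons, div_inv_eq_mul]
    obtain ⟨A, B, hAB⟩ := theta_pair_expansion hp0 hp1 (c := e * f) (e := e) (u := (x i)⁻¹)
      (w := (x j)⁻¹) (by positivity) he (by positivity) (by positivity)
      (by
        rw [inv_div_inv]
        exact hne j hj i hi hij.symm)
      (by
        rw [← mul_inv, div_inv_eq_mul, ← mul_assoc]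
        exact hbad)
    have hsum : ∀ k, ((e :: f :: E).map fun e => theta p (x k * e)).prod =
        A * (theta p (x k * (x i)⁻¹) * theta p (x k * (e * f / (x i)⁻¹)) *
          (E.map fun e => theta p (x k * e)).prod) +
        B * (theta p (x k * (x j)⁻¹) * theta p (x k * (e * f / (x j)⁻¹)) *
          (E.map fun e => theta p (x k * e)).prod) := fun k => by
      have := hAB (x k) (hx k)
      rw [mul_div_cancel_left₀ _ he] at this
      simp only [List.map_cons, List.prod_cons]
      linear_combination (E.map fun e => theta p (x k * e)).prod * this
    simp only [hsum, add_div, Finset.sum_add_distrib, mul_div_assoc A, mul_div_assoc B,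
      ← Finset.mul_sum]
    rw [reduce i hi, reduce j hj]
    ring

theorem sum_mul_prod_theta_div_eq_zero (hp0 : p ≠ 0) (hp1 : ‖p‖ < 1) {ι : Type*} [DecidableEq ι]
    {s : Finset ι} {x : ι → ℂ} (hx : ∀ i, x i ≠ 0) {E : List ℂ} (hE : ∀ e ∈ E, e ≠ 0)
    (hcard : E.length = s.card) (h2 : 2 ≤ s.card)
    (hne : ∀ i ∈ s, ∀ j ∈ s, i ≠ j → theta p (x i / x j) ≠ 0)
    (hprod : (∏ i ∈ s, x i) * E.prod = p) :
    ∑ k ∈ s, x k * (E.map fun e => theta p (x k * e)).prod /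
      ∏ j ∈ s.erase k, theta p (x k / x j) = 0 := by
  match E, hcard with
  | [], h => simp at h; omega
  | e :: E, h =>
    have he := hE e (by simp)
    have key := sum_prod_theta_div_eq_zero hp0 hp1 hx (E := e / p :: E) (by
        intro a ha
        rcases List.mem_cons.1 ha with rfl | ha
        · positivity
        · exact hE a (by simp [ha])) (by simpa using h) h2 hne
        (by
          rw [List.prod_cons] at hprod ⊢
          field_simp
          linear_combination hprod)
    have hep : -(e / p) ≠ 0 := by simp [he, hp0]
    refine (mul_eq_zero.1 (Eq.trans ?_ key)).resolve_left hep
    rw [Finset.mul_sum]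
    refine Finset.sum_congr rfl fun k _ => ?_
    rw [List.map_cons, List.map_cons, List.prod_cons, List.prod_cons, ← mul_div_assoc (x k),
      theta_div_base hp0 hp1 (mul_ne_zero (hx k) he)]
    ring

/-! ### The integrand -/

/-- The reciprocal of `Γ(x;p,q) Γ(1/x;p,q)`, as an entire expression in theta functions. -/
noncomputable def vfac (p q x : ℂ) : ℂ := theta p x * theta q x⁻¹

/-- `Γ(s x^{±1};p,q)`. -/
noncomputable def gpair (p q s x : ℂ) : ℂ := ellGamma (s * x) p q * ellGamma (s / x) p q

/-- `∏_{s ∈ L} Γ(s x^{±1};p,q)`. -/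
noncomputable def wt (p q : ℂ) (L : List ℂ) (x : ℂ) : ℂ := (L.map fun s => gpair p q s x).prod

/-- `∏_{i<j} h(z_i z_j) h(z_i/z_j)`. -/
noncomputable def pairs (h : ℂ → ℂ) {n : ℕ} (z : Fin n → ℂ) : ℂ :=
  ∏ i, ∏ j, if i < j then h (z i * z j) * h (z i / z j) else 1

/-- The integrand without the interaction factors `Γ(t z_i^{±1} z_j^{±1};p,q)`. -/
noncomputable def dens (p q : ℂ) (L : List ℂ) {n : ℕ} (z : Fin n → ℂ) : ℂ :=
  pairs (vfac p q) z * ∏ i, (vfac p q (z i ^ 2) * wt p q L (z i))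

/-- The `n`-dimensional torus. -/
abbrev Torus (n : ℕ) := Fin n → Circ

/-- The normalized Haar measure on the torus. -/
noncomputable abbrev torusMeasure (n : ℕ) : Measure (Torus n) :=
  Measure.pi fun _ => circMeasure

/-- The embedding of the torus into `ℂ^n`. -/
noncomputable def pt {n : ℕ} (x : Torus n) (i : Fin n) : ℂ := cis (x i)

@[simp] lemma norm_pt {n : ℕ} (x : Torus n) (i : Fin n) : ‖pt x i‖ = 1 := norm_cis _

@[simp] lemma pt_ne_zero {n : ℕ} (x : Torus n) (i : Fin n) : pt x i ≠ 0 := cis_ne_zero _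

@[fun_prop]
lemma continuous_pt {n : ℕ} (i : Fin n) : Continuous fun x : Torus n => pt x i := by
  unfold pt; fun_prop

section Continuity

variable {X : Type*} [TopologicalSpace X] {f g : X → ℂ} {x₀ : X}

lemma continuousAt_theta_comp (hq1 : ‖q‖ < 1) (hf : ContinuousAt f x₀) (h0 : f x₀ ≠ 0) :
    ContinuousAt (fun x => theta q (f x)) x₀ :=
  (theta_differentiableAt hq1 h0).continuousAt.comp hf

lemma continuousAt_vfac_comp (hp1 : ‖p‖ < 1) (hq1 : ‖q‖ < 1) (hf : ContinuousAt f x₀)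
    (h0 : f x₀ ≠ 0) : ContinuousAt (fun x => vfac p q (f x)) x₀ :=
  (continuousAt_theta_comp hp1 hf h0).mul
    (continuousAt_theta_comp hq1 (hf.inv₀ h0) (inv_ne_zero h0))

lemma continuousAt_ellGamma_comp (hp1 : ‖p‖ < 1) (hq1 : ‖q‖ < 1) (hf : ContinuousAt f x₀)
    (h0 : f x₀ ≠ 0) (h1 : ‖f x₀‖ < 1) : ContinuousAt (fun x => ellGamma (f x) p q) x₀ :=
  (differentiableAt_ellGamma hp1 hq1 h0 h1).continuousAt.comp hf

lemma continuousAt_gpair_comp (hp1 : ‖p‖ < 1) (hq1 : ‖q‖ < 1) (hf : ContinuousAt f x₀)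
    (hg : ContinuousAt g x₀) (h0 : f x₀ ≠ 0) (h1 : ‖f x₀‖ < 1) (hg1 : ‖g x₀‖ = 1) :
    ContinuousAt (fun x => gpair p q (f x) (g x)) x₀ := by
  have hg0 : g x₀ ≠ 0 := by rintro h; simp [h] at hg1
  refine (continuousAt_ellGamma_comp hp1 hq1 (hf.mul hg) (mul_ne_zero h0 hg0) ?_).mul
    (continuousAt_ellGamma_comp hp1 hq1 (hf.div hg hg0) (div_ne_zero h0 hg0) ?_)
  · simpa [hg1] using h1
  · simpa [hg1] using h1

lemma continuousAt_wt_comp (hp1 : ‖p‖ < 1) (hq1 : ‖q‖ < 1) {L : List (X → ℂ)}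
    (hL : ∀ f ∈ L, ContinuousAt f x₀ ∧ f x₀ ≠ 0 ∧ ‖f x₀‖ < 1)
    (hg : ContinuousAt g x₀) (hg1 : ‖g x₀‖ = 1) :
    ContinuousAt (fun x => wt p q (L.map fun f => f x) (g x)) x₀ := by
  induction L with
  | nil => simpa [wt] using continuousAt_const
  | cons f L ih =>
    simp only [List.forall_mem_cons] at hL
    simp only [List.map_cons, wt, List.prod_cons]
    exact (continuousAt_gpair_comp hp1 hq1 hL.1.1 hg hL.1.2.1 hL.1.2.2 hg1).mul (ih hL.2)

lemma continuousAt_pairs {h : X → ℂ → ℂ} {n : ℕ} {z : X → Fin n → ℂ}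
    (hh : ∀ u : X → ℂ, ContinuousAt u x₀ → ‖u x₀‖ = 1 → ContinuousAt (fun x => h x (u x)) x₀)
    (hz : ∀ i, ContinuousAt (fun x => z x i) x₀) (hz1 : ∀ i, ‖z x₀ i‖ = 1) :
    ContinuousAt (fun x => pairs (h x) (z x)) x₀ := by
  unfold pairs
  refine tendsto_finsetProd _ fun i _ => tendsto_finsetProd _ fun j _ => ?_
  split_ifs
  · have hj : z x₀ j ≠ 0 := fun h => by have := hz1 j; simp [h] at this
    exact (hh _ ((hz i).mul (hz j)) (by simp [hz1])).mul
      (hh _ ((hz i).div (hz j) hj) (by simp [hz1]))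
  · exact tendsto_const_nhds

lemma continuousAt_dens (hp1 : ‖p‖ < 1) (hq1 : ‖q‖ < 1) {L : List (X → ℂ)} {n : ℕ}
    {z : X → Fin n → ℂ}
    (hL : ∀ f ∈ L, ContinuousAt f x₀ ∧ f x₀ ≠ 0 ∧ ‖f x₀‖ < 1)
    (hz : ∀ i, ContinuousAt (fun x => z x i) x₀) (hz1 : ∀ i, ‖z x₀ i‖ = 1) :
    ContinuousAt (fun x => dens p q (L.map fun f => f x) (z x)) x₀ := by
  have h0 : ∀ {u : ℂ}, ‖u‖ = 1 → u ≠ 0 := fun h h' => by simp [h'] at h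
  refine (continuousAt_pairs (fun u hu hu1 => continuousAt_vfac_comp hp1 hq1 hu (h0 hu1))
    hz hz1).mul (tendsto_finsetProd _ fun i _ => ?_)
  exact (continuousAt_vfac_comp hp1 hq1 ((hz i).pow 2) (pow_ne_zero 2 (h0 (hz1 i)))).mul
    (continuousAt_wt_comp hp1 hq1 hL (hz i) (hz1 i))

end Continuity

lemma continuous_dens_pt (hp1 : ‖p‖ < 1) (hq1 : ‖q‖ < 1) {L : List ℂ}
    (hL : ∀ s ∈ L, s ≠ 0 ∧ ‖s‖ < 1) (n : ℕ) :
    Continuous fun x : Torus n => dens p q L (pt x) := by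
  refine continuous_iff_continuousAt.2 fun x => ?_
  simpa [Function.comp_def] using continuousAt_dens
    (L := L.map fun s (_ : Torus n) => s) (z := pt) hp1 hq1
    (by simpa using fun s hs => ⟨continuousAt_const, hL s hs⟩)
    (fun i => (continuous_pt i).continuousAt) (by simp)

lemma integrable_of_continuous {X : Type*} [TopologicalSpace X] [CompactSpace X]
    [MeasurableSpace X] [OpensMeasurableSpace X] {μ : Measure X} [IsFiniteMeasure μ] {f : X → ℂ}
    (hf : Continuous f) : Integrable f μ :=
  hf.integrable_of_hasCompactSupport (HasCompactSupport.of_compactSpace _)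

/-! ### Symmetries -/

lemma vfac_inv (hp0 : p ≠ 0) (hp1 : ‖p‖ < 1) (hq0 : q ≠ 0) (hq1 : ‖q‖ < 1) {x : ℂ} (hx : x ≠ 0) :
    vfac p q x⁻¹ = vfac p q x := by
  rw [vfac, vfac, theta_inv hp0 hp1 hx, inv_inv, ← inv_inv x, theta_inv hq0 hq1 (inv_ne_zero hx),
    inv_inv]
  field_simp

lemma gpair_inv (s x : ℂ) : gpair p q s x⁻¹ = gpair p q s x := by
  rw [gpair, gpair, div_inv_eq_mul, div_eq_mul_inv, mul_comm]

lemma wt_inv (L : List ℂ) (x : ℂ) : wt p q L x⁻¹ = wt p q L x := by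
  simp [wt, gpair_inv]

lemma wt_cons (s : ℂ) (L : List ℂ) (x : ℂ) : wt p q (s :: L) x = gpair p q s x * wt p q L x := by
  simp [wt]

lemma wt_perm {L L' : List ℂ} (h : L.Perm L') : wt p q L = wt p q L' := by
  ext x
  exact (h.map _).prod_eq

lemma pairs_eq_erase_mul {h : ℂ → ℂ} (hh : ∀ u ≠ 0, h u⁻¹ = h u) {n : ℕ} {z : Fin n → ℂ}
    (hz : ∀ i, z i ≠ 0) (k : Fin n) :
    pairs h z = (∏ i ∈ Finset.univ.erase k, ∏ j ∈ Finset.univ.erase k,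
      if i < j then h (z i * z j) * h (z i / z j) else 1) *
      ∏ j ∈ Finset.univ.erase k, h (z k * z j) * h (z k / z j) := by
  have hsym : ∀ i j, h (z j * z i) * h (z j / z i) = h (z i * z j) * h (z i / z j) := fun i j => by
    rw [mul_comm (z j), ← inv_div, hh _ (div_ne_zero (hz i) (hz j))]
  set c : Fin n → Fin n → ℂ := fun i j => h (z i * z j) * h (z i / z j)
  have key : ∀ G : Fin n → Fin n → ℂ, ∏ i, ∏ j, G i j =
      (G k k * ∏ j ∈ Finset.univ.erase k, (G k j * G j k)) *
        ∏ i ∈ Finset.univ.erase k, ∏ j ∈ Finset.univ.erase k, G i j := fun G => by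
    rw [← Finset.mul_prod_erase _ _ (Finset.mem_univ k),
      ← Finset.mul_prod_erase _ (G k) (Finset.mem_univ k), Finset.prod_mul_distrib, ← mul_assoc,
      mul_assoc (G k k * _), ← Finset.prod_mul_distrib]
    simp only [Finset.mul_prod_erase Finset.univ (G _) (Finset.mem_univ k)]
  rw [pairs, key, if_neg (lt_irrefl k), one_mul, mul_comm]
  congr 1
  refine Finset.prod_congr rfl fun j hj => ?_
  rcases lt_or_gt_of_ne (Finset.ne_of_mem_erase hj) with hlt | hlt
  · simp [hlt, hlt.not_gt, hsym]
  · simp [hlt, hlt.not_gt]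

/-! ### The difference relation -/

/-- The one-variable function whose integral vanishes, in the proof of the difference relation. -/
noncomputable def bfun (p q : ℂ) (S : List ℂ) {n : ℕ} (k : Fin n) (y : Fin n → ℂ) (w : ℂ) : ℂ :=
  (S.map fun s => ellGamma (q * (s * w)) p q * ellGamma (s / w) p q).prod *
    (theta q (w ^ 2)⁻¹ * w⁻¹) *
      ∏ j ∈ Finset.univ.erase k, theta q (w * y j)⁻¹ * theta q (y j / w)

lemma bfun_inv_mul (hq0 : q ≠ 0) (hq1 : ‖q‖ < 1) (S : List ℂ) {n : ℕ}
    (k : Fin n) {y : Fin n → ℂ} (hy : ∀ i, y i ≠ 0) {w : ℂ} (hw : w ≠ 0) :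
    bfun p q S k y (q * w)⁻¹ = -bfun p q S k y w := by
  have e1 : ∀ s : ℂ, ellGamma (q * (s * (q * w)⁻¹)) p q * ellGamma (s / (q * w)⁻¹) p q =
      ellGamma (q * (s * w)) p q * ellGamma (s / w) p q := fun s => by
    rw [mul_comm]
    congr 2 <;> field_simp
  have e2 : theta q (((q * w)⁻¹) ^ 2)⁻¹ * ((q * w)⁻¹)⁻¹ = -(theta q (w ^ 2)⁻¹ * w⁻¹) := by
    rw [theta_inv hq0 hq1 (pow_ne_zero 2 hw), show (((q * w)⁻¹) ^ 2)⁻¹ = q * (q * w ^ 2) by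
      field_simp, theta_mul_self hq0 hq1 (by positivity), theta_mul_self hq0 hq1 (by positivity)]
    field_simp
  have e3 : ∀ j, theta q ((q * w)⁻¹ * y j)⁻¹ * theta q (y j / (q * w)⁻¹) =
      theta q (w * y j)⁻¹ * theta q (y j / w) := fun j => by
    have := hy j
    rw [← theta_div_self hq0 (y j / w), ← theta_div_self hq0 (w * y j)⁻¹, mul_comm]
    congr 2 <;> field_simp
  simp only [bfun, e1, e2, e3]
  ring

lemma differentiableAt_bfun_inv (hp1 : ‖p‖ < 1) (hq0 : q ≠ 0) (hq1 : ‖q‖ < 1) {S : List ℂ}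
    (hS : ∀ s ∈ S, s ≠ 0 ∧ ‖s‖ < 1) {n : ℕ}
    (k : Fin n) {y : Fin n → ℂ} (hy : ∀ i, y i ≠ 0) {w : ℂ} (h1 : ‖q‖ ≤ ‖w‖) (h2 : ‖w‖ ≤ 1) :
    DifferentiableAt ℂ (fun w => bfun p q S k y w⁻¹) w := by
  have hw : w ≠ 0 := norm_pos_iff.1 ((norm_pos_iff.2 hq0).trans_le h1)
  have ht : ∀ f : ℂ → ℂ, DifferentiableAt ℂ f w → f w ≠ 0 →
      DifferentiableAt ℂ (fun w => theta q (f w)) w := fun f hf h =>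
    (theta_differentiableAt hq1 h).comp w hf
  have hg : ∀ f : ℂ → ℂ, DifferentiableAt ℂ f w → f w ≠ 0 → ‖f w‖ < 1 →
      DifferentiableAt ℂ (fun w => ellGamma (f w) p q) w := fun f hf h h' =>
    (differentiableAt_ellGamma hp1 hq1 h h').comp w hf
  have hi : DifferentiableAt ℂ (fun w : ℂ => w⁻¹) w := differentiableAt_inv hw
  unfold bfun
  refine DifferentiableAt.mul (DifferentiableAt.mul ?_ (DifferentiableAt.mul ?_ ?_)) ?_
  · clear ht
    induction S with
    | nil => simp
    | cons s S ih =>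
      simp only [List.forall_mem_cons] at hS
      simp only [List.map_cons, List.prod_cons]
      have hs := hS.1.1
      have hw' : 0 < ‖w‖ := norm_pos_iff.2 hw
      refine DifferentiableAt.mul (DifferentiableAt.mul (hg _ (by fun_prop) (by positivity) ?_)
        (hg _ (by fun_prop (disch := positivity)) (by positivity) ?_)) (ih hS.2)
      · rw [← mul_assoc, mul_comm q, mul_assoc, norm_mul]
        refine mul_lt_one_of_nonneg_of_lt_one_left (norm_nonneg _) hS.1.2 ?_
        rwa [norm_mul, norm_inv, ← div_eq_mul_inv, div_le_one hw']
      · rw [div_inv_eq_mul, norm_mul]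
        exact mul_lt_one_of_nonneg_of_lt_one_left (norm_nonneg _) hS.1.2 h2
  · exact ht _ (by fun_prop (disch := positivity)) (by positivity)
  · fun_prop (disch := positivity)
  · refine DifferentiableAt.fun_finsetProd fun j _ => ?_
    have := hy j
    exact (ht _ (by fun_prop (disch := positivity)) (by positivity)).mul
      (ht _ (by fun_prop (disch := positivity)) (by positivity))

lemma integral_bfun (hp1 : ‖p‖ < 1) (hq0 : q ≠ 0) (hq1 : ‖q‖ < 1) {S : List ℂ}
    (hS : ∀ s ∈ S, s ≠ 0 ∧ ‖s‖ < 1) {n : ℕ} (k : Fin n) {y : Fin n → ℂ} (hy : ∀ i, y i ≠ 0) :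
    ∫ x, bfun p q S k y (cis x) ∂circMeasure = 0 := by
  have h1 := integral_shift (G := fun w => bfun p q S k y w⁻¹) hq0 hq1.le
    fun w => differentiableAt_bfun_inv hp1 hq0 hq1 hS k hy
  have h2 := integral_neg_cis fun w => bfun p q S k y w
  simp only [bfun_inv_mul hq0 hq1 S k hy (cis_ne_zero _), integral_neg] at h1
  rw [h2] at h1
  linear_combination -(1 / 2) * h1

lemma integral_eq_zero_of_coordinate {n : ℕ} (k : Fin n) {F : (Fin n → ℂ) → ℂ}
    (hF : Continuous fun x : Torus n => F (pt x))
    (h : ∀ x : Torus n, ∫ t, F (Function.update (pt x) k (cis t)) ∂circMeasure = 0) :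
    ∫ x, F (pt x) ∂torusMeasure n = 0 := by
  have h1 : ∀ t : Circ, ∫ x : Torus n, F (pt (x + Pi.single k t)) ∂torusMeasure n =
      ∫ x, F (pt x) ∂torusMeasure n := fun t =>
    integral_add_right_eq_self (fun x : Torus n => F (pt x)) _
  have h2 : ∫ t, ∫ x : Torus n, F (pt (x + Pi.single k t)) ∂torusMeasure n ∂circMeasure = 0 := by
    rw [integral_integral_swap]
    · refine integral_eq_zero_of_ae (.of_forall fun x => ?_)
      have e : ∀ t : Circ, pt (x + Pi.single k t) =
          Function.update (pt x) k (cis (x k + t)) := fun t => by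
        ext i
        by_cases hi : i = k
        · subst hi; simp [pt]
        · simp [pt, hi]
      simp only [e]
      rw [integral_add_left_eq_self fun t => F (Function.update (pt x) k (cis t))]
      exact h x
    · have hc : Continuous fun z : Circ × Torus n => z.2 + (Pi.single k z.1 : Torus n) :=
        continuous_snd.add ((continuous_single k).comp continuous_fst)
      exact integrable_of_continuous (hF.comp hc)
  simpa [h1] using h2

/-- The interaction factor of the integrand with the variable `z k` removed. -/
noncomputable def pairsErase (h : ℂ → ℂ) {n : ℕ} (k : Fin n) (z : Fin n → ℂ) : ℂ :=
  ∏ i ∈ Finset.univ.erase k, ∏ j ∈ Finset.univ.erase k,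
    if i < j then h (z i * z j) * h (z i / z j) else 1

/-- `θ(s x^{±1};p)`. -/
noncomputable def tpair (p s x : ℂ) : ℂ := theta p (s * x) * theta p (s / x)

lemma tpair_inv (s x : ℂ) : tpair p s x⁻¹ = tpair p s x := by
  rw [tpair, tpair, div_inv_eq_mul, div_eq_mul_inv, mul_comm]

lemma gpair_mul (hp1 : ‖p‖ < 1) (hq0 : q ≠ 0) (hq1 : ‖q‖ < 1) {s x : ℂ} (hs : ‖s‖ < 1)
    (hx : ‖x‖ = 1) : gpair p q (q * s) x = tpair p s x * gpair p q s x := by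
  rw [gpair, gpair, tpair, mul_assoc, mul_div_assoc, ellGamma_mul hp1 hq0 hq1 (by simpa [hx]),
    ellGamma_mul hp1 hq0 hq1 (by simpa [hx])]
  ring

/-- The summands in the difference relation. -/
noncomputable def dterm (p q a b : ℂ) (L : List ℂ) {n : ℕ} (k : Fin n) (z : Fin n → ℂ) : ℂ :=
  bfun p q (a :: b :: L) k z (z k) * pairsErase (vfac p q) k z *
    ∏ j ∈ Finset.univ.erase k, (vfac p q (z j ^ 2) * wt p q (a :: b :: L) (z j) *
      (tpair p a (z j) * tpair p b (z j)))

lemma bfun_update (S : List ℂ) {n : ℕ} (k : Fin n) (z : Fin n → ℂ) (w v : ℂ) :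
    bfun p q S k (Function.update z k v) w = bfun p q S k z w := by
  unfold bfun
  congr 1
  refine Finset.prod_congr rfl fun j hj => ?_
  rw [Function.update_of_ne (Finset.ne_of_mem_erase hj)]

lemma dterm_update (a b : ℂ) (L : List ℂ) {n : ℕ} (k : Fin n) (z : Fin n → ℂ) (w : ℂ) :
    dterm p q a b L k (Function.update z k w) =
      bfun p q (a :: b :: L) k z w * (pairsErase (vfac p q) k z *
        ∏ j ∈ Finset.univ.erase k, (vfac p q (z j ^ 2) * wt p q (a :: b :: L) (z j) *
          (tpair p a (z j) * tpair p b (z j)))) := by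
  have e : ∀ j ∈ Finset.univ.erase k, Function.update z k w j = z j := fun j hj =>
    Function.update_of_ne (Finset.ne_of_mem_erase hj) _ _
  rw [dterm, bfun_update, Function.update_self, mul_assoc]
  congr 2
  · refine Finset.prod_congr rfl fun i hi => Finset.prod_congr rfl fun j hj => ?_
    rw [e i hi, e j hj]
  · refine Finset.prod_congr rfl fun j hj => ?_
    rw [e j hj]

lemma continuous_dterm_update (hp1 : ‖p‖ < 1) (hq0 : q ≠ 0) (hq1 : ‖q‖ < 1) {a b : ℂ}
    {L : List ℂ} (hS : ∀ s ∈ a :: b :: L, s ≠ 0 ∧ ‖s‖ < 1) {n : ℕ} (k : Fin n)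
    {u : Circ → Circ} (hu : Continuous u) :
    Continuous fun x : Torus n =>
      dterm p q a b L k (Function.update (pt x) k (cis (u (x k)))) := by
  have hw : ∀ x : Torus n, Function.update (pt x) k (cis (u (x k))) =
      pt (Function.update x k (u (x k))) := fun x => by
    ext i
    by_cases hi : i = k
    · subst hi; simp [pt]
    · simp [pt, hi]
  simp only [hw]
  refine Continuous.comp (g := fun x : Torus n => dterm p q a b L k (pt x)) ?_
    (Continuous.update continuous_id k (hu.comp (continuous_apply k)))
  have ht : ∀ {r : ℂ} (f : Torus n → ℂ), ‖r‖ < 1 → Continuous f → (∀ x, f x ≠ 0) →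
      Continuous fun x => theta r (f x) := fun f hr hf h0 =>
    continuous_iff_continuousAt.2 fun x => continuousAt_theta_comp hr hf.continuousAt (h0 x)
  have hv : ∀ f : Torus n → ℂ, Continuous f → (∀ x, f x ≠ 0) →
      Continuous fun x => vfac p q (f x) := fun f hf h0 =>
    continuous_iff_continuousAt.2 fun x => continuousAt_vfac_comp hp1 hq1 hf.continuousAt (h0 x)
  have hg : ∀ f : Torus n → ℂ, Continuous f → (∀ x, f x ≠ 0) → (∀ x, ‖f x‖ < 1) →
      Continuous fun x => ellGamma (f x) p q := fun f hf h0 h1 =>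
    continuous_iff_continuousAt.2 fun x =>
      continuousAt_ellGamma_comp hp1 hq1 hf.continuousAt (h0 x) (h1 x)
  have hz : ∀ j, Continuous fun x : Torus n => pt x j := continuous_pt
  have hz0 : ∀ j (x : Torus n), pt x j ≠ 0 := fun j x => pt_ne_zero x j
  have hdiv : ∀ (f : Torus n → ℂ) (j : Fin n), Continuous f →
      Continuous fun x => f x / pt x j := fun f j hf => hf.div₀ (hz j) (hz0 j)
  have htp : ∀ s ∈ a :: b :: L, ∀ j, Continuous fun x : Torus n => tpair p s (pt x j) :=
    fun s hs j => (ht _ hp1 (by fun_prop) fun x => mul_ne_zero (hS s hs).1 (hz0 j x)).mul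
      (ht _ hp1 (hdiv _ j continuous_const) fun x => div_ne_zero (hS s hs).1 (hz0 j x))
  unfold dterm bfun pairsErase
  refine ((Continuous.mul (Continuous.mul ?_ (Continuous.mul ?_ ?_)) ?_).mul ?_).mul ?_
  · refine continuous_list_prod _ fun s hs => ?_
    have h1 : ‖q * s‖ < 1 := by
      rw [norm_mul]; exact mul_lt_one_of_nonneg_of_lt_one_left (norm_nonneg _) hq1 (hS s hs).2.le
    refine (hg _ (by fun_prop) (fun x => ?_) fun x => ?_).mul
      (hg _ (hdiv _ k continuous_const) (fun x => ?_) fun x => ?_)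
    · exact mul_ne_zero hq0 (mul_ne_zero (hS s hs).1 (hz0 k x))
    · rw [← mul_assoc, norm_mul, norm_pt, mul_one]; exact h1
    · exact div_ne_zero (hS s hs).1 (hz0 k x)
    · simpa using (hS s hs).2
  · exact ht _ hq1 (((hz k).pow 2).inv₀ fun x => pow_ne_zero 2 (hz0 k x))
      fun x => inv_ne_zero (pow_ne_zero 2 (hz0 k x))
  · exact (hz k).inv₀ (hz0 k)
  · refine continuous_finsetProd _ fun j _ => (ht _ hq1 ?_ ?_).mul (ht _ hq1 (hdiv _ k (hz j)) ?_)
    · exact ((hz k).mul (hz j)).inv₀ fun x => mul_ne_zero (hz0 k x) (hz0 j x)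
    · exact fun x => inv_ne_zero (mul_ne_zero (hz0 k x) (hz0 j x))
    · exact fun x => div_ne_zero (hz0 j x) (hz0 k x)
  · refine continuous_finsetProd _ fun i _ => continuous_finsetProd _ fun j _ => ?_
    split_ifs
    · exact (hv _ ((hz i).mul (hz j)) fun x => mul_ne_zero (hz0 i x) (hz0 j x)).mul
        (hv _ (hdiv _ j (hz i)) fun x => div_ne_zero (hz0 i x) (hz0 j x))
    · exact continuous_const
  · refine continuous_finsetProd _ fun j _ => ((hv _ ((hz j).pow 2) fun x => pow_ne_zero 2
      (hz0 j x)).mul ?_).mul ((htp a (by simp) j).mul (htp b (by simp) j))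
    unfold wt gpair
    refine continuous_list_prod _ fun s hs => ?_
    refine (hg _ (by fun_prop) (fun x => ?_) fun x => ?_).mul
      (hg _ (hdiv _ j continuous_const) (fun x => ?_) fun x => ?_)
    · exact mul_ne_zero (hS s hs).1 (hz0 j x)
    · simpa using (hS s hs).2
    · exact div_ne_zero (hS s hs).1 (hz0 j x)
    · simpa using (hS s hs).2

lemma integral_dterm (hp1 : ‖p‖ < 1) (hq0 : q ≠ 0) (hq1 : ‖q‖ < 1) {a b : ℂ}
    {L : List ℂ} (hS : ∀ s ∈ a :: b :: L, s ≠ 0 ∧ ‖s‖ < 1) {n : ℕ} (k : Fin n) :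
    ∫ x, dterm p q a b L k (pt x) ∂torusMeasure n = 0 := by
  refine integral_eq_zero_of_coordinate k ?_ fun x => ?_
  · have e : ∀ x : Torus n, Function.update (pt x) k (cis (id (x k))) = pt x :=
      fun x => Function.update_eq_self k (pt x)
    simpa only [e] using continuous_dterm_update hp1 hq0 hq1 hS k continuous_id
  · simp only [dterm_update, integral_mul_const]
    rw [integral_bfun hp1 hq0 hq1 hS k (pt_ne_zero x), zero_mul]

lemma integral_dterm_inv (hp1 : ‖p‖ < 1) (hq0 : q ≠ 0) (hq1 : ‖q‖ < 1) {a b : ℂ}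
    {L : List ℂ} (hS : ∀ s ∈ a :: b :: L, s ≠ 0 ∧ ‖s‖ < 1) {n : ℕ} (k : Fin n) :
    ∫ x, dterm p q a b L k (Function.update (pt x) k (pt x k)⁻¹) ∂torusMeasure n = 0 := by
  refine integral_eq_zero_of_coordinate (F := fun z => dterm p q a b L k
    (Function.update z k (z k)⁻¹)) k ?_ fun x => ?_
  · simpa [pt, cis_neg] using continuous_dterm_update hp1 hq0 hq1 hS k continuous_neg
  · simp only [Function.update_self, Function.update_idem, dterm_update, integral_mul_const]
    rw [integral_neg_cis fun w => bfun p q _ k (pt x) w,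
      integral_bfun hp1 hq0 hq1 hS k (pt_ne_zero x), zero_mul]

lemma theta_ne_zero_of_ne_one (hp0 : p ≠ 0) (hp1 : ‖p‖ < 1) {x : ℂ} (h1 : ‖p‖ < ‖x‖)
    (h2 : ‖p‖ * ‖x‖ < 1) (hx : x ≠ 1) : theta p x ≠ 0 := by
  have hp : 0 < ‖p‖ := norm_pos_iff.2 hp0
  intro h
  obtain ⟨k, rfl⟩ := (theta_eq_zero_iff hp0 hp1 (norm_pos_iff.1 (hp.trans h1))).1 h
  rw [norm_zpow] at h1 h2
  have hk1 : k < 1 := (zpow_lt_zpow_iff_right_of_lt_one₀ hp hp1).1 (by simpa using h1)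
  have hk2 : 0 < k + 1 := (zpow_lt_zpow_iff_right_of_lt_one₀ hp hp1).1
    (by rwa [zpow_zero, zpow_add_one₀ hp.ne', mul_comm])
  obtain rfl : k = 0 := by omega
  simp at hx

/-- The common multiple of the summands in the difference relation. -/
noncomputable def cden (p q a b : ℂ) (L : List ℂ) {n : ℕ} (z : Fin n → ℂ) : ℂ :=
  pairs (vfac p q) z * ∏ i, (vfac p q (z i ^ 2) * wt p q (a :: b :: L) (z i) *
    (tpair p a (z i) * tpair p b (z i)))

lemma cden_eq (hp0 : p ≠ 0) (hp1 : ‖p‖ < 1) (hq0 : q ≠ 0) (hq1 : ‖q‖ < 1) (a b : ℂ) (L : List ℂ)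
    {n : ℕ} {z : Fin n → ℂ} (hz : ∀ i, z i ≠ 0) (k : Fin n) :
    cden p q a b L z = (∏ j ∈ Finset.univ.erase k,
        vfac p q (z k * z j) * vfac p q (z k / z j)) *
      (vfac p q (z k ^ 2) * wt p q (a :: b :: L) (z k) * (tpair p a (z k) * tpair p b (z k))) *
      (pairsErase (vfac p q) k z * ∏ j ∈ Finset.univ.erase k, (vfac p q (z j ^ 2) *
        wt p q (a :: b :: L) (z j) * (tpair p a (z j) * tpair p b (z j)))) := by
  rw [cden, pairs_eq_erase_mul (fun u hu => vfac_inv hp0 hp1 hq0 hq1 hu) hz k, pairsErase,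
    ← Finset.mul_prod_erase _ _ (Finset.mem_univ k)]
  ring

lemma cden_update (hp0 : p ≠ 0) (hp1 : ‖p‖ < 1) (hq0 : q ≠ 0) (hq1 : ‖q‖ < 1) (a b : ℂ)
    (L : List ℂ) {n : ℕ} {z : Fin n → ℂ} (hz : ∀ i, z i ≠ 0) (k : Fin n) :
    cden p q a b L (Function.update z k (z k)⁻¹) = cden p q a b L z := by
  have hz' : ∀ i, Function.update z k (z k)⁻¹ i ≠ 0 := fun i => by
    by_cases hi : i = k
    · subst hi; simpa using hz i
    · simpa [hi] using hz i
  have e : ∀ j ∈ Finset.univ.erase k, Function.update z k (z k)⁻¹ j = z j := fun j hj =>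
    Function.update_of_ne (Finset.ne_of_mem_erase hj) _ _
  have e1 : ∏ j ∈ Finset.univ.erase k, vfac p q ((z k)⁻¹ * Function.update z k (z k)⁻¹ j) *
      vfac p q ((z k)⁻¹ / Function.update z k (z k)⁻¹ j) =
      ∏ j ∈ Finset.univ.erase k, vfac p q (z k * z j) * vfac p q (z k / z j) := by
    refine Finset.prod_congr rfl fun j hj => ?_
    rw [e j hj, ← div_eq_inv_mul, ← inv_div, vfac_inv hp0 hp1 hq0 hq1 (div_ne_zero (hz k) (hz j)),
      div_eq_mul_inv (z k)⁻¹, ← mul_inv, vfac_inv hp0 hp1 hq0 hq1 (mul_ne_zero (hz k) (hz j)),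
      mul_comm]
  have e2 : pairsErase (vfac p q) k (Function.update z k (z k)⁻¹) =
      pairsErase (vfac p q) k z := by
    refine Finset.prod_congr rfl fun i hi => Finset.prod_congr rfl fun j hj => ?_
    rw [e i hi, e j hj]
  rw [cden_eq hp0 hp1 hq0 hq1 a b L hz' k, cden_eq hp0 hp1 hq0 hq1 a b L hz k,
    Function.update_self, wt_inv, tpair_inv, tpair_inv, inv_pow,
    vfac_inv hp0 hp1 hq0 hq1 (pow_ne_zero 2 (hz k)), e1, e2]
  congr 2
  refine Finset.prod_congr rfl fun j hj => ?_
  rw [e j hj]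

lemma cden_mul (hp0 : p ≠ 0) (hp1 : ‖p‖ < 1) (hq0 : q ≠ 0) (hq1 : ‖q‖ < 1) {a b : ℂ}
    {L : List ℂ} (hS : ∀ s ∈ a :: b :: L, s ≠ 0 ∧ ‖s‖ < 1) {n : ℕ} {z : Fin n → ℂ}
    (hz : ∀ i, ‖z i‖ = 1) (k : Fin n) :
    cden p q a b L z * (z k * (L.map fun e => theta p (z k * e)).prod) =
      a * b * dterm p q a b L k z * (theta p (z k ^ 2) *
        (∏ j ∈ Finset.univ.erase k, theta p (z k * z j) * theta p (z k / z j)) *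
        (theta p (z k / a) * theta p (z k / b))) := by
  have hz0 : ∀ i, z i ≠ 0 := fun i => norm_pos_iff.1 (by simp [hz])
  have ha := (hS a (by simp)).1
  have hb := (hS b (by simp)).1
  have hk := hz0 k
  have hmap : ∀ S : List ℂ, (∀ s ∈ S, s ≠ 0 ∧ ‖s‖ < 1) →
      (S.map fun s => ellGamma (q * (s * z k)) p q * ellGamma (s / z k) p q).prod =
        (S.map fun s => theta p (z k * s)).prod * wt p q S (z k) := fun S hS => by
    rw [wt, ← List.prod_map_mul]
    congr 1
    refine List.map_congr_left fun s hs => ?_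
    rw [ellGamma_mul hp1 hq0 hq1 (by simpa [hz] using (hS s hs).2), gpair, mul_comm (z k)]
    ring
  rw [cden_eq hp0 hp1 hq0 hq1 a b L hz0 k, dterm, bfun, hmap _ hS,
    theta_div_comm hp0 hp1 hk ha, theta_div_comm hp0 hp1 hk hb]
  have e : a * b * (z k)⁻¹ * (z k / a) * (z k / b) = z k := by field_simp
  generalize (∏ j ∈ Finset.univ.erase k, (vfac p q (z j ^ 2) *
    wt p q (a :: b :: L) (z j) * (tpair p a (z j) * tpair p b (z j)))) = X
  simp only [List.map_cons, List.prod_cons, vfac, tpair, Finset.prod_mul_distrib, inv_div,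
    mul_comm a (z k), mul_comm b (z k)]
  generalize wt p q (a :: b :: L) (z k) = W, theta q (z k ^ 2)⁻¹ = Q,
    (L.map fun e => theta p (z k * e)).prod = M, theta p (z k ^ 2) = P,
    ∏ j ∈ Finset.univ.erase k, theta p (z k * z j) = P₁,
    ∏ j ∈ Finset.univ.erase k, theta p (z k / z j) = P₂,
    ∏ j ∈ Finset.univ.erase k, theta q (z k * z j)⁻¹ = Q₁,
    ∏ j ∈ Finset.univ.erase k, theta q (z j / z k) = Q₂,
    theta p (z k * a) = A₁, theta p (z k * b) = B₁, theta p (a / z k) = A₂,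
    theta p (b / z k) = B₂, pairsErase (vfac p q) k z = R
  linear_combination -(P₁ * P₂ * Q₁ * Q₂ * P * Q * W * A₁ * A₂ * B₁ * B₂ * R * M * X) * e

lemma dens_cons_cons_mul (hp1 : ‖p‖ < 1) (hq0 : q ≠ 0) (hq1 : ‖q‖ < 1) {a : ℂ} (ha : ‖a‖ < 1)
    (L : List ℂ) {n : ℕ} {z : Fin n → ℂ} (hz : ∀ i, ‖z i‖ = 1) :
    dens p q (q * a :: L) z = dens p q (a :: L) z * ∏ i, tpair p a (z i) := by
  rw [dens, dens, mul_assoc, ← Finset.prod_mul_distrib]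
  congr 1
  refine Finset.prod_congr rfl fun i _ => ?_
  rw [wt_cons, wt_cons, gpair_mul hp1 hq0 hq1 ha (hz i)]
  ring

lemma dens_perm {L L' : List ℂ} (h : L.Perm L') {n : ℕ} (z : Fin n → ℂ) :
    dens p q L z = dens p q L' z := by
  rw [dens, dens, wt_perm h]

lemma sum_dterm (hp0 : p ≠ 0) (hp1 : ‖p‖ < 1) (hq0 : q ≠ 0) (hq1 : ‖q‖ < 1) {a b : ℂ}
    {L : List ℂ} (hS : ∀ s ∈ a :: b :: L, s ≠ 0 ∧ ‖s‖ < 1) (ha : ‖p‖ < ‖a‖) (hb : ‖p‖ < ‖b‖)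
    (hab : a ≠ b) {n : ℕ} (hL : L.length = 2 * n + 2) (hprod : a * b * L.prod = p)
    {z : Fin n → ℂ} (hz : ∀ i, ‖z i‖ = 1) (hinj : Function.Injective z)
    (hne : ∀ i j, z i * z j ≠ 1) :
    a * b * ∑ k, (dterm p q a b L k z + dterm p q a b L k (Function.update z k (z k)⁻¹)) +
      a / theta p (a / b) * ((L.map fun e => theta p (a * e)).prod * dens p q (q * b :: a :: L) z -
        (L.map fun e => theta p (b * e)).prod * dens p q (q * a :: b :: L) z) = 0 := by
  have hz0 : ∀ i, z i ≠ 0 := fun i => norm_pos_iff.1 (by simp [hz])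
  obtain ⟨⟨ha0, ha1⟩, ⟨hb0, hb1⟩, -⟩ := by simpa only [List.forall_mem_cons] using hS
  set x : Fin n ⊕ Fin n ⊕ Bool → ℂ :=
    Sum.elim z (Sum.elim (fun i => (z i)⁻¹) fun c => if c then a else b) with hx
  have hxn : ∀ i, ‖p‖ < ‖x i‖ ∧ ‖x i‖ ≤ 1 := by
    rintro (i | i | _ | _) <;> simp [hx, hz, hp1, ha, hb, ha1.le, hb1.le]
  have hxinj : Function.Injective x := by
    refine hinj.sumElim (Function.Injective.sumElim (inv_injective.comp hinj) ?_ ?_) ?_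
    · rintro (_ | _) (_ | _) <;> simp [hab, hab.symm]
    · rintro i (_ | _) h <;> simp only [reduceIte, Bool.false_eq_true] at h
      · rw [← h] at hb1; simp [hz] at hb1
      · rw [← h] at ha1; simp [hz] at ha1
    · rintro i (j | _ | _) h <;>
        simp only [Sum.elim_inl, Sum.elim_inr, reduceIte, Bool.false_eq_true] at h
      · exact hne i j (by rw [h, inv_mul_cancel₀ (hz0 j)])
      · rw [← h] at hb1; simp [hz] at hb1
      · rw [← h] at ha1; simp [hz] at ha1
  have hp : 0 < ‖p‖ := norm_pos_iff.2 hp0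
  have hx0 : ∀ i, x i ≠ 0 := fun i => norm_pos_iff.1 (hp.trans (hxn i).1)
  have hth : ∀ i j, i ≠ j → theta p (x i / x j) ≠ 0 := fun i j hij => by
    have hj : 0 < ‖x j‖ := norm_pos_iff.2 (hx0 j)
    refine theta_ne_zero_of_ne_one hp0 hp1 ?_ ?_ fun h => hij (hxinj ((div_eq_one_iff_eq (hx0 j)).1 h))
    · rw [norm_div, lt_div_iff₀ hj]
      nlinarith [hxn i, hxn j]
    · rw [norm_div, ← mul_div_assoc, div_lt_one hj]
      nlinarith [hxn i, hxn j]
  have key := sum_mul_prod_theta_div_eq_zero hp0 hp1 (s := Finset.univ) hx0 (E := L)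
    (fun e he => (hS e (by simp [he])).1) (by simp [hL]; ring) (by simp; omega)
    (fun i _ j _ => hth i j) (by
      simp only [hx, Fintype.prod_sum_type, Sum.elim_inl, Sum.elim_inr, Fintype.prod_bool,
        ← hprod, reduceIte, Bool.false_eq_true]
      rw [← mul_assoc, ← Finset.prod_mul_distrib, Finset.prod_congr rfl fun i _ =>
        mul_inv_cancel₀ (hz0 i), Finset.prod_const_one, one_mul])
  have herase : ∀ k, ∏ j ∈ Finset.univ.erase k, theta p (x k / x j) =
      ∏ j, if j = k then 1 else theta p (x k / x j) := fun k => by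
    rw [← Finset.mul_prod_erase _ _ (Finset.mem_univ k), if_pos rfl, one_mul]
    exact Finset.prod_congr rfl fun j hj => (if_neg (Finset.ne_of_mem_erase hj)).symm
  have hden : ∀ k, ∏ j ∈ Finset.univ.erase k, theta p (x k / x j) ≠ 0 := fun k =>
    Finset.prod_ne_zero_iff.2 fun j hj => hth k j (Finset.ne_of_mem_erase hj).symm
  have hz' : ∀ k i, ‖Function.update z k (z k)⁻¹ i‖ = 1 := fun k i => by
    by_cases hi : i = k
    · subst hi; simp [hz]
    · simp [hi, hz]
  have hd1 : ∀ k, ∏ j ∈ Finset.univ.erase (Sum.inl k), theta p (x (Sum.inl k) / x j) =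
      theta p (z k ^ 2) * (∏ j ∈ Finset.univ.erase k, theta p (z k * z j) * theta p (z k / z j)) *
        (theta p (z k / a) * theta p (z k / b)) := fun k => by
    rw [herase]
    simp only [hx, Fintype.prod_sum_type, Sum.elim_inl, Sum.elim_inr, Fintype.prod_bool,
      reduceIte, Bool.false_eq_true, Sum.inl.injEq, reduceCtorEq, div_inv_eq_mul,
      Finset.prod_mul_distrib]
    rw [← Finset.mul_prod_erase Finset.univ (fun j => theta p (z k * z j)) (Finset.mem_univ k),
      ← Finset.mul_prod_erase _ _ (Finset.mem_univ k), if_pos rfl,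
      Finset.prod_congr rfl fun j hj => if_neg (Finset.ne_of_mem_erase hj), pow_two]
    ring
  have hd2 : ∀ k, ∏ j ∈ Finset.univ.erase (Sum.inr (Sum.inl k)),
      theta p (x (Sum.inr (Sum.inl k)) / x j) =
      theta p ((z k)⁻¹ ^ 2) * (∏ j ∈ Finset.univ.erase k,
        theta p ((z k)⁻¹ * z j) * theta p ((z k)⁻¹ / z j)) *
        (theta p ((z k)⁻¹ / a) * theta p ((z k)⁻¹ / b)) := fun k => by
    rw [herase]
    simp only [hx, Fintype.prod_sum_type, Sum.elim_inl, Sum.elim_inr, Fintype.prod_bool,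
      reduceIte, Bool.false_eq_true, Sum.inl.injEq, Sum.inr.injEq, reduceCtorEq, div_inv_eq_mul,
      Finset.prod_mul_distrib]
    rw [← Finset.mul_prod_erase Finset.univ (fun j => theta p ((z k)⁻¹ / z j)) (Finset.mem_univ k),
      ← Finset.mul_prod_erase Finset.univ (fun j => if j = k then _ else _) (Finset.mem_univ k),
      if_pos rfl, Finset.prod_congr rfl fun j hj => if_neg (Finset.ne_of_mem_erase hj),
      pow_two, ← div_eq_mul_inv (z k)⁻¹ (z k)]
    ring
  have h1 : ∀ k, cden p q a b L z * (x (Sum.inl k) *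
      (L.map fun e => theta p (x (Sum.inl k) * e)).prod /
        ∏ j ∈ Finset.univ.erase (Sum.inl k), theta p (x (Sum.inl k) / x j)) =
      a * b * dterm p q a b L k z := fun k => by
    rw [← mul_div_assoc, div_eq_iff (hden _), hd1]
    exact cden_mul hp0 hp1 hq0 hq1 hS hz k
  have h2 : ∀ k, cden p q a b L z * (x (Sum.inr (Sum.inl k)) *
      (L.map fun e => theta p (x (Sum.inr (Sum.inl k)) * e)).prod /
        ∏ j ∈ Finset.univ.erase (Sum.inr (Sum.inl k)), theta p (x (Sum.inr (Sum.inl k)) / x j)) =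
      a * b * dterm p q a b L k (Function.update z k (z k)⁻¹) := fun k => by
    rw [← mul_div_assoc, div_eq_iff (hden _), hd2,
      ← cden_update hp0 hp1 hq0 hq1 a b L hz0 k]
    have := cden_mul hp0 hp1 hq0 hq1 hS (hz' k) k
    rw [Finset.prod_congr rfl fun j hj => by
      rw [Function.update_of_ne (Finset.ne_of_mem_erase hj)]] at this
    simp only [Function.update_self] at this
    exact this
  have h3 : cden p q a b L z * (x (Sum.inr (Sum.inr true)) *
      (L.map fun e => theta p (x (Sum.inr (Sum.inr true)) * e)).prod /
        ∏ j ∈ Finset.univ.erase (Sum.inr (Sum.inr true)),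
          theta p (x (Sum.inr (Sum.inr true)) / x j)) =
      a / theta p (a / b) *
        ((L.map fun e => theta p (a * e)).prod * dens p q (q * b :: a :: L) z) := by
    have e : ∏ j ∈ Finset.univ.erase (Sum.inr (Sum.inr true)),
        theta p (x (Sum.inr (Sum.inr true)) / x j) =
        (∏ j, tpair p a (z j)) * theta p (a / b) := by
      rw [herase]
      simp [hx, Fintype.prod_sum_type, tpair, Finset.prod_mul_distrib]
      ring
    have h0 := hden (Sum.inr (Sum.inr true))
    rw [e] at h0 ⊢
    rw [dens_cons_cons_mul hp1 hq0 hq1 hb1 _ hz, dens_perm (.swap a b L), cden, dens]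
    simp only [Finset.prod_mul_distrib]
    have := left_ne_zero_of_mul h0
    have := right_ne_zero_of_mul h0
    simp only [hx, Sum.elim_inr, reduceIte]
    field_simp
  have h4 : cden p q a b L z * (x (Sum.inr (Sum.inr false)) *
      (L.map fun e => theta p (x (Sum.inr (Sum.inr false)) * e)).prod /
        ∏ j ∈ Finset.univ.erase (Sum.inr (Sum.inr false)),
          theta p (x (Sum.inr (Sum.inr false)) / x j)) =
      -(a / theta p (a / b) *
        ((L.map fun e => theta p (b * e)).prod * dens p q (q * a :: b :: L) z)) := by
    have e : ∏ j ∈ Finset.univ.erase (Sum.inr (Sum.inr false)),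
        theta p (x (Sum.inr (Sum.inr false)) / x j) =
        (∏ j, tpair p b (z j)) * theta p (b / a) := by
      rw [herase]
      simp [hx, Fintype.prod_sum_type, tpair, Finset.prod_mul_distrib]
      ring
    have h0 := hden (Sum.inr (Sum.inr false))
    rw [e] at h0 ⊢
    rw [theta_div_comm hp0 hp1 hb0 ha0] at h0 ⊢
    rw [dens_cons_cons_mul hp1 hq0 hq1 ha1 _ hz, cden, dens]
    simp only [Finset.prod_mul_distrib]
    have := left_ne_zero_of_mul h0
    have := right_ne_zero_of_mul (right_ne_zero_of_mul h0)
    simp only [hx, Sum.elim_inr, reduceIte, Bool.false_eq_true]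
    field_simp
  have := congrArg (cden p q a b L z * ·) key
  simp only [Fintype.sum_sum_type, Fintype.sum_bool, mul_add, Finset.mul_sum, h1, h2, h3, h4,
    mul_zero] at this
  rw [Finset.sum_add_distrib, mul_add, Finset.mul_sum, Finset.mul_sum]
  linear_combination this

lemma ae_ne_zero_of_addMonoidHom {n : ℕ} (φ : Torus n →+ Circ) (hc : Continuous φ)
    (hs : Function.Surjective φ) : ∀ᵐ x ∂torusMeasure n, φ x ≠ 0 := by
  have h := AddMonoidHom.measurePreserving (μ := torusMeasure n) (ν := circMeasure) hc hs (by simp)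
  have h0 : ∀ᵐ y ∂circMeasure, y ≠ (0 : Circ) := by
    have h1 := AddCircle.volume_closedBall (T := 2 * π) (x := 0) 0
    rw [AddCircle.volume_eq_smul_haarAddCircle] at h1
    simpa [ae_iff, Real.pi_pos.not_ge] using h1
  exact h.quasiMeasurePreserving.ae h0

lemma ae_generic (n : ℕ) : ∀ᵐ x ∂torusMeasure n,
    Function.Injective (pt x) ∧ ∀ i j, pt x i * pt x j ≠ 1 := by
  have h1 : ∀ᵐ x ∂torusMeasure n, ∀ i j, i ≠ j → x i - x j ≠ 0 := by
    refine ae_all_iff.2 fun i => ae_all_iff.2 fun j => ?_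
    by_cases hij : i = j
    · simp [hij]
    · filter_upwards [ae_ne_zero_of_addMonoidHom
        (Pi.evalAddMonoidHom (fun _ : Fin n => Circ) i - Pi.evalAddMonoidHom _ j)
        ((continuous_apply i).sub (continuous_apply j))
        fun c => ⟨Pi.single i c, by simp [Ne.symm hij]⟩] with x hx _
      simpa using hx
  have h2 : ∀ᵐ x ∂torusMeasure n, ∀ i j, x i + x j ≠ 0 := by
    refine ae_all_iff.2 fun i => ae_all_iff.2 fun j => ?_
    have hs : Function.Surjective
        (Pi.evalAddMonoidHom (fun _ : Fin n => Circ) i +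
          Pi.evalAddMonoidHom (fun _ : Fin n => Circ) j) := fun c => by
      by_cases hij : i = j
      · obtain ⟨r, rfl⟩ := QuotientAddGroup.mk_surjective c
        refine ⟨fun _ => ((r / 2 : ℝ) : Circ), ?_⟩
        simp only [AddMonoidHom.add_apply, Pi.evalAddMonoidHom_apply, ← AddCircle.coe_add,
          add_halves]
      · exact ⟨Pi.single i c, by simp [Ne.symm hij]⟩
    filter_upwards [ae_ne_zero_of_addMonoidHom _
      ((continuous_apply i).add (continuous_apply j)) hs] with x hx
    simpa using hx
  filter_upwards [h1, h2] with x hx1 hx2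
  refine ⟨fun i j h => ?_, fun i j h => hx2 i j ?_⟩
  · by_contra hij
    exact hx1 i j hij (sub_eq_zero.2 (cis_injective h))
  · refine cis_injective ?_
    rw [cis_add]
    simpa [cis, pt] using h

/-- The type I integral with parameters `L`. -/
noncomputable def typeI (p q : ℂ) (n : ℕ) (L : List ℂ) : ℂ :=
  ∫ x, dens p q L (pt x) ∂torusMeasure n

lemma typeI_perm (n : ℕ) {L L' : List ℂ} (h : L.Perm L') : typeI p q n L = typeI p q n L' := by
  simp only [typeI, dens_perm h]

/-- The difference relation for type I integrals. -/
lemma typeI_difference (hp0 : p ≠ 0) (hp1 : ‖p‖ < 1) (hq0 : q ≠ 0) (hq1 : ‖q‖ < 1) {a b : ℂ}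
    {L : List ℂ} (hS : ∀ s ∈ a :: b :: L, s ≠ 0 ∧ ‖s‖ < 1) (ha : ‖p‖ < ‖a‖) (hb : ‖p‖ < ‖b‖)
    {n : ℕ} (hL : L.length = 2 * n + 2) (hprod : a * b * L.prod = p) :
    (L.map fun e => theta p (a * e)).prod * typeI p q n (q * b :: a :: L) =
      (L.map fun e => theta p (b * e)).prod * typeI p q n (q * a :: b :: L) := by
  rcases eq_or_ne a b with rfl | hab
  · rfl
  have hS' := hS
  obtain ⟨⟨ha0, ha1⟩, ⟨hb0, hb1⟩, hL0⟩ := by simpa only [List.forall_mem_cons] using hS'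
  have hth : theta p (a / b) ≠ 0 := by
    refine theta_ne_zero_of_ne_one hp0 hp1 ?_ ?_ fun h => hab ((div_eq_one_iff_eq hb0).1 h)
    · rw [norm_div, lt_div_iff₀ (norm_pos_iff.2 hb0)]
      nlinarith [norm_pos_iff.2 hp0]
    · rw [norm_div, ← mul_div_assoc, div_lt_one (norm_pos_iff.2 hb0)]
      nlinarith [norm_pos_iff.2 hp0]
  have hqs : ∀ {s : ℂ}, s ≠ 0 ∧ ‖s‖ < 1 → q * s ≠ 0 ∧ ‖q * s‖ < 1 := fun h => by
    refine ⟨mul_ne_zero hq0 h.1, ?_⟩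
    rw [norm_mul]; exact mul_lt_one_of_nonneg_of_lt_one_left (norm_nonneg _) hq1 h.2.le
  have hi1 : Integrable (fun x => dens p q (q * b :: a :: L) (pt x)) (torusMeasure n) :=
    integrable_of_continuous (continuous_dens_pt hp1 hq1 (by
      simp only [List.forall_mem_cons]; exact ⟨hqs ⟨hb0, hb1⟩, ⟨ha0, ha1⟩, hL0⟩) n)
  have hi2 : Integrable (fun x => dens p q (q * a :: b :: L) (pt x)) (torusMeasure n) :=
    integrable_of_continuous (continuous_dens_pt hp1 hq1 (by
      simp only [List.forall_mem_cons]; exact ⟨hqs ⟨ha0, ha1⟩, ⟨hb0, hb1⟩, hL0⟩) n)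
  have hi3 : ∀ k : Fin n, Integrable (fun x => dterm p q a b L k (pt x)) (torusMeasure n) := fun k =>
    integrable_of_continuous (by
      have e : ∀ x : Torus n, Function.update (pt x) k (cis (id (x k))) = pt x :=
        fun x => Function.update_eq_self k (pt x)
      simpa only [e] using continuous_dterm_update hp1 hq0 hq1 hS k continuous_id)
  have hi4 : ∀ k : Fin n, Integrable (fun x => dterm p q a b L k
      (Function.update (pt x) k (pt x k)⁻¹)) (torusMeasure n) := fun k =>
    integrable_of_continuous (by
      simpa [pt, cis_neg] using continuous_dterm_update hp1 hq0 hq1 hS k continuous_neg)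
  have hi5 : Integrable (fun x => ∑ k, (dterm p q a b L k (pt x) + dterm p q a b L k
      (Function.update (pt x) k (pt x k)⁻¹))) (torusMeasure n) :=
    integrable_finsetSum _ fun k _ => (hi3 k).add (hi4 k)
  have h5 : ∫ x, ∑ k, (dterm p q a b L k (pt x) + dterm p q a b L k
      (Function.update (pt x) k (pt x k)⁻¹)) ∂torusMeasure n = 0 := by
    rw [integral_finsetSum _ fun k _ => by exact (hi3 k).add (hi4 k)]
    refine Finset.sum_eq_zero fun k _ => ?_
    rw [integral_add (hi3 k) (hi4 k), integral_dterm hp1 hq0 hq1 hS k,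
      integral_dterm_inv hp1 hq0 hq1 hS k, add_zero]
  have h := integral_congr_ae (μ := torusMeasure n) (g := fun _ => (0 : ℂ))
    ((ae_generic n).mono fun x hx =>
      sum_dterm hp0 hp1 hq0 hq1 hS ha hb hab hL hprod (norm_pt x) hx.1 hx.2)
  have hi6 : Integrable (fun x => a / theta p (a / b) *
      ((L.map fun e => theta p (a * e)).prod * dens p q (q * b :: a :: L) (pt x) -
        (L.map fun e => theta p (b * e)).prod * dens p q (q * a :: b :: L) (pt x)))
      (torusMeasure n) := ((hi1.const_mul _).sub (hi2.const_mul _)).const_mul _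
  rw [integral_add (hi5.const_mul _) hi6, integral_const_mul, h5, mul_zero,
    zero_add, integral_const_mul, integral_sub (hi1.const_mul _) (hi2.const_mul _),
    integral_const_mul, integral_const_mul, integral_zero] at h
  exact sub_eq_zero.1 ((mul_eq_zero.1 h).resolve_left (div_ne_zero ha0 hth))

/-! ### Integrals depending holomorphically on a parameter -/

lemma differentiableOn_integral {X : Type*} [TopologicalSpace X] [CompactSpace X]
    [MeasurableSpace X] [OpensMeasurableSpace X] {μ : Measure X} [IsFiniteMeasure μ]
    {U : Set ℂ} (hU : IsOpen U) {F : ℂ → X → ℂ}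
    (hF : ContinuousOn (Function.uncurry F) (U ×ˢ Set.univ))
    (hd : ∀ x, DifferentiableOn ℂ (fun u => F u x) U) :
    DifferentiableOn ℂ (fun u => ∫ x, F u x ∂μ) U := by
  intro u₀ hu₀
  obtain ⟨ε, hε, hball⟩ := Metric.isOpen_iff.1 hU u₀ hu₀
  set r := ε / 3 with hr
  have hr0 : 0 < r := by positivity
  have hK : Metric.closedBall u₀ (2 * r) ⊆ U :=
    (Metric.closedBall_subset_ball (by linarith)).trans hball
  obtain ⟨C, hC⟩ := ((isCompact_closedBall u₀ (2 * r)).prod isCompact_univ).exists_bound_of_continuousOn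
    (hF.mono (Set.prod_mono hK subset_rfl))
  have hcont : ∀ u ∈ U, Continuous (F u) := fun u hu =>
    continuous_iff_continuousAt.2 fun x =>
      ((hF.continuousAt ((hU.prod isOpen_univ).mem_nhds ⟨hu, trivial⟩)).comp
        (f := fun x => (u, x)) (Continuous.prodMk_right u).continuousAt)
  have hsub : Metric.ball u₀ r ⊆ U := (Metric.ball_subset_ball (by linarith)).trans hball
  have hder : ∀ x, ∀ u ∈ Metric.ball u₀ r, HasDerivAt (fun u => F u x) (deriv (fun u => F u x) u) u :=
    fun x u hu => ((hd x).differentiableAt (hU.mem_nhds (hsub hu))).hasDerivAt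
  have hbound : ∀ x, ∀ u ∈ Metric.ball u₀ r, ‖deriv (fun u => F u x) u‖ ≤ C / r := fun x u hu => by
    have hcb : Metric.closedBall u r ⊆ Metric.closedBall u₀ (2 * r) :=
      Metric.closedBall_subset_closedBall' (by rw [Metric.mem_ball] at hu; linarith)
    refine Complex.norm_deriv_le_of_forall_mem_sphere_norm_le hr0 ?_ fun v hv => ?_
    · exact ((hd x).mono (hcb.trans hK)).diffContOnCl_ball subset_rfl
    · exact hC (v, x) ⟨hcb (Metric.sphere_subset_closedBall hv), trivial⟩
  have hmeas : AEStronglyMeasurable (fun x => deriv (fun u => F u x) u₀) μ := by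
    have hn : Filter.Tendsto (fun n : ℕ => u₀ + ((r / (n + 2) : ℝ) : ℂ)) Filter.atTop
        (nhdsWithin u₀ {u₀}ᶜ) := by
      refine tendsto_nhdsWithin_iff.2 ⟨?_, .of_forall fun n => ?_⟩
      · have h1 : Filter.Tendsto (fun n : ℕ => r / ((n : ℝ) + 2)) Filter.atTop (nhds 0) :=
          Filter.Tendsto.div_atTop tendsto_const_nhds
            (Filter.tendsto_atTop_add_const_right _ _ tendsto_natCast_atTop_atTop)
        simpa using ((Complex.continuous_ofReal.tendsto 0).comp h1).const_add u₀
      · have : r / ((n : ℝ) + 2) ≠ 0 := by positivity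
        simpa only [Set.mem_compl_iff, Set.mem_singleton_iff, add_eq_left, Complex.ofReal_eq_zero]
          using this
    refine aestronglyMeasurable_of_tendsto_ae Filter.atTop
      (f := fun (n : ℕ) x => slope (fun u => F u x) u₀ (u₀ + ((r / (n + 2) : ℝ) : ℂ)))
      (fun n => ?_) (.of_forall fun x => ?_)
    · refine Continuous.aestronglyMeasurable ?_
      simp only [slope, vsub_eq_sub, smul_eq_mul]
      refine continuous_const.mul ((hcont _ ?_).sub (hcont _ hu₀))
      refine hsub ?_
      rw [Metric.mem_ball, dist_self_add_left, Complex.norm_real, Real.norm_of_nonneg (by positivity)]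
      exact div_lt_self hr0 (by linarith [(Nat.cast_nonneg n : (0 : ℝ) ≤ n)])
    · exact (hasDerivAt_iff_tendsto_slope.1 (hder x u₀ (Metric.mem_ball_self hr0))).comp hn
  have := hasDerivAt_integral_of_dominated_loc_of_deriv_le (μ := μ) (F := F)
    (F' := fun u x => deriv (fun u => F u x) u) (x₀ := u₀) (s := Metric.ball u₀ r)
    (bound := fun _ => C / r) (Metric.ball_mem_nhds u₀ hr0)
    (Filter.eventually_of_mem (hU.mem_nhds hu₀) fun u hu => (hcont u hu).aestronglyMeasurable)
    (integrable_of_continuous (hcont u₀ hu₀)) hmeas (.of_forall fun x u hu => hbound x u hu)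
    (integrable_const _) (.of_forall fun x u hu => hder x u hu)
  exact this.2.differentiableAt.differentiableWithinAt

lemma differentiableAt_wt (hp1 : ‖p‖ < 1) (hq1 : ‖q‖ < 1) {L : List (ℂ → ℂ)} {u₀ z : ℂ}
    (hL : ∀ f ∈ L, DifferentiableAt ℂ f u₀ ∧ f u₀ ≠ 0 ∧ ‖f u₀‖ < 1) (hz : ‖z‖ = 1) :
    DifferentiableAt ℂ (fun u => wt p q (L.map fun f => f u) z) u₀ := by
  have hz0 : z ≠ 0 := norm_pos_iff.1 (by simp [hz])
  induction L with
  | nil => simp [wt]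
  | cons f L ih =>
    simp only [List.forall_mem_cons] at hL
    obtain ⟨⟨hf, hf0, hf1⟩, hL⟩ := hL
    simp only [List.map_cons, wt_cons]
    refine DifferentiableAt.mul (DifferentiableAt.mul ?_ ?_) (ih hL)
    · exact (differentiableAt_ellGamma hp1 hq1 (mul_ne_zero hf0 hz0) (by simpa [hz])).comp
        (f := fun u => f u * z) u₀ (hf.mul_const z)
    · exact (differentiableAt_ellGamma hp1 hq1 (div_ne_zero hf0 hz0) (by simpa [hz])).comp
        (f := fun u => f u / z) u₀ (hf.div_const z)

lemma differentiableOn_integral_dens (hp1 : ‖p‖ < 1) (hq1 : ‖q‖ < 1) {n : ℕ} {g : Torus n → ℂ}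
    (hg : Continuous g) {U : Set ℂ} (hU : IsOpen U) {L : List (ℂ → ℂ)}
    (hL : ∀ f ∈ L, DifferentiableOn ℂ f U ∧ ∀ u ∈ U, f u ≠ 0 ∧ ‖f u‖ < 1) :
    DifferentiableOn ℂ
      (fun u => ∫ x, g x * dens p q (L.map fun f => f u) (pt x) ∂torusMeasure n) U := by
  refine differentiableOn_integral hU (continuousOn_of_forall_continuousAt ?_) fun x u hu => ?_
  · rintro ⟨u, x⟩ ⟨hu, -⟩
    refine ContinuousAt.mul (by fun_prop) ?_
    have := continuousAt_dens hp1 hq1 (L := L.map fun f (w : ℂ × Torus n) => f w.1)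
      (z := fun w => pt w.2) (x₀ := (u, x)) (by
        simp only [List.forall_mem_map]
        exact fun f hf => ⟨((((hL f hf).1.differentiableAt (hU.mem_nhds hu)).continuousAt).comp
          (x := ((u, x) : ℂ × Torus n)) continuousAt_fst), (hL f hf).2 u hu⟩)
      (fun i => by fun_prop) (fun i => norm_pt x i)
    simpa [Function.comp_def, Function.uncurry] using this
  · refine DifferentiableAt.differentiableWithinAt (DifferentiableAt.const_mul ?_ _)
    refine DifferentiableAt.const_mul (DifferentiableAt.fun_finsetProd fun i _ =>
      DifferentiableAt.const_mul ?_ _) _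
    exact differentiableAt_wt hp1 hq1 (fun f hf => ⟨(hL f hf).1.differentiableAt (hU.mem_nhds hu),
      (hL f hf).2 u hu⟩) (norm_pt x i)

/-- A holomorphic function on an annulus that is invariant under `u ↦ q u` is constant. -/
lemma eq_of_mul_invariant {c : ℂ} (hc0 : c ≠ 0) (hcq : ‖c‖ < ‖q‖) (hq1 : ‖q‖ < 1) {f : ℂ → ℂ}
    (hf : DifferentiableOn ℂ f {u | ‖c‖ < ‖u‖ ∧ ‖u‖ < 1})
    (hfq : ∀ u, ‖c‖ < ‖q‖ * ‖u‖ → ‖u‖ < 1 → f (q * u) = f u) {u v : ℂ}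
    (hu : ‖c‖ < ‖u‖ ∧ ‖u‖ < 1) (hv : ‖c‖ < ‖v‖ ∧ ‖v‖ < 1) : f u = f v := by
  have hc : 0 < ‖c‖ := norm_pos_iff.2 hc0
  have hq : 0 < ‖q‖ := hc.trans hcq
  have hq0 : q ≠ 0 := norm_pos_iff.1 hq
  obtain ⟨ρ, hρ, hρ1⟩ := exists_between (max_lt hq1 ((div_lt_one hq).2 hcq))
  obtain ⟨hρq, hρc⟩ := max_lt_iff.1 hρ
  rw [div_lt_iff₀ hq, mul_comm] at hρc
  have hA : IsOpen {u : ℂ | ‖c‖ < ‖u‖ ∧ ‖u‖ < 1} :=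
    (isOpen_lt continuous_const continuous_norm).inter (isOpen_lt continuous_norm continuous_const)
  set K : Set ℂ := {u | ‖q‖ * ρ ≤ ‖u‖ ∧ ‖u‖ ≤ ρ} with hKdef
  have hKc : IsCompact K := by
    refine Metric.isCompact_of_isClosed_isBounded ?_ ?_
    · exact (isClosed_le continuous_const continuous_norm).inter
        (isClosed_le continuous_norm continuous_const)
    · exact (Metric.isBounded_closedBall (x := (0 : ℂ)) (r := ρ)).subset fun u hu => by
        simpa using hu.2
  have hKA : K ⊆ {u : ℂ | ‖c‖ < ‖u‖ ∧ ‖u‖ < 1} := fun u hu =>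
    ⟨hρc.trans_le hu.1, hu.2.trans_lt hρ1⟩
  have hρ0 : 0 < ρ := hq.trans hρq
  obtain ⟨u₀, hu₀, hmax⟩ := hKc.exists_isMaxOn
    ⟨(ρ : ℂ), by simp [K, abs_of_pos hρ0, hρ0, hq1.le]⟩ (hf.mono hKA).continuousOn.norm
  set S : Set ℂ := {w | Real.log ‖c‖ < w.re ∧ w.re < 0} with hS
  have hSo : IsOpen S := (isOpen_lt continuous_const Complex.continuous_re).inter
    (isOpen_lt Complex.continuous_re continuous_const)
  have hSc : Convex ℝ S := (convex_halfSpace_re_gt _).inter (convex_halfSpace_re_lt _)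
  have hmem : ∀ w, w ∈ S ↔ ‖c‖ < ‖Complex.exp w‖ ∧ ‖Complex.exp w‖ < 1 := fun w => by
    rw [Complex.norm_exp, Real.exp_lt_one_iff, ← Real.log_lt_iff_lt_exp hc]; rfl
  have hg : DifferentiableOn ℂ (fun w => f (Complex.exp w)) S :=
    hf.comp Complex.differentiable_exp.differentiableOn fun w hw => (hmem w).1 hw
  set V : Set ℂ := {w | max (Real.log ‖c‖) (Real.log (‖q‖ ^ 2 * ρ)) < w.re ∧ w.re < 0} with hV
  have hVS : V ⊆ S := fun w hw => ⟨(le_max_left _ _).trans_lt hw.1, hw.2⟩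
  have hVo : IsOpen V := (isOpen_lt continuous_const Complex.continuous_re).inter
    (isOpen_lt Complex.continuous_re continuous_const)
  have hVc : Convex ℝ V := (convex_halfSpace_re_gt _).inter (convex_halfSpace_re_lt _)
  have hbd : ∀ w ∈ V, ‖f (Complex.exp w)‖ ≤ ‖f u₀‖ := fun w hw => by
    obtain ⟨h1, h2⟩ := (hmem w).1 (hVS hw)
    have h3 : ‖q‖ ^ 2 * ρ < ‖Complex.exp w‖ := by
      rw [Complex.norm_exp, ← Real.log_lt_iff_lt_exp (by positivity)]
      exact (le_max_right _ _).trans_lt hw.1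
    rcases le_or_gt ‖Complex.exp w‖ ρ with h4 | h4
    · rcases le_or_gt (‖q‖ * ρ) ‖Complex.exp w‖ with h5 | h5
      · exact hmax ⟨h5, h4⟩
      · have e : q * (Complex.exp w / q) = Complex.exp w := mul_div_cancel₀ _ hq0
        have e' : ‖q‖ * ‖Complex.exp w / q‖ = ‖Complex.exp w‖ := by rw [← norm_mul, e]
        have h6 : ‖Complex.exp w / q‖ < ρ := by
          rw [norm_div, div_lt_iff₀ hq, mul_comm]; exact h5
        rw [← e, hfq _ (e' ▸ h1) (h6.trans hρ1)]
        refine hmax ⟨?_, h6.le⟩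
        rw [norm_div, le_div_iff₀ hq]
        nlinarith
    · rw [← hfq _ (hρc.trans (mul_lt_mul_of_pos_left h4 hq)) h2]
      refine hmax ⟨?_, ?_⟩
      · rw [norm_mul]; exact mul_le_mul_of_nonneg_left h4.le hq.le
      · rw [norm_mul]; exact (mul_le_of_le_one_right hq.le h2.le).trans hρq.le
  have hu₀0 : u₀ ≠ 0 := norm_pos_iff.1 (hc.trans (hKA hu₀).1)
  have hw₀ : Complex.log u₀ ∈ V := by
    refine ⟨max_lt ?_ ?_, ?_⟩ <;> rw [Complex.log_re]
    · exact Real.log_lt_log hc (hKA hu₀).1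
    · refine Real.log_lt_log (by positivity) (lt_of_lt_of_le ?_ hu₀.1)
      nlinarith [mul_pos hq hρ0]
    · exact Real.log_neg (norm_pos_iff.2 hu₀0) (hKA hu₀).2
  have hconst : Set.EqOn (fun w => f (Complex.exp w)) (fun _ => f u₀) V := by
    have := Complex.eqOn_of_isPreconnected_of_isMaxOn_norm hVc.isPreconnected hVo (hg.mono hVS) hw₀
      (fun w hw => by simpa [Complex.exp_log hu₀0] using hbd w hw)
    intro w hw
    simpa [Complex.exp_log hu₀0] using this hw
  have hall : Set.EqOn (fun w => f (Complex.exp w)) (fun _ => f u₀) S :=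
    (hg.analyticOnNhd hSo).eqOn_of_preconnected_of_eventuallyEq analyticOnNhd_const
      hSc.isPreconnected (hVS hw₀) (Filter.eventually_of_mem (hVo.mem_nhds hw₀) hconst)
  have hval : ∀ u : ℂ, ‖c‖ < ‖u‖ ∧ ‖u‖ < 1 → f u = f u₀ := fun u hu => by
    have hu0 : u ≠ 0 := norm_pos_iff.1 (hc.trans hu.1)
    have := hall ((hmem (Complex.log u)).2 (by rwa [Complex.exp_log hu0]))
    simpa [Complex.exp_log hu0] using this
  rw [hval u hu, hval v hv]

/-! ### Type I integrals, up to a constant -/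

/-- `∏_{r<s} Γ(t_r t_s;p,q)`. -/
noncomputable def pairProd (p q : ℂ) : List ℂ → ℂ
  | [] => 1
  | a :: L => (L.map fun b => ellGamma (a * b) p q).prod * pairProd p q L

lemma pairProd_cons (a : ℂ) (L : List ℂ) : pairProd p q (a :: L) =
    (L.map fun b => ellGamma (a * b) p q).prod * pairProd p q L := rfl

lemma pairProd_perm {L L' : List ℂ} (h : L.Perm L') : pairProd p q L = pairProd p q L' := by
  induction h with
  | nil => rfl
  | cons a h ih => rw [pairProd_cons, pairProd_cons, ih, (h.map _).prod_eq]
  | swap a b L =>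
    simp only [pairProd_cons, List.map_cons, List.prod_cons, mul_comm a b]
    ring
  | trans _ _ ih₁ ih₂ => rw [ih₁, ih₂]

/-- The parameters of an `n`-dimensional type I integral. -/
structure Balanced (p q : ℂ) (n : ℕ) (L : List ℂ) : Prop where
  length_eq : L.length = 2 * n + 4
  prod_eq : L.prod = p * q
  norm_lt : ∀ s ∈ L, ‖s‖ < 1

lemma Balanced.perm {n : ℕ} {L L' : List ℂ} (h : Balanced p q n L) (hp : L.Perm L') :
    Balanced p q n L' :=
  ⟨hp.length_eq ▸ h.1, hp.prod_eq ▸ h.2, fun s hs => h.3 s (hp.mem_iff.2 hs)⟩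

lemma Balanced.ne_zero (hp0 : p ≠ 0) (hq0 : q ≠ 0) {n : ℕ} {L : List ℂ} (h : Balanced p q n L) :
    ∀ s ∈ L, s ≠ 0 := by
  rintro s hs rfl
  exact mul_ne_zero hp0 hq0 (h.prod_eq ▸ List.prod_eq_zero hs)

lemma norm_prod_le_one {L : List ℂ} (hL : ∀ s ∈ L, ‖s‖ < 1) : ‖L.prod‖ ≤ 1 := by
  induction L with
  | nil => simp
  | cons s L ih =>
    simp only [List.forall_mem_cons] at hL
    rw [List.prod_cons, norm_mul]
    exact mul_le_one₀ hL.1.le (norm_nonneg _) (ih hL.2)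

lemma Balanced.norm_mul_lt (hp0 : p ≠ 0) (hq0 : q ≠ 0) {n : ℕ} {a b : ℂ} {M : List ℂ}
    (h : Balanced p q n (a :: b :: M)) : ‖p * q‖ < ‖a * b‖ := by
  have h0 := h.ne_zero hp0 hq0
  obtain ⟨hl, hprod, hlt⟩ := h
  match M, hl with
  | s :: M, _ =>
    simp only [List.forall_mem_cons, List.prod_cons] at *
    have hM := norm_prod_le_one hlt.2.2.2
    have hab : 0 < ‖a * b‖ := norm_pos_iff.2 (mul_ne_zero h0.1 h0.2.1)
    rw [← hprod, ← mul_assoc, norm_mul (a * b), norm_mul s]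
    exact mul_lt_of_lt_one_right hab
      ((mul_le_of_le_one_right (norm_nonneg _) hM).trans_lt hlt.2.2.1)

lemma pairProd_ne_zero_of_pairwise (hp1 : ‖p‖ < 1) (hq1 : ‖q‖ < 1) {L : List ℂ}
    (hL : ∀ s ∈ L, ‖s‖ < 1) (h : L.Pairwise fun a b => ‖p * q‖ < ‖a * b‖) :
    pairProd p q L ≠ 0 := by
  induction L with
  | nil => exact one_ne_zero
  | cons a L ih =>
    simp only [List.forall_mem_cons, List.pairwise_cons] at hL h
    refine mul_ne_zero (List.prod_ne_zero ?_) (ih hL.2 h.2)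
    simp only [List.mem_map, not_exists, not_and]
    intro b hb
    refine ellGamma_ne_zero hp1 hq1 (h.1 b hb) ?_
    rw [norm_mul]
    exact mul_lt_one_of_nonneg_of_lt_one_left (norm_nonneg _) hL.1 (hL.2 b hb).le

lemma Balanced.pairwise (hp0 : p ≠ 0) (hq0 : q ≠ 0) {n : ℕ} {L : List ℂ}
    (h : Balanced p q n L) : L.Pairwise fun a b => ‖p * q‖ < ‖a * b‖ :=
  List.pairwise_iff_forall_sublist.2 fun hs => by
    obtain ⟨M, hM⟩ := hs.exists_perm_append
    exact (h.perm hM).norm_mul_lt hp0 hq0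

lemma Balanced.pairProd_ne_zero (hp0 : p ≠ 0) (hp1 : ‖p‖ < 1) (hq0 : q ≠ 0) (hq1 : ‖q‖ < 1)
    {n : ℕ} {L : List ℂ} (h : Balanced p q n L) : pairProd p q L ≠ 0 :=
  pairProd_ne_zero_of_pairwise hp1 hq1 h.3 (h.pairwise hp0 hq0)

/-- The ratio of a type I integral and its conjectural value. -/
noncomputable def ratio (p q : ℂ) (n : ℕ) (L : List ℂ) : ℂ := typeI p q n L / pairProd p q L

lemma ratio_perm (n : ℕ) {L L' : List ℂ} (h : L.Perm L') : ratio p q n L = ratio p q n L' := by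
  rw [ratio, ratio, typeI_perm n h, pairProd_perm h]

lemma Balanced.replace {n : ℕ} {a b u : ℂ} {M : List ℂ}
    (h : Balanced p q n (a :: b :: M)) (hu0 : u ≠ 0) (hu : ‖a * b‖ < ‖u‖) (hu1 : ‖u‖ < 1) :
    Balanced p q n (u :: a * b / u :: M) := by
  obtain ⟨hl, hprod, hlt⟩ := h
  refine ⟨hl, ?_, ?_⟩
  · rw [← hprod]
    simp only [List.prod_cons]
    field_simp
  · simp only [List.forall_mem_cons] at hlt ⊢
    exact ⟨hu1, by rwa [norm_div, div_lt_one (norm_pos_iff.2 hu0)], hlt.2.2⟩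

lemma map_ellGamma_mul (hp1 : ‖p‖ < 1) (hq0 : q ≠ 0) (hq1 : ‖q‖ < 1) {a : ℂ} {M : List ℂ}
    (h : ∀ e ∈ M, ‖a * e‖ < 1) : (M.map fun e => ellGamma (q * a * e) p q).prod =
      (M.map fun e => theta p (a * e)).prod * (M.map fun e => ellGamma (a * e) p q).prod := by
  rw [← List.prod_map_mul]
  congr 1
  refine List.map_congr_left fun e he => ?_
  rw [mul_assoc, ellGamma_mul hp1 hq0 hq1 (h e he)]

lemma ratio_mul_q (hp0 : p ≠ 0) (hp1 : ‖p‖ < 1) (hq0 : q ≠ 0) (hq1 : ‖q‖ < 1) {n : ℕ} {a b : ℂ}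
    {M : List ℂ} (h : Balanced p q n (q * b :: a :: M)) (hb1 : ‖b‖ < 1) :
    ratio p q n (q * a :: b :: M) = ratio p q n (q * b :: a :: M) := by
  have h0 := h.ne_zero hp0 hq0
  have hn := h.pairwise hp0 hq0
  have hab := h.norm_mul_lt hp0 hq0
  obtain ⟨hl, hprod, hlt⟩ := h
  simp only [List.forall_mem_cons, List.prod_cons, List.pairwise_cons, List.length_cons] at *
  have hb0 : b ≠ 0 := right_ne_zero_of_mul h0.1
  have hq : 0 < ‖q‖ := norm_pos_iff.2 hq0
  have hab' : ‖p‖ < ‖a‖ * ‖b‖ := by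
    rw [norm_mul, norm_mul, norm_mul, mul_comm ‖p‖, mul_assoc, mul_comm ‖b‖] at hab
    exact lt_of_mul_lt_mul_left hab hq.le
  have ha1 := hlt.2.1
  have hap : ‖p‖ < ‖a‖ := hab'.trans_le (mul_le_of_le_one_right (norm_nonneg _) hb1.le)
  have hbp : ‖p‖ < ‖b‖ := hab'.trans_le (mul_le_of_le_one_left (norm_nonneg _) ha1.le)
  have hS : ∀ s ∈ a :: b :: M, s ≠ 0 ∧ ‖s‖ < 1 := by
    simp only [List.forall_mem_cons]
    exact ⟨⟨h0.2.1, ha1⟩, ⟨hb0, hb1⟩, fun e he => ⟨h0.2.2 e he, hlt.2.2 e he⟩⟩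
  have key := typeI_difference hp0 hp1 hq0 hq1 (n := n) (L := M) hS hap hbp (by omega)
    (by refine mul_left_cancel₀ hq0 ?_; linear_combination hprod)
  have hlt1 : ∀ {x : ℂ}, ‖x‖ < 1 → ∀ e ∈ M, ‖x * e‖ < 1 := fun hx e he => by
    rw [norm_mul]; exact mul_lt_one_of_nonneg_of_lt_one_left (norm_nonneg _) hx (hlt.2.2 e he).le
  have hbe : ∀ e ∈ M, ‖p‖ < ‖b * e‖ := fun e he => by
    have := hn.1.2 e he
    rw [mul_assoc, norm_mul, norm_mul q, mul_comm ‖p‖] at this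
    exact lt_of_mul_lt_mul_left this hq.le
  have hae : ∀ e ∈ M, ‖p‖ < ‖a * e‖ := fun e he => by
    obtain ⟨l, r, rfl⟩ := List.append_of_mem he
    have hlr := norm_prod_le_one (L := l ++ r) fun s hs => hlt.2.2 s (by
      rw [List.mem_append] at hs
      rcases hs with hs | hs <;> simp [hs])
    rw [List.prod_append, norm_mul] at hlr
    have e1 : p = a * e * (b * (l.prod * r.prod)) := by
      refine mul_left_cancel₀ hq0 ?_
      rw [List.prod_append, List.prod_cons] at hprod
      linear_combination -hprod
    have hae0 : 0 < ‖a * e‖ := norm_pos_iff.2 (mul_ne_zero h0.2.1 (h0.2.2 e he))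
    conv_lhs => rw [e1]
    rw [norm_mul, norm_mul b, norm_mul l.prod]
    exact mul_lt_of_lt_one_right hae0 ((mul_le_of_le_one_right (norm_nonneg _) hlr).trans_lt hb1)
  have hth : ∀ x : ℂ, ‖x‖ < 1 → (∀ e ∈ M, ‖p‖ < ‖x * e‖) →
      (M.map fun e => theta p (x * e)).prod ≠ 0 := fun x hx h => by
    refine List.prod_ne_zero ?_
    simp only [List.mem_map, not_exists, not_and]
    exact fun e he => theta_ne_zero_of_norm hp1 (h e he) (hlt1 hx e he)
  have hA := hth a ha1 hae
  have hB := hth b hb1 hbe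
  rw [ratio, ratio]
  simp only [pairProd_cons, List.map_cons, List.prod_cons]
  rw [map_ellGamma_mul hp1 hq0 hq1 (hlt1 ha1), map_ellGamma_mul hp1 hq0 hq1 (hlt1 hb1),
    show q * a * b = q * b * a by ring]
  generalize (M.map fun e => theta p (a * e)).prod = A at *
  generalize (M.map fun e => theta p (b * e)).prod = B at *
  generalize typeI p q n (q * b :: a :: M) = T at *
  have hT : typeI p q n (q * a :: b :: M) = A * T / B := by
    rw [eq_div_iff hB, key]; ring
  rw [hT]
  field_simp

lemma ratio_eq_replace (hp0 : p ≠ 0) (hp1 : ‖p‖ < 1) (hq0 : q ≠ 0) (hq1 : ‖q‖ < 1) {n : ℕ}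
    {a b u : ℂ} {M : List ℂ} (h : Balanced p q n (a :: b :: M)) (hab : ‖a * b‖ < ‖q‖)
    (hu : ‖a * b‖ < ‖u‖) (hu1 : ‖u‖ < 1) :
    ratio p q n (a :: b :: M) = ratio p q n (u :: a * b / u :: M) := by
  have h0 := h.ne_zero hp0 hq0
  have hlt := h.norm_lt
  simp only [List.forall_mem_cons] at h0 hlt
  have hc0 : a * b ≠ 0 := mul_ne_zero h0.1 h0.2.1
  have hbal : ∀ v : ℂ, ‖a * b‖ < ‖v‖ ∧ ‖v‖ < 1 → Balanced p q n (v :: a * b / v :: M) := fun v hv =>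
    h.replace (norm_pos_iff.1 ((norm_nonneg _).trans_lt hv.1)) hv.1 hv.2
  have hau : ‖a * b‖ < ‖a‖ := by
    rw [norm_mul]; exact mul_lt_of_lt_one_right (norm_pos_iff.2 h0.1) hlt.2.1
  have hd : DifferentiableOn ℂ (fun v => ratio p q n (v :: a * b / v :: M))
      {v | ‖a * b‖ < ‖v‖ ∧ ‖v‖ < 1} := by
    have hU : IsOpen {v : ℂ | ‖a * b‖ < ‖v‖ ∧ ‖v‖ < 1} :=
      (isOpen_lt continuous_const continuous_norm).inter (isOpen_lt continuous_norm continuous_const)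
    have hv0 : ∀ v : ℂ, ‖a * b‖ < ‖v‖ ∧ ‖v‖ < 1 → v ≠ 0 := fun v hv =>
      norm_pos_iff.1 ((norm_nonneg _).trans_lt hv.1)
    have hdiv : DifferentiableOn ℂ (fun v => a * b / v) {v | ‖a * b‖ < ‖v‖ ∧ ‖v‖ < 1} :=
      fun v hv => (DifferentiableAt.fun_div (differentiableAt_const _) differentiableAt_id
        (hv0 v hv)).differentiableWithinAt
    have hdn : ∀ v : ℂ, ‖a * b‖ < ‖v‖ ∧ ‖v‖ < 1 → ‖a * b / v‖ < 1 := fun v hv => by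
      rw [norm_div, div_lt_one (norm_pos_iff.2 (hv0 v hv))]; exact hv.1
    have h1 := differentiableOn_integral_dens hp1 hq1 (n := n) (g := fun _ => 1)
      continuous_const hU (L := id :: (fun v => a * b / v) :: M.map fun s _ => s) (by
        simp only [List.forall_mem_cons, List.forall_mem_map]
        exact ⟨⟨differentiableOn_id, fun v hv => ⟨hv0 v hv, hv.2⟩⟩,
          ⟨hdiv, fun v hv => ⟨div_ne_zero hc0 (hv0 v hv), hdn v hv⟩⟩,
          fun s hs => ⟨differentiableOn_const _, fun v _ => ⟨h0.2.2 s hs, hlt.2.2 s hs⟩⟩⟩)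
    have h2 : DifferentiableOn ℂ (fun v => typeI p q n (v :: a * b / v :: M))
        {v | ‖a * b‖ < ‖v‖ ∧ ‖v‖ < 1} := by
      simpa [typeI, Function.comp_def] using h1
    refine h2.div ?_ fun v hv => (hbal v hv).pairProd_ne_zero hp0 hp1 hq0 hq1
    have hmap : ∀ (g : ℂ → ℂ) (N : List ℂ), DifferentiableOn ℂ g {v | ‖a * b‖ < ‖v‖ ∧ ‖v‖ < 1} →
        (∀ v, ‖a * b‖ < ‖v‖ ∧ ‖v‖ < 1 → g v ≠ 0 ∧ ‖g v‖ < 1) → (∀ s ∈ N, s ≠ 0 ∧ ‖s‖ < 1) →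
        DifferentiableOn ℂ (fun v => (N.map fun e => ellGamma (g v * e) p q).prod)
          {v | ‖a * b‖ < ‖v‖ ∧ ‖v‖ < 1} := fun g N hg hg1 hN => by
      induction N with
      | nil => simp
      | cons e N ih =>
        simp only [List.forall_mem_cons] at hN
        simp only [List.map_cons, List.prod_cons]
        refine DifferentiableOn.mul (fun v hv => ?_) (ih hN.2)
        have h1 : ‖g v * e‖ < 1 := by
          rw [norm_mul]
          exact mul_lt_one_of_nonneg_of_lt_one_left (norm_nonneg _) (hg1 v hv).2 hN.1.2.le
        exact ((differentiableAt_ellGamma hp1 hq1 (mul_ne_zero (hg1 v hv).1 hN.1.1) h1).comp v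
          ((hg.differentiableAt (hU.mem_nhds hv)).mul_const e)).differentiableWithinAt
    have hM : ∀ s ∈ M, s ≠ 0 ∧ ‖s‖ < 1 := fun s hs => ⟨h0.2.2 s hs, hlt.2.2 s hs⟩
    simp only [pairProd_cons, List.map_cons, List.prod_cons]
    refine ((DifferentiableOn.mul ?_ (hmap _ M differentiableOn_id
      (fun v hv => ⟨hv0 v hv, hv.2⟩) hM)).mul ?_)
    · refine (differentiableOn_const (ellGamma (a * b) p q)).congr fun v hv => ?_
      rw [mul_div_cancel₀ _ (hv0 v hv)]
    · exact (hmap _ M hdiv (fun v hv => ⟨div_ne_zero hc0 (hv0 v hv), hdn v hv⟩) hM).mul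
        (differentiableOn_const _)
  have := eq_of_mul_invariant hc0 hab hq1 hd (fun v hv hv1 => ?_) ⟨hau, hlt.1⟩ ⟨hu, hu1⟩
  · rwa [mul_div_cancel_left₀ _ h0.1] at this
  · have hv0 : 0 < ‖v‖ := pos_of_mul_pos_right ((norm_nonneg _).trans_lt hv) (norm_nonneg q)
    have hv00 := norm_pos_iff.1 hv0
    have e : a * b / v = q * (a * b / (q * v)) := by field_simp
    have hq : 0 < ‖q‖ := norm_pos_iff.2 hq0
    have hn : ‖a * b / (q * v)‖ < 1 := by
      rwa [norm_div, norm_mul q, div_lt_one (by positivity)]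
    have hb := (hbal v ⟨hv.trans (mul_lt_of_lt_one_left hv0 hq1), hv1⟩).perm (.swap _ _ M)
    have key : ∀ w, a * b / v = q * w → ‖w‖ < 1 →
        ratio p q n (q * v :: w :: M) = ratio p q n (v :: a * b / v :: M) := fun w hw hw1 => by
      rw [hw] at hb ⊢
      rw [ratio_mul_q hp0 hp1 hq0 hq1 hb hw1, ratio_perm n (.swap v (q * w) M)]
    exact key _ e hn

/-- Replacing the parameters `L₁` by a common value. -/
lemma ratio_eq_replicate (hp0 : p ≠ 0) (hp1 : ‖p‖ < 1) (hq0 : q ≠ 0) (hq1 : ‖q‖ < 1) {n : ℕ}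
    {ρ : ℂ} (hρ0 : ρ ≠ 0) (hρ : ‖ρ‖ < 1) (L₁ : List ℂ) : ∀ {b : ℂ} {L₂ : List ℂ},
    Balanced p q n (b :: (L₁ ++ L₂)) → ‖b‖ < ‖q‖ → ‖b‖ < ‖ρ‖ → (∀ a ∈ L₁, ‖a‖ ≤ ‖ρ‖) →
    ∃ c, Balanced p q n (c :: (List.replicate L₁.length ρ ++ L₂)) ∧
      ratio p q n (b :: (L₁ ++ L₂)) = ratio p q n (c :: (List.replicate L₁.length ρ ++ L₂)) := by
  induction L₁ with
  | nil => exact fun {b L₂} h _ _ _ => ⟨b, h, rfl⟩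
  | cons a L₁ ih =>
    intro b L₂ h hb hbρ ha
    simp only [List.forall_mem_cons] at ha
    have h0 := h.ne_zero hp0 hq0
    have hlt := h.norm_lt
    simp only [List.cons_append, List.forall_mem_cons] at h0 hlt
    have hba : ‖b * a‖ < ‖b‖ := by
      rw [norm_mul]; exact mul_lt_of_lt_one_right (norm_pos_iff.2 h0.1) hlt.2.1
    have hba' : ‖b * a / ρ‖ ≤ ‖b‖ := by
      rw [norm_div, norm_mul, div_le_iff₀ (norm_pos_iff.2 hρ0)]
      exact mul_le_mul_of_nonneg_left ha.1 (norm_nonneg _)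
    have hp : ∀ x (N : List ℂ), (ρ :: x :: (N ++ L₂)).Perm (x :: (N ++ ρ :: L₂)) := fun x N =>
      (List.Perm.swap _ _ _).trans (List.perm_middle.symm.cons _)
    have h1 := ratio_eq_replace hp0 hp1 hq0 hq1 h (hba.trans hb) (hba.trans hbρ) hρ
    have hB := (h.replace hρ0 (hba.trans hbρ) hρ).perm (hp _ _)
    obtain ⟨c, hc, e⟩ := ih hB (hba'.trans_lt hb) (hba'.trans_lt hbρ) ha.2
    have hq : (c :: (List.replicate L₁.length ρ ++ ρ :: L₂)).Perm
        (c :: (List.replicate (a :: L₁).length ρ ++ L₂)) := List.Perm.cons _ List.perm_middle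
    exact ⟨c, hc.perm hq, h1.trans ((ratio_perm n (hp _ _)).trans (e.trans (ratio_perm n hq)))⟩

lemma exists_typeI_const (hp0 : p ≠ 0) (hp1 : ‖p‖ < 1) (hq0 : q ≠ 0) (hq1 : ‖q‖ < 1) (n : ℕ) :
    ∃ κ, ∀ b L, Balanced p q n (b :: L) → ‖b‖ < ‖q‖ →
      typeI p q n (b :: L) = κ * pairProd p q (b :: L) := by
  have key : ∀ b L b' L', Balanced p q n (b :: L) → ‖b‖ < ‖q‖ → Balanced p q n (b' :: L') →
      ‖b'‖ < ‖q‖ → ratio p q n (b :: L) = ratio p q n (b' :: L') := by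
    intro b L b' L' h hb h' hb'
    have hm : ∀ N : List ℂ, (∀ s ∈ N, ‖s‖ < 1) → ∃ r : ℝ, r < 1 ∧ 0 < r ∧ ∀ s ∈ N, ‖s‖ < r := by
      intro N hN
      induction N with
      | nil => exact ⟨1 / 2, by norm_num, by norm_num, by simp⟩
      | cons s N ih =>
        simp only [List.forall_mem_cons] at hN
        obtain ⟨r, h1, h2, h3⟩ := ih hN.2
        obtain ⟨r', h4, h5⟩ := exists_between (max_lt h1 hN.1)
        refine ⟨r', h5, h2.trans ((le_max_left _ _).trans_lt h4), ?_⟩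
        simp only [List.forall_mem_cons]
        exact ⟨(le_max_right _ _).trans_lt h4, fun s hs =>
          (h3 s hs).trans ((le_max_left _ _).trans_lt h4)⟩
    obtain ⟨r, h1, h2, h3⟩ := hm ((b :: L) ++ (b' :: L')) fun s hs => by
      rcases List.mem_append.1 hs with hs | hs
      exacts [h.norm_lt s hs, h'.norm_lt s hs]
    have hr0 : (r : ℂ) ≠ 0 := by exact_mod_cast h2.ne'
    have hr : ‖(r : ℂ)‖ = r := by rw [Complex.norm_real, Real.norm_of_nonneg h2.le]
    have hx : ∀ x N, Balanced p q n (x :: N) → ‖x‖ < ‖q‖ → (∀ s ∈ x :: N, ‖s‖ < r) →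
        ratio p q n (x :: N) =
          ratio p q n (p * q / r ^ (2 * n + 3) :: List.replicate (2 * n + 3) (r : ℂ)) := by
      intro x N hN hx hs
      simp only [List.forall_mem_cons] at hs
      obtain ⟨c, hc, e⟩ := ratio_eq_replicate hp0 hp1 hq0 hq1 (n := n) hr0 (by rwa [hr]) N
        (b := x) (L₂ := []) (by simpa using hN) hx (by rw [hr]; exact hs.1)
        (fun a ha => by rw [hr]; exact (hs.2 a ha).le)
      have hl : N.length = 2 * n + 3 := by
        have := hN.length_eq
        rw [List.length_cons] at this
        omega
      rw [List.append_nil, List.append_nil, hl] at e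
      rw [List.append_nil, hl] at hc
      have hp := hc.prod_eq
      rw [List.prod_cons, List.prod_replicate] at hp
      rw [e, ← hp, mul_div_cancel_right₀ _ (pow_ne_zero _ hr0)]
    simp only [List.forall_mem_append] at h3
    rw [hx b L h hb h3.1, hx b' L' h' hb' h3.2]
  by_cases hex : ∃ b L, Balanced p q n (b :: L) ∧ ‖b‖ < ‖q‖
  · obtain ⟨b, L, h, hb⟩ := hex
    refine ⟨ratio p q n (b :: L), fun b' L' h' hb' => ?_⟩
    rw [key b L b' L' h hb h' hb', ratio,
      div_mul_cancel₀ _ (h'.pairProd_ne_zero hp0 hp1 hq0 hq1)]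
  · exact ⟨0, fun b L h hb => absurd ⟨b, L, h, hb⟩ hex⟩

/-! ### Composing type I integrals -/

/-- The parameters `τ w^{±1}` for `w ∈ l`. -/
noncomputable def dbl (τ : ℂ) (l : List ℂ) : List ℂ := l.flatMap fun w => [τ * w, τ / w]

lemma prod_map_dbl (f : ℂ → ℂ) (τ : ℂ) (l : List ℂ) :
    ((dbl τ l).map f).prod = (l.map fun w => f (τ * w) * f (τ / w)).prod := by
  induction l with
  | nil => rfl
  | cons w l ih =>
    rw [List.map_cons, List.prod_cons, ← ih, dbl, List.flatMap_cons, List.map_append,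
      List.prod_append]
    simp [dbl]

lemma prod_map_dbl_ofFn (f : ℂ → ℂ) (τ : ℂ) {m : ℕ} (w : Fin m → ℂ) :
    ((dbl τ (List.ofFn w)).map f).prod = ∏ k, (f (τ * w k) * f (τ / w k)) := by
  rw [prod_map_dbl, List.map_ofFn, List.prod_ofFn]
  rfl

lemma length_dbl (τ : ℂ) (l : List ℂ) : (dbl τ l).length = 2 * l.length := by
  simp [dbl, mul_comm]

lemma mem_dbl {τ : ℂ} {m : ℕ} {w : Fin m → ℂ} {s : ℂ} (hs : s ∈ dbl τ (List.ofFn w)) :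
    ∃ k, s = τ * w k ∨ s = τ / w k := by
  simpa [dbl, List.mem_ofFn] using hs

lemma prod_dbl_ofFn (τ : ℂ) {m : ℕ} {w : Fin m → ℂ} (hw : ∀ k, w k ≠ 0) :
    (dbl τ (List.ofFn w)).prod = τ ^ (2 * m) := by
  have := prod_map_dbl_ofFn id τ w
  rw [List.map_id] at this
  rw [this, Finset.prod_congr rfl fun k _ => show id (τ * w k) * id (τ / w k) = τ ^ 2 by
    have := hw k
    simp only [id]
    field_simp]
  rw [Finset.prod_const, Finset.card_univ, Fintype.card_fin, pow_mul]

lemma wt_append (L M : List ℂ) (x : ℂ) : wt p q (L ++ M) x = wt p q L x * wt p q M x := by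
  simp [wt]

lemma dens_append (L M : List ℂ) {n : ℕ} (z : Fin n → ℂ) :
    dens p q (L ++ M) z = dens p q L z * ∏ i, wt p q M (z i) := by
  simp only [dens, wt_append, Finset.prod_mul_distrib]
  ring

lemma pairs_succ (h : ℂ → ℂ) {n : ℕ} (z : Fin (n + 1) → ℂ) : pairs h z =
    (∏ j : Fin n, h (z 0 * z j.succ) * h (z 0 / z j.succ)) * pairs h fun i => z i.succ := by
  simp [pairs, Fin.prod_univ_succ]

lemma pairProd_append (L M : List ℂ) : pairProd p q (L ++ M) = pairProd p q L * pairProd p q M *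
    (L.map fun a => (M.map fun b => ellGamma (a * b) p q).prod).prod := by
  induction L with
  | nil => simp [pairProd]
  | cons a L ih =>
    simp only [List.cons_append, pairProd_cons, ih, List.map_append, List.prod_append,
      List.map_cons, List.prod_cons]
    ring

lemma pairProd_dbl (τ : ℂ) {m : ℕ} {w : Fin m → ℂ} (hw : ∀ k, w k ≠ 0) :
    pairProd p q (dbl τ (List.ofFn w)) =
      ellGamma (τ ^ 2) p q ^ m * pairs (gpair p q (τ ^ 2)) w := by
  induction m with
  | zero => simp [dbl, pairProd, pairs]
  | succ m ih =>
    have h0 := hw 0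
    rw [List.ofFn_succ, dbl, List.flatMap_cons, ← dbl, pairProd_append, ih fun k => hw k.succ,
      pairs_succ]
    simp only [pairProd, List.map_cons, List.map_nil, List.prod_cons, List.prod_nil,
      prod_map_dbl_ofFn, mul_one]
    rw [show τ * w 0 * (τ / w 0) = τ ^ 2 by field_simp, ← Finset.prod_mul_distrib]
    have : ∀ j : Fin m, ellGamma (τ * w 0 * (τ * w j.succ)) p q *
        ellGamma (τ * w 0 * (τ / w j.succ)) p q * (ellGamma (τ / w 0 * (τ * w j.succ)) p q *
        ellGamma (τ / w 0 * (τ / w j.succ)) p q) = gpair p q (τ ^ 2) (w 0 * w j.succ) *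
          gpair p q (τ ^ 2) (w 0 / w j.succ) := fun j => by
      have hj := hw j.succ
      rw [gpair, gpair, show τ * w 0 * (τ * w j.succ) = τ ^ 2 * (w 0 * w j.succ) by ring,
        show τ * w 0 * (τ / w j.succ) = τ ^ 2 * (w 0 / w j.succ) by field_simp,
        show τ / w 0 * (τ * w j.succ) = τ ^ 2 / (w 0 / w j.succ) by field_simp,
        show τ / w 0 * (τ / w j.succ) = τ ^ 2 / (w 0 * w j.succ) by field_simp]
      ring
    simp only [this]
    ring

lemma prod_ellGamma_dbl (τ : ℂ) (T : List ℂ) {m : ℕ} (w : Fin m → ℂ) :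
    (T.map fun a => ((dbl τ (List.ofFn w)).map fun b => ellGamma (a * b) p q).prod).prod =
      ∏ k, wt p q (T.map fun a => τ * a) (w k) := by
  induction T with
  | nil => simp [wt]
  | cons a T ih =>
    simp only [List.map_cons, List.prod_cons, ih, wt_cons, Finset.prod_mul_distrib]
    congr 1
    rw [prod_map_dbl_ofFn]
    refine Finset.prod_congr rfl fun k _ => ?_
    rw [gpair]
    congr 2 <;> ring

lemma prod_wt_dbl_comm (τ : ℂ) {n m : ℕ} {z : Fin n → ℂ} {w : Fin m → ℂ} (hz : ∀ i, z i ≠ 0)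
    (hw : ∀ k, w k ≠ 0) : ∏ i, wt p q (dbl τ (List.ofFn w)) (z i) =
      ∏ k, wt p q (dbl τ (List.ofFn z)) (w k) := by
  simp only [wt, prod_map_dbl_ofFn]
  rw [Finset.prod_comm]
  refine Finset.prod_congr rfl fun k _ => Finset.prod_congr rfl fun i _ => ?_
  have h1 := hz i
  have h2 := hw k
  simp only [gpair]
  rw [show τ * z i / w k = τ / w k * z i by ring, show τ / z i * w k = τ * w k / z i by ring,
    show τ / z i / w k = τ / w k / z i by field_simp, show τ * z i * w k = τ * w k * z i by ring]
  ring

/-- The type II integrals. -/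
noncomputable def typeII (p q : ℂ) (n : ℕ) (t : ℂ) (L : List ℂ) : ℂ :=
  ∫ x, pairs (gpair p q t) (pt x) * dens p q L (pt x) ∂torusMeasure n

lemma typeII_perm (n : ℕ) (t : ℂ) {L L' : List ℂ} (h : L.Perm L') :
    typeII p q n t L = typeII p q n t L' := by
  simp only [typeII, dens, wt_perm h]

lemma gpair_mul_gpair (hp0 : p ≠ 0) (hp1 : ‖p‖ < 1) (hq0 : q ≠ 0) (hq1 : ‖q‖ < 1) {a c x : ℂ}
    (hac : a * c = p * q) (ha : ‖a‖ < 1) (hc : ‖c‖ < 1) (hx : ‖x‖ = 1) :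
    gpair p q a x * gpair p q c x = 1 := by
  have hx0 : x ≠ 0 := norm_pos_iff.1 (by rw [hx]; exact one_pos)
  have h1 := ellGamma_reflection hp0 hp1 hq0 hq1 (x := a * x) (y := c / x)
    (by rw [← hac]; field_simp) (by simpa [hx] using ha) (by simpa [hx] using hc)
  have h2 := ellGamma_reflection hp0 hp1 hq0 hq1 (x := a / x) (y := c * x)
    (by rw [← hac]; field_simp) (by simpa [hx] using ha) (by simpa [hx] using hc)
  rw [gpair, gpair]
  linear_combination (ellGamma (a / x) p q * ellGamma (c * x) p q) * h1 + h2

lemma typeII_cancel (hp0 : p ≠ 0) (hp1 : ‖p‖ < 1) (hq0 : q ≠ 0) (hq1 : ‖q‖ < 1) (n : ℕ) (t : ℂ)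
    {a c : ℂ} (hac : a * c = p * q) (ha : ‖a‖ < 1) (hc : ‖c‖ < 1) (L : List ℂ) :
    typeII p q n t (a :: c :: L) = typeII p q n t L := by
  simp only [typeII, dens, wt_cons, ← mul_assoc,
    gpair_mul_gpair hp0 hp1 hq0 hq1 hac ha hc (norm_pt _ _), mul_one]

lemma integral_typeI_mul_dens {n m : ℕ} {τ b κ : ℂ} {T S : List ℂ}
    (hκ : ∀ b L, Balanced p q n (b :: L) → ‖b‖ < ‖q‖ →
      typeI p q n (b :: L) = κ * pairProd p q (b :: L)) (hb : ‖b‖ < ‖q‖) (hτ : ‖τ‖ < 1)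
    (hT : T.length + 1 + 2 * m = 2 * n + 4) (hprod : b * T.prod * τ ^ (2 * m) = p * q)
    (hlt : ∀ s ∈ b :: T, ‖s‖ < 1) :
    ∫ y, typeI p q n (b :: T ++ dbl τ (List.ofFn (pt y))) * dens p q S (pt y) ∂torusMeasure m =
      κ * pairProd p q (b :: T) * ellGamma (τ ^ 2) p q ^ m *
        typeII p q m (τ ^ 2) (S ++ (b :: T).map fun a => τ * a) := by
  rw [typeII, ← integral_const_mul]
  congr 1
  ext y
  have hB : Balanced p q n (b :: T ++ dbl τ (List.ofFn (pt y))) := by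
    refine ⟨?_, ?_, fun s hs => ?_⟩
    · simp only [List.length_append, List.length_cons, length_dbl, List.length_ofFn]
      omega
    · rw [List.prod_append, List.prod_cons, prod_dbl_ofFn τ (pt_ne_zero y), hprod]
    · rcases List.mem_append.1 hs with hs | hs
      · exact hlt s hs
      · obtain ⟨k, rfl | rfl⟩ := mem_dbl hs <;> simpa
  have e : typeI p q n (b :: T ++ dbl τ (List.ofFn (pt y))) = _ := hκ b _ hB hb
  rw [show b :: T.append (dbl τ (List.ofFn (pt y))) = b :: T ++ dbl τ (List.ofFn (pt y)) from rfl]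
    at e
  rw [dens_append, e, pairProd_append,
    pairProd_dbl τ (pt_ne_zero y), prod_ellGamma_dbl]
  ring

lemma integral_typeI_comm (hp1 : ‖p‖ < 1) (hq1 : ‖q‖ < 1) {n m : ℕ} {τ : ℂ} {T S : List ℂ}
    (hτ0 : τ ≠ 0) (hτ : ‖τ‖ < 1) (hT : ∀ s ∈ T, s ≠ 0 ∧ ‖s‖ < 1) (hS : ∀ s ∈ S, s ≠ 0 ∧ ‖s‖ < 1) :
    ∫ y, typeI p q n (T ++ dbl τ (List.ofFn (pt y))) * dens p q S (pt y) ∂torusMeasure m =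
      ∫ x, typeI p q m (S ++ dbl τ (List.ofFn (pt x))) * dens p q T (pt x) ∂torusMeasure n := by
  simp only [typeI, ← integral_mul_const]
  rw [integral_integral_swap]
  · congr 1
    ext x
    congr 1
    ext y
    rw [dens_append, dens_append, prod_wt_dbl_comm τ (pt_ne_zero x) (pt_ne_zero y)]
    ring
  · refine integrable_of_continuous (continuous_iff_continuousAt.2 fun v => ?_)
    have h1 := continuousAt_dens (x₀ := v) hp1 hq1 (z := fun v : Torus m × Torus n => pt v.2)
      (L := (T.map fun s (_ : Torus m × Torus n) => s) ++
        (List.ofFn fun k (v : Torus m × Torus n) => pt v.1 k).flatMap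
          fun f => [fun v => τ * f v, fun v => τ / f v]) (by
        simp only [List.forall_mem_append, List.forall_mem_map, List.mem_flatMap, List.mem_ofFn,
          List.mem_cons, List.not_mem_nil, or_false]
        refine ⟨fun s hs => ⟨continuousAt_const, hT s hs⟩, ?_⟩
        rintro _ ⟨_, ⟨k, rfl⟩, rfl | rfl⟩
        · exact ⟨by fun_prop, by simp [hτ0], by simpa⟩
        · exact ⟨by fun_prop (disch := simp), by simp [hτ0], by simpa⟩)
      (fun i => by fun_prop) (by simp)
    have h2 : ContinuousAt (fun v : Torus m × Torus n => dens p q S (pt v.1)) v :=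
      (continuous_dens_pt hp1 hq1 hS m).continuousAt.comp continuousAt_fst
    have e : ∀ v : Torus m × Torus n, dbl τ (List.ofFn (pt v.1)) =
        (List.ofFn fun k (v : Torus m × Torus n) => pt v.1 k).flatMap
          fun f => [τ * f v, τ / f v] := fun v => by
      rw [dbl, show List.ofFn (pt v.1) = (List.ofFn fun k (v : Torus m × Torus n) => pt v.1 k).map
        fun f => f v by rw [List.map_ofFn]; rfl, List.flatMap_map]
    refine (h1.mul h2).congr (.of_forall fun v => ?_)
    simp only [Function.uncurry, e]
    simp [List.map_flatMap, Function.comp_def]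

/-- A relation between type II integrals of successive dimensions. -/
lemma typeII_succ (hp0 : p ≠ 0) (hp1 : ‖p‖ < 1) (hq0 : q ≠ 0) (hq1 : ‖q‖ < 1) {m : ℕ} (hm : 1 ≤ m)
    {τ u κ κ' : ℂ} {T : List ℂ}
    (hκ : ∀ b L, Balanced p q m (b :: L) → ‖b‖ < ‖q‖ →
      typeI p q m (b :: L) = κ * pairProd p q (b :: L))
    (hκ' : ∀ b L, Balanced p q (m + 1) (b :: L) → ‖b‖ < ‖q‖ →
      typeI p q (m + 1) (b :: L) = κ' * pairProd p q (b :: L))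
    (hτ0 : τ ≠ 0) (hτ : ‖τ‖ < 1) (hT : T.length = 5) (hlt : ∀ s ∈ T, ‖s‖ < 1)
    (hprod : (τ ^ 2) ^ (2 * m) * (u * T.prod) = p * q) (hu : ‖u‖ < ‖q‖ * ‖τ‖) :
    κ * ellGamma (τ ^ 2) p q ^ (m + 1) * typeII p q (m + 1) (τ ^ 2) (u :: T) =
      κ' * pairProd p q ((τ ^ 2) ^ m * u :: T) * ellGamma ((τ ^ 2) ^ (m + 1)) p q *
        ellGamma (τ ^ 2) p q ^ m * typeII p q m (τ ^ 2) (u / τ :: T.map fun a => τ * a) := by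
  have hpq : p * q ≠ 0 := mul_ne_zero hp0 hq0
  have hτn : 0 < ‖τ‖ := norm_pos_iff.2 hτ0
  obtain ⟨k, rfl⟩ : ∃ k, m = k + 1 := ⟨m - 1, by omega⟩
  set a := τ ^ (2 * k + 1) * T.prod with ha
  set s := (τ ^ 2) ^ (k + 1) * u with hs
  have h0 := hprod ▸ hpq
  have hu0 : u ≠ 0 := left_ne_zero_of_mul (right_ne_zero_of_mul h0)
  have hP0 : T.prod ≠ 0 := right_ne_zero_of_mul (right_ne_zero_of_mul h0)
  have hT0 : ∀ s ∈ T, s ≠ 0 := by rintro s hs rfl; exact hP0 (List.prod_eq_zero hs)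
  have ha1 : ‖a‖ < 1 := by
    rw [ha, norm_mul, norm_pow]
    exact mul_lt_one_of_nonneg_of_lt_one_left (by positivity)
      (pow_lt_one₀ hτn.le hτ (by omega)) (norm_prod_le_one hlt)
  have ht1 : ∀ j, j ≠ 0 → ‖(τ ^ 2) ^ j‖ < 1 := fun j hj => by
    rw [← pow_mul, norm_pow]
    exact pow_lt_one₀ hτn.le hτ (by omega)
  have huq : ‖u‖ < ‖q‖ := hu.trans_le (mul_le_of_le_one_right (norm_nonneg _) hτ.le)
  have hsq : ‖s‖ < ‖q‖ := by
    rw [hs, norm_mul]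
    exact (mul_le_of_le_one_left (norm_nonneg _) (ht1 _ (by omega)).le).trans_lt huq
  have hbq : ‖u / τ‖ < ‖q‖ := by rwa [norm_div, div_lt_iff₀ hτn]
  have hτa : τ * a * s = p * q := by rw [← hprod, ha, hs]; ring
  have hsa : a * (τ * s) = p * q := by rw [← hτa]; ring
  have hτa1 : ‖τ * a‖ < 1 := by
    rw [norm_mul]; exact mul_lt_one_of_nonneg_of_lt_one_left hτn.le hτ ha1.le
  have hτs1 : ‖τ * s‖ < 1 := by
    rw [norm_mul]; exact mul_lt_one_of_nonneg_of_lt_one_left hτn.le hτ (hsq.trans hq1).le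
  have hl1 : ∀ x ∈ s :: T, x ≠ 0 ∧ ‖x‖ < 1 := by
    simp only [List.forall_mem_cons]
    exact ⟨⟨mul_ne_zero (by positivity) hu0, hsq.trans hq1⟩, fun x hx => ⟨hT0 x hx, hlt x hx⟩⟩
  have hl2 : ∀ x ∈ [u / τ, a], x ≠ 0 ∧ ‖x‖ < 1 := by
    simp only [List.forall_mem_cons]
    exact ⟨⟨div_ne_zero hu0 hτ0, hbq.trans hq1⟩, ⟨mul_ne_zero (by positivity) hP0, ha1⟩, by simp⟩
  have e1 := integral_typeI_mul_dens (m := k + 1) (S := [u / τ, a]) hκ' hsq hτ (by omega)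
    (by rw [← hprod, hs]; ring) fun x hx => (hl1 x hx).2
  have e2 := integral_typeI_mul_dens (m := k + 1 + 1) (T := [a]) (S := s :: T) hκ hbq hτ
    (by simp; omega) (by rw [← hprod, ha]; simp only [List.prod_cons, List.prod_nil]; field_simp; ring)
    fun x hx => (hl2 x hx).2
  have e3 := integral_typeI_comm hp1 hq1 (n := k + 1 + 1) (m := k + 1) hτ0 hτ hl1 hl2
  have e4 : typeII p q (k + 1) (τ ^ 2) ([u / τ, a] ++ (s :: T).map fun a => τ * a) =
      typeII p q (k + 1) (τ ^ 2) (u / τ :: T.map fun a => τ * a) := by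
    rw [← typeII_cancel hp0 hp1 hq0 hq1 _ _ hsa ha1 hτs1 (u / τ :: _)]
    refine typeII_perm _ _ ?_
    simp only [List.map_cons, List.cons_append, List.nil_append]
    exact (List.Perm.swap _ _ _).trans ((List.Perm.swap _ _ _).cons _)
  have e5 : typeII p q (k + 1 + 1) (τ ^ 2) (s :: T ++ [u / τ, a].map fun a => τ * a) =
      typeII p q (k + 1 + 1) (τ ^ 2) (u :: T) := by
    rw [← typeII_cancel hp0 hp1 hq0 hq1 _ _ hτa hτa1 (hsq.trans hq1) (u :: _)]
    refine typeII_perm _ _ ?_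
    simp only [List.map_cons, List.map_nil, mul_div_cancel₀ _ hτ0]
    refine (List.perm_append_comm (l₁ := s :: T) (l₂ := [u, τ * a])).trans ?_
    simp only [List.cons_append, List.nil_append]
    exact (List.Perm.swap _ _ _).trans ((List.Perm.swap _ _ _).cons _)
  have e6 : ellGamma (u / τ * a) p q * ellGamma ((τ ^ 2) ^ (k + 1 + 1)) p q = 1 := by
    refine ellGamma_reflection hp0 hp1 hq0 hq1 ?_ ?_ (ht1 _ (by omega))
    · rw [← hprod, ha]; field_simp; ring
    · rw [norm_mul]
      exact mul_lt_one_of_nonneg_of_lt_one_left (norm_nonneg _) (hbq.trans hq1) ha1.le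
  have e7 : pairProd p q [u / τ, a] = ellGamma (u / τ * a) p q := by simp [pairProd]
  rw [e1, e2, e4, e5, e7] at e3
  linear_combination (-ellGamma ((τ ^ 2) ^ (k + 1 + 1)) p q) * e3 -
    κ * ellGamma (τ ^ 2) p q ^ (k + 1 + 1) * typeII p q (k + 1 + 1) (τ ^ 2) (u :: T) * e6

/-! ### The Poisson kernel -/

/-- The Poisson kernel of the unit disc at the real point `r`. -/
noncomputable def poisson (r : ℝ) (x : Circ) : ℝ := (1 - r ^ 2) / ‖cis x - r‖ ^ 2

lemma one_sub_le_norm_cis_sub (r : ℝ) (x : Circ) : 1 - |r| ≤ ‖cis x - r‖ := by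
  have := norm_sub_norm_le (cis x) r
  rwa [norm_cis, Complex.norm_real, Real.norm_eq_abs] at this

lemma continuous_poisson {r : ℝ} (hr0 : 0 ≤ r) (hr : r < 1) : Continuous (poisson r) := by
  unfold poisson
  refine Continuous.div (by fun_prop) (by fun_prop) fun x => ?_
  have := one_sub_le_norm_cis_sub r x
  rw [abs_of_nonneg hr0] at this
  exact pow_ne_zero 2 (by linarith)

lemma poisson_nonneg {r : ℝ} (hr0 : 0 ≤ r) (hr : r < 1) (x : Circ) : 0 ≤ poisson r x := by
  unfold poisson
  have : r ^ 2 ≤ 1 := pow_le_one₀ hr0 hr.le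
  exact div_nonneg (by linarith) (by positivity)

lemma integral_poisson {r : ℝ} (hr0 : 0 ≤ r) (hr : r < 1) : ∫ x, poisson r x ∂circMeasure = 1 := by
  have h1 := DiffContOnCl.circleAverage_re_herglotzRieszKernel_smul (f := fun _ => (1 : ℂ)) (c := 0)
    (R := 1) (w := r) diffContOnCl_const (by simp [abs_of_nonneg hr0, hr])
  rw [← integral_cis] at h1
  have h2 : ∀ x, ((Complex.re ∘ herglotzRieszKernel 0 (r : ℂ)) • fun _ => (1 : ℂ)) (cis x) =
      (poisson r x : ℂ) := fun x => by
    rw [← poissonKernel_eq_re_herglotzRieszKernel]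
    simp [poissonKernel, poisson]
  simp only [h2] at h1
  rw [integral_complex_ofReal] at h1
  exact_mod_cast h1

lemma tendsto_integral_poisson {a : ℝ} (ha0 : 0 ≤ a) (ha : a < 1) {h : ℝ → Circ → ℂ}
    (hh : ContinuousOn (Function.uncurry h) (Set.Icc a 1 ×ˢ Set.univ)) :
    Filter.Tendsto (fun r => ∫ x, (poisson r x : ℂ) * h r x ∂circMeasure) (nhdsWithin 1 (Set.Iio 1))
      (nhds (h 1 0)) := by
  obtain ⟨M, hM⟩ := (isCompact_Icc.prod isCompact_univ).exists_bound_of_continuousOn hh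
  have hM' : ∀ r ∈ Set.Icc a 1, ∀ x, ‖h r x‖ ≤ M := fun r hr x => hM (r, x) ⟨hr, trivial⟩
  have h11 : (1 : ℝ) ∈ Set.Icc a 1 := ⟨ha.le, le_rfl⟩
  have hM0 : 0 ≤ M := (norm_nonneg _).trans (hM' 1 h11 0)
  rw [Metric.tendsto_nhds]
  intro ε hε
  obtain ⟨δ, hδ, hball⟩ := Metric.continuousOn_iff.1 hh (1, 0) ⟨h11, trivial⟩ (ε / 2) (half_pos hε)
  have hK : IsCompact {x : Circ | δ ≤ dist x 0} :=
    (isClosed_le continuous_const (continuous_id.dist continuous_const)).isCompact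
  obtain ⟨η, hη, hηx⟩ : ∃ η : ℝ, 0 < η ∧ ∀ x : Circ, δ ≤ dist x 0 → η ≤ ‖cis x - 1‖ := by
    rcases Set.eq_empty_or_nonempty {x : Circ | δ ≤ dist x 0} with he | he
    · exact ⟨1, one_pos, fun x hx => absurd hx (Set.eq_empty_iff_forall_notMem.1 he x)⟩
    · obtain ⟨y, hy, hmin⟩ := hK.exists_isMinOn he
        (f := fun x => ‖cis x - 1‖) (by fun_prop)
      refine ⟨_, norm_pos_iff.2 (sub_ne_zero.2 fun h => ?_), fun x hx => hmin hx⟩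
      have : y = 0 := cis_injective (h.trans (by simp [cis]))
      rw [this] at hy
      have hy : δ ≤ dist (0 : Circ) 0 := hy
      rw [dist_self] at hy
      linarith
  have hlim : Filter.Tendsto (fun r : ℝ => 8 * M / η ^ 2 * (1 - r ^ 2)) (nhdsWithin 1 (Set.Iio 1))
      (nhds 0) := by
    have : Continuous fun r : ℝ => 8 * M / η ^ 2 * (1 - r ^ 2) := by fun_prop
    simpa using (this.tendsto 1).mono_left nhdsWithin_le_nhds
  have e1 : ∀ᶠ r : ℝ in nhdsWithin 1 (Set.Iio 1), max a (1 - δ) < r :=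
    nhdsWithin_le_nhds (lt_mem_nhds (by simp [hδ, ha]))
  filter_upwards [hlim.eventually (gt_mem_nhds (half_pos hε)), e1, self_mem_nhdsWithin] with r h1 h2 h3
  rw [Set.mem_Iio] at h3
  obtain ⟨h4, h5⟩ := max_lt_iff.1 h2
  have hr0 : 0 ≤ r := by linarith
  have hri : r ∈ Set.Icc a 1 := ⟨h4.le, h3.le⟩
  have hP := continuous_poisson hr0 h3
  have hcr : Continuous (h r) := by
    have := hh.comp_continuous (f := fun x : Circ => (r, x)) (by fun_prop) fun x => ⟨hri, trivial⟩
    exact this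
  have hPc : Continuous fun x => (poisson r x : ℂ) := Complex.continuous_ofReal.comp hP
  have hi : ∫ x, (poisson r x : ℂ) * h 1 0 ∂circMeasure = h 1 0 := by
    rw [integral_mul_const, integral_complex_ofReal, integral_poisson hr0 h3]
    simp
  have i1 : Integrable (fun x => (poisson r x : ℂ) * h r x) circMeasure :=
    integrable_of_continuous (hPc.mul hcr)
  have i2 : Integrable (fun x => (poisson r x : ℂ) * h 1 0) circMeasure :=
    integrable_of_continuous (hPc.mul continuous_const)
  have i3 : Integrable (fun x => poisson r x * (ε / 2)) circMeasure :=
    (hP.mul continuous_const).integrable_of_hasCompactSupport (HasCompactSupport.of_compactSpace _)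
  rw [dist_eq_norm, ← hi, ← integral_sub i1 i2]
  have hb : ∀ x, ‖(poisson r x : ℂ) * h r x - poisson r x * h 1 0‖ ≤
      poisson r x * (ε / 2) + 8 * M / η ^ 2 * (1 - r ^ 2) := fun x => by
    have hp := poisson_nonneg hr0 h3 x
    rw [← mul_sub, norm_mul, Complex.norm_real, Real.norm_of_nonneg hp]
    have hr2 : 0 ≤ 1 - r ^ 2 := by nlinarith
    by_cases hx : dist x 0 < δ
    · have := hball (r, x) ⟨hri, trivial⟩ (by
        rw [Prod.dist_eq, max_lt_iff]
        refine ⟨?_, hx⟩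
        rw [Real.dist_eq, abs_lt]; constructor <;> linarith)
      rw [dist_eq_norm] at this
      have h6 := mul_le_mul_of_nonneg_left this.le hp
      have : 0 ≤ 8 * M / η ^ 2 * (1 - r ^ 2) := by positivity
      simp only [Function.uncurry] at h6
      linarith
    · have h6 : ‖h r x - h 1 0‖ ≤ 2 * M := by
        have := norm_sub_le (h r x) (h 1 0)
        have := hM' r hri x
        have := hM' 1 h11 0
        linarith
      have h7 : η ≤ 2 * ‖cis x - r‖ := by
        have h8 := one_sub_le_norm_cis_sub r x
        rw [abs_of_nonneg hr0] at h8
        have h9 : ‖cis x - 1‖ ≤ ‖cis x - r‖ + (1 - r) := by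
          have := norm_add_le (cis x - r) ((r : ℂ) - 1)
          rw [show ((r : ℂ) - 1) = ((r - 1 : ℝ) : ℂ) by push_cast; ring, Complex.norm_real,
            Real.norm_eq_abs, abs_of_nonpos (by linarith)] at this
          push_cast at this
          rw [sub_add_sub_cancel] at this
          linarith
        have := hηx x (not_lt.1 hx)
        linarith
      have h8 : poisson r x ≤ 4 / η ^ 2 * (1 - r ^ 2) := by
        rw [poisson, div_mul_eq_mul_div]
        have : 0 < ‖cis x - r‖ := by linarith
        rw [div_le_div_iff₀ (by positivity) (by positivity)]
        have : η ^ 2 ≤ (2 * ‖cis x - r‖) ^ 2 := pow_le_pow_left₀ hη.le h7 2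
        nlinarith
      have h9 := mul_le_mul h8 h6 (norm_nonneg _) (by positivity)
      have : 0 ≤ poisson r x * (ε / 2) := by positivity
      calc _ ≤ 4 / η ^ 2 * (1 - r ^ 2) * (2 * M) := h9
        _ = 8 * M / η ^ 2 * (1 - r ^ 2) := by ring
        _ ≤ _ := by linarith
  refine (norm_integral_le_of_norm_le ?_ (.of_forall hb)).trans_lt ?_
  · exact i3.add (integrable_const _)
  · rw [integral_add i3 (integrable_const _), integral_mul_const, integral_poisson hr0 h3,
      integral_const]
    simp
    linarith

/-! ### The constant of the univariate integral -/

lemma poisson_eq (r : ℝ) (x : Circ) :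
    (poisson r x : ℂ) = (1 - r ^ 2) / ((1 - r * cis x) * (1 - r / cis x)) := by
  have h : ((‖cis x - r‖ ^ 2 : ℝ) : ℂ) = (1 - r * cis x) * (1 - r / cis x) := by
    have h1 : (starRingEnd ℂ) (cis x) = (cis x)⁻¹ := by
      rw [Complex.inv_def, Complex.normSq_eq_norm_sq, norm_cis]
      simp
    rw [← Complex.normSq_eq_norm_sq, ← Complex.mul_conj, map_sub, h1, Complex.conj_ofReal]
    field_simp [cis_ne_zero x]
  rw [poisson]
  push_cast
  rw [← h]
  push_cast
  rfl

lemma integral_rotate (G : ℂ → ℂ) {u : ℂ} (hu : ‖u‖ = 1) :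
    ∫ x, G (u * cis x) ∂circMeasure = ∫ x, G (cis x) ∂circMeasure := by
  obtain ⟨y, rfl⟩ := exists_cis_eq hu
  simp only [← cis_add]
  exact integral_add_left_eq_self (fun x => G (cis x)) y

lemma dens_one (L : List ℂ) (x : Torus 1) :
    dens p q L (pt x) = vfac p q (cis (x 0) ^ 2) * wt p q L (cis (x 0)) := by
  simp [dens, pairs, pt]

lemma typeI_one (L : List ℂ) :
    typeI p q 1 L = ∫ x, vfac p q (cis x ^ 2) * wt p q L (cis x) ∂circMeasure := by
  simp only [typeI, dens_one]
  have := (measurePreserving_funUnique (circMeasure) (Fin 1)).integral_comp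
    (MeasurableEquiv.measurableEmbedding _)
    (fun x => vfac p q (cis x ^ 2) * wt p q L (cis x))
  exact this

lemma regGamma_ne_zero (hp1 : ‖p‖ < 1) (hq1 : ‖q‖ < 1) {x : ℂ} (hx : ‖p * q‖ < ‖x‖)
    (hx1 : ‖x‖ ≤ 1) : regGamma p q x ≠ 0 := by
  refine div_ne_zero (dFac_ne_zero hp1 hq1 ?_) (regGamma_denom_ne_zero hp1 hq1 hx1)
  rwa [norm_div, div_lt_one ((norm_nonneg _).trans_lt hx)]

lemma exists_norm_lt_pow (hp1 : ‖p‖ < 1) (k : ℕ) : ∃ c : ℝ, 0 < c ∧ c < 1 ∧ ‖p‖ < c ^ k := by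
  have h : Filter.Tendsto (fun c : ℝ => c ^ k) (nhdsWithin 1 (Set.Iio 1)) (nhds 1) := by
    have : Continuous fun c : ℝ => c ^ k := by fun_prop
    simpa using (this.tendsto 1).mono_left nhdsWithin_le_nhds
  have h0 : ∀ᶠ c : ℝ in nhdsWithin 1 (Set.Iio 1), 0 < c :=
    nhdsWithin_le_nhds (lt_mem_nhds one_pos)
  obtain ⟨c, h1, h2, h3⟩ :=
    ((h.eventually (lt_mem_nhds hp1)).and (h0.and self_mem_nhdsWithin)).exists
  exact ⟨c, h2, h3, h1⟩

/-- The product of the regular parts of `Γ(± r y^{±1};p,q)`. -/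
noncomputable def regFour (p q r y : ℂ) : ℂ :=
  regGamma p q (r * y) * regGamma p q (-r / y) * (regGamma p q (-r * y) * regGamma p q (r / y))

lemma gpair_mul_gpair_I (hp1 : ‖p‖ < 1) (hq1 : ‖q‖ < 1) {r : ℝ} (hr0 : 0 ≤ r) (hr : r < 1)
    {x x' : Circ} (hx : cis x' = -(cis x)⁻¹) :
    (1 - r ^ 2) * (gpair p q (r * Complex.I) (-Complex.I * cis x) *
      gpair p q (-r * Complex.I) (-Complex.I * cis x)) =
    (2 * (1 + (r : ℂ) ^ 2))⁻¹ * (poisson r x * regFour p q r (cis x) +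
      poisson r x' * regFour p q r (cis x)) := by
  have hy := cis_ne_zero x
  have hy1 := norm_cis x
  rw [poisson_eq, poisson_eq, hx]
  set y := cis x
  have hI := Complex.I_ne_zero
  have e1 : r * Complex.I * (-Complex.I * y) = r * y := by
    linear_combination (-r * y) * Complex.I_sq
  have e2 : r * Complex.I / (-Complex.I * y) = -r / y := by field_simp
  have e3 : -r * Complex.I * (-Complex.I * y) = -r * y := by
    linear_combination (r * y) * Complex.I_sq
  have e4 : -r * Complex.I / (-Complex.I * y) = r / y := by field_simp
  have hne : ∀ w : ℂ, ‖w‖ = r → 1 - w ≠ 0 := fun w hw h => by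
    rw [← sub_eq_zero.1 h] at hw
    simp at hw
    linarith
  have hr' : ‖(r : ℂ)‖ = r := by simp [hr0]
  have n1 := hne (r * y) (by simp [hy1, hr0])
  have n2 := hne (-r / y) (by simp [hy1, hr0])
  have n3 := hne (-r * y) (by simp [hy1, hr0])
  have n4 := hne (r / y) (by simp [hy1, hr0])
  have n5 : (1 + r ^ 2 : ℂ) ≠ 0 := by
    have : (1 + r ^ 2 : ℝ) ≠ 0 := by positivity
    exact_mod_cast this
  simp only [gpair, e1, e2, e3, e4, regGamma_eq hp1 hq1, regFour]
  generalize regGamma p q (r * y) = a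
  generalize regGamma p q (-r / y) = b
  generalize regGamma p q (-r * y) = c
  generalize regGamma p q (r / y) = d
  have e5 : (r : ℂ) * -y⁻¹ = -r / y := by field_simp
  have e6 : (r : ℂ) / -y⁻¹ = -r * y := by field_simp
  rw [e5, e6]
  have e7 : (1 - r * y) * (1 - r / y) + (1 - -r / y) * (1 - -r * y) = 2 * (1 + (r : ℂ) ^ 2) := by
    field_simp
    ring
  rw [← e7]
  have n6 : (1 - r * y) * (1 - r / y) + (1 - -r / y) * (1 - -r * y) ≠ 0 := by
    rw [e7]; exact mul_ne_zero two_ne_zero n5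
  generalize (1 - r * y : ℂ) = A at *
  generalize (1 - r / y : ℂ) = B at *
  generalize (1 - -r / y : ℂ) = C at *
  generalize (1 - -r * y : ℂ) = D at *
  field_simp
  ring

lemma integral_poisson_symm (r : ℝ) {G : ℂ → ℂ} (hG : ∀ y ≠ 0, G (-y⁻¹) = G y) {x₀ : Circ}
    (hx₀ : cis x₀ = -1) :
    ∫ x, (poisson r (x₀ - x) : ℂ) * G (cis x) ∂circMeasure =
      ∫ x, (poisson r x : ℂ) * G (cis x) ∂circMeasure := by
  rw [← integral_sub_left_eq_self (fun x => (poisson r x : ℂ) * G (cis x)) circMeasure x₀]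
  congr 1 with x
  rw [sub_eq_add_neg, cis_add, hx₀, cis_neg, neg_one_mul, hG _ (cis_ne_zero x)]

/-- The part of the integrand that stays regular when a pair of parameters pinches the circle. -/
noncomputable def regPart (p q c r y : ℂ) : ℂ :=
  vfac p q (-y ^ 2) * regFour p q r y *
    wt p q [p * q / (r ^ 2 * c ^ 3), c, c, c] (-Complex.I * y)

lemma regPart_neg_inv (hp0 : p ≠ 0) (hp1 : ‖p‖ < 1) (hq0 : q ≠ 0) (hq1 : ‖q‖ < 1) (c r : ℂ) {y : ℂ}
    (hy : y ≠ 0) : regPart p q c r (-y⁻¹) = regPart p q c r y := by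
  have hI := Complex.I_ne_zero
  have e1 : -(-y⁻¹) ^ 2 = (-y ^ 2)⁻¹ := by field_simp
  have e2 : -Complex.I * -y⁻¹ = (-Complex.I * y)⁻¹ := by
    field_simp
    linear_combination Complex.I_sq
  have e3 : regFour p q r (-y⁻¹) = regFour p q r y := by
    have h1 : r * -y⁻¹ = -r / y := by field_simp
    have h2 : -r / -y⁻¹ = r * y := by field_simp
    have h3 : -r * -y⁻¹ = r / y := by field_simp
    have h4 : r / -y⁻¹ = -r * y := by field_simp
    rw [regFour, regFour, h1, h2, h3, h4]
    ring
  rw [regPart, regPart, e1, e2, e3, wt_inv,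
    vfac_inv hp0 hp1 hq0 hq1 (neg_ne_zero.2 (pow_ne_zero 2 hy))]

lemma continuousOn_regPart (hp0 : p ≠ 0) (hp1 : ‖p‖ < 1) (hq0 : q ≠ 0) (hq1 : ‖q‖ < 1) {c : ℝ}
    (hc0 : 0 < c) (hc : c < 1) (hpc : ‖p‖ < c ^ 5) :
    ContinuousOn (Function.uncurry fun (r : ℝ) (x : Circ) => regPart p q c r (cis x))
      (Set.Icc c 1 ×ˢ Set.univ) := by
  refine continuousOn_of_forall_continuousAt ?_
  rintro ⟨r, x⟩ ⟨⟨hr1, hr2⟩, -⟩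
  have hr0 : 0 < r := hc0.trans_le hr1
  have hy := cis_ne_zero x
  have hrC : (r : ℂ) ≠ 0 := by exact_mod_cast hr0.ne'
  have hcC : (c : ℂ) ≠ 0 := by exact_mod_cast hc0.ne'
  have hI := Complex.I_ne_zero
  have cy : ContinuousAt (fun w : ℝ × Circ => cis w.2) (r, x) := by fun_prop
  have cr : ContinuousAt (fun w : ℝ × Circ => (w.1 : ℂ)) (r, x) := by fun_prop
  have hreg : ∀ f : ℝ × Circ → ℂ, ContinuousAt f (r, x) → ‖f (r, x)‖ = r →
      ContinuousAt (fun w => regGamma p q (f w)) (r, x) := fun f hf h1 =>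
    (continuousAt_regGamma hp1 hq1 (norm_pos_iff.1 (by rw [h1]; exact hr0)) (h1.trans_le hr2)).comp hf
  refine ContinuousAt.mul (ContinuousAt.mul ?_ ?_) ?_
  · exact continuousAt_vfac_comp hp1 hq1 (cy.pow 2).neg (neg_ne_zero.2 (pow_ne_zero 2 hy))
  · refine ContinuousAt.mul (ContinuousAt.mul (hreg _ (cr.mul cy) ?_)
      (hreg _ (cr.neg.div cy hy) ?_)) (ContinuousAt.mul (hreg _ (cr.neg.mul cy) ?_)
      (hreg _ (cr.div cy hy) ?_)) <;> simp [hr0.le]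
  · have := continuousAt_wt_comp (X := ℝ × Circ) (x₀ := (r, x)) hp1 hq1
      (L := [fun w => p * q / ((w.1 : ℂ) ^ 2 * c ^ 3), fun _ => (c : ℂ), fun _ => (c : ℂ),
        fun _ => (c : ℂ)]) (g := fun w => -Complex.I * cis w.2) ?_ (by fun_prop) (by simp)
    · simpa using this
    · have hcc : ContinuousAt (fun _ : ℝ × Circ => (c : ℂ)) (r, x) ∧ (c : ℂ) ≠ 0 ∧ ‖(c : ℂ)‖ < 1 :=
        ⟨continuousAt_const, hcC, by simpa [abs_of_pos hc0] using hc⟩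
      simp only [List.forall_mem_cons, hcc, true_and, and_true]
      refine ⟨⟨continuousAt_const.div (by fun_prop)
        (mul_ne_zero (pow_ne_zero 2 hrC) (pow_ne_zero 3 hcC)), ?_, ?_⟩, by simp [hc0.ne']⟩
      · exact div_ne_zero (mul_ne_zero hp0 hq0) (mul_ne_zero (pow_ne_zero 2 hrC)
          (pow_ne_zero 3 hcC))
      · simp only [norm_div, norm_mul, norm_pow, Complex.norm_real, Real.norm_of_nonneg hr0.le,
          Real.norm_of_nonneg hc0.le]
        rw [div_lt_one (by positivity)]
        have h1 : ‖p‖ * ‖q‖ ≤ ‖p‖ := mul_le_of_le_one_right (norm_nonneg _) hq1.le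
        have h2 : c ^ 2 * c ^ 3 ≤ r ^ 2 * c ^ 3 := by gcongr
        calc _ ≤ ‖p‖ := h1
          _ < c ^ 5 := hpc
          _ = c ^ 2 * c ^ 3 := by ring
          _ ≤ _ := h2

lemma one_sub_sq_mul_typeI (hp0 : p ≠ 0) (hp1 : ‖p‖ < 1) (hq0 : q ≠ 0) (hq1 : ‖q‖ < 1) {c : ℝ}
    (hc0 : 0 < c) (hc : c < 1) (hpc : ‖p‖ < c ^ 5) {r : ℝ} (hcr : c ≤ r) (hr : r < 1) :
    (1 - r ^ 2) * typeI p q 1 [p * q / (r ^ 2 * c ^ 3), r * Complex.I, -r * Complex.I, c, c, c] =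
      (1 + (r : ℂ) ^ 2)⁻¹ * ∫ x, (poisson r x : ℂ) * regPart p q c r (cis x) ∂circMeasure := by
  have hr0 : 0 ≤ r := hc0.le.trans hcr
  obtain ⟨x₀, hx₀⟩ := exists_cis_eq (u := -1) (by simp)
  have hx : ∀ x, cis (x₀ - x) = -(cis x)⁻¹ := fun x => by
    rw [sub_eq_add_neg, cis_add, hx₀, cis_neg, neg_one_mul]
  have hG : Continuous fun x => regPart p q c r (cis x) :=
    (continuousOn_regPart hp0 hp1 hq0 hq1 hc0 hc hpc).comp_continuous
      (f := fun x : Circ => (r, x)) (by fun_prop) fun x => ⟨⟨hcr, hr.le⟩, trivial⟩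
  have hP : Continuous fun x => (poisson r x : ℂ) :=
    Complex.continuous_ofReal.comp (continuous_poisson hr0 hr)
  have i1 : Integrable (fun x => (poisson r x : ℂ) * regPart p q c r (cis x)) circMeasure :=
    integrable_of_continuous (hP.mul hG)
  have i2 : Integrable (fun x => (poisson r (x₀ - x) : ℂ) * regPart p q c r (cis x)) circMeasure :=
    integrable_of_continuous ((hP.comp (by fun_prop : Continuous fun x => x₀ - x)).mul hG)
  have h2 := integral_poisson_symm r (fun y hy => regPart_neg_inv hp0 hp1 hq0 hq1 c r hy) hx₀
  rw [typeI_one, ← integral_rotate (fun z => vfac p q (z ^ 2) * wt p q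
    [p * q / (r ^ 2 * c ^ 3), r * Complex.I, -r * Complex.I, c, c, c] z)
    (by simp : ‖-Complex.I‖ = 1), ← integral_const_mul]
  have h3 : ∀ x, (1 - (r : ℂ) ^ 2) * (vfac p q ((-Complex.I * cis x) ^ 2) * wt p q
      [p * q / (r ^ 2 * c ^ 3), r * Complex.I, -r * Complex.I, c, c, c] (-Complex.I * cis x)) =
      (2 * (1 + (r : ℂ) ^ 2))⁻¹ * ((poisson r x : ℂ) * regPart p q c r (cis x) +
        (poisson r (x₀ - x) : ℂ) * regPart p q c r (cis x)) := fun x => by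
    have e : (-Complex.I * cis x) ^ 2 = -cis x ^ 2 := by
      linear_combination (cis x) ^ 2 * Complex.I_sq
    have h := gpair_mul_gpair_I hp1 hq1 hr0 hr (hx x)
    rw [e, regPart]
    simp only [wt_cons]
    linear_combination (vfac p q (-cis x ^ 2) *
      gpair p q (p * q / (r ^ 2 * c ^ 3)) (-Complex.I * cis x) *
      (gpair p q c (-Complex.I * cis x) * (gpair p q c (-Complex.I * cis x) *
        (gpair p q c (-Complex.I * cis x) * wt p q [] (-Complex.I * cis x))))) * h
  simp only [h3]
  rw [integral_const_mul, integral_add i1 i2, h2, mul_inv]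
  ring

/-- The value of the univariate constant. -/
lemma typeI_const_one (hp0 : p ≠ 0) (hp1 : ‖p‖ < 1) (hq0 : q ≠ 0) (hq1 : ‖q‖ < 1) {κ : ℂ}
    (hκ : ∀ b L, Balanced p q 1 (b :: L) → ‖b‖ < ‖q‖ →
      typeI p q 1 (b :: L) = κ * pairProd p q (b :: L)) :
    κ = 2 * (qPoch p * qPoch q)⁻¹ := by
  obtain ⟨c, hc0, hc, hpc⟩ := exists_norm_lt_pow hp1 5
  have hcC : (c : ℂ) ≠ 0 := by exact_mod_cast hc0.ne'
  have hI := Complex.I_ne_zero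
  have hcn : ‖(c : ℂ)‖ = c := by simp [hc0.le]
  have hpq : ‖p * q‖ < ‖p‖ := by
    rw [norm_mul]; exact mul_lt_of_lt_one_right (norm_pos_iff.2 hp0) hq1
  have hp5 : ∀ k ≤ 5, ‖p‖ < c ^ k := fun k hk =>
    hpc.trans_le (pow_le_pow_of_le_one hc0.le hc.le hk)
  set u : ℝ → ℂ := fun r => p * q / (r ^ 2 * c ^ 3) with hu
  set R : ℝ → ℂ := fun r => κ * (regGamma p q (r ^ 2) * (ellGamma (u r * (r * Complex.I)) p q *
    ellGamma (u r * (-r * Complex.I)) p q * ellGamma (u r * c) p q ^ 3 *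
    (ellGamma (r * Complex.I * c) p q * ellGamma (-r * Complex.I * c) p q *
      ellGamma (c * c) p q) ^ 3)) with hR
  have hun : ∀ r : ℝ, c ≤ r → ‖u r‖ < ‖q‖ := fun r hr => by
    have hr0 : 0 < r := hc0.trans_le hr
    simp only [hu, norm_div, norm_mul, norm_pow, Complex.norm_real, Real.norm_of_nonneg hr0.le,
      Real.norm_of_nonneg hc0.le]
    rw [div_lt_iff₀ (by positivity), mul_comm]
    refine mul_lt_mul_of_pos_left (hpc.trans_le ?_) (norm_pos_iff.2 hq0)
    calc c ^ 5 = c ^ 2 * c ^ 3 := by ring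
      _ ≤ _ := by gcongr
  have key : ∀ r : ℝ, c ≤ r → r < 1 → (1 + (r : ℂ) ^ 2)⁻¹ *
      ∫ x, (poisson r x : ℂ) * regPart p q c r (cis x) ∂circMeasure = R r := fun r hcr hr => by
    have hr0 : 0 < r := hc0.trans_le hcr
    have hrC : (r : ℂ) ≠ 0 := by exact_mod_cast hr0.ne'
    have hB : Balanced p q 1 [u r, r * Complex.I, -r * Complex.I, c, c, c] := by
      refine ⟨rfl, ?_, ?_⟩
      · simp only [hu, List.prod_cons, List.prod_nil]
        field_simp
        linear_combination -Complex.I_sq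
      · simp [abs_of_pos hc0, abs_of_pos hr0, hc, hr, (hun r hcr).trans hq1]
    have hr2 : (1 - (r : ℂ) ^ 2) ≠ 0 := by
      have : (1 - r ^ 2 : ℝ) ≠ 0 := by nlinarith
      exact_mod_cast this
    rw [← one_sub_sq_mul_typeI hp0 hp1 hq0 hq1 hc0 hc hpc hcr hr, hκ _ _ hB (hun r hcr)]
    have e : r * Complex.I * (-r * Complex.I) = (r : ℂ) ^ 2 := by
      linear_combination -(r : ℂ) ^ 2 * Complex.I_sq
    simp only [pairProd, List.map_cons, List.map_nil, List.prod_cons, List.prod_nil, e,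
      regGamma_eq hp1 hq1 ((r : ℂ) ^ 2), hR]
    field_simp
  have hlim := tendsto_integral_poisson hc0.le hc
    (continuousOn_regPart hp0 hp1 hq0 hq1 hc0 hc hpc)
  have hlim1 : Filter.Tendsto (fun r : ℝ => (1 + (r : ℂ) ^ 2)⁻¹) (nhdsWithin 1 (Set.Iio 1))
      (nhds (1 / 2)) := by
    have : ContinuousAt (fun r : ℝ => (1 + (r : ℂ) ^ 2)⁻¹) 1 :=
      ContinuousAt.inv₀ (by fun_prop) (by norm_num)
    have := this.tendsto.mono_left (nhdsWithin_le_nhds (s := Set.Iio 1))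
    norm_num at this
    exact this
  have hu1 : ContinuousAt u 1 :=
    continuousAt_const.div (by fun_prop) (by simp [hc0.ne'])
  have hu10 : u 1 ≠ 0 := by simp [hu, hp0, hq0, hc0.ne']
  have hu11 : ‖u 1‖ < 1 := (hun 1 hc.le).trans hq1
  have hu1p : ‖p * q‖ < ‖u 1‖ := by
    simp only [hu, norm_div, norm_mul, norm_pow, Complex.norm_real, Real.norm_of_nonneg hc0.le]
    rw [lt_div_iff₀ (by simp; positivity)]
    have : 0 < ‖p‖ * ‖q‖ := mul_pos (norm_pos_iff.2 hp0) (norm_pos_iff.2 hq0)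
    have : c ^ 3 < 1 := pow_lt_one₀ hc0.le hc (by norm_num)
    simp
    nlinarith
  have hRc : ContinuousAt R 1 := by
    have hΓ : ∀ f : ℝ → ℂ, ContinuousAt f 1 → f 1 ≠ 0 → ‖f 1‖ < 1 →
        ContinuousAt (fun r => ellGamma (f r) p q) 1 := fun f hf h0 h1 =>
      continuousAt_ellGamma_comp hp1 hq1 hf h0 h1
    refine continuousAt_const.mul (ContinuousAt.mul ?_ (ContinuousAt.mul (ContinuousAt.mul
      (ContinuousAt.mul (hΓ _ ?_ ?_ ?_) (hΓ _ ?_ ?_ ?_)) ((hΓ _ ?_ ?_ ?_).pow 3))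
      (ContinuousAt.pow (ContinuousAt.mul (ContinuousAt.mul
      (hΓ _ ?_ ?_ ?_) (hΓ _ ?_ ?_ ?_)) continuousAt_const) 3)))
    · exact (continuousAt_regGamma hp1 hq1 (by simp) (by simp)).comp (by fun_prop)
    any_goals fun_prop
    all_goals simp [hc0.ne', hu10, hu11, abs_of_pos hc0, hc]
    nlinarith [norm_nonneg (u 1)]
  have hfin := tendsto_nhds_unique_of_eventuallyEq (hlim1.mul hlim)
    (hRc.tendsto.mono_left (nhdsWithin_le_nhds (s := Set.Iio 1))) (by
      have : ∀ᶠ r : ℝ in nhdsWithin 1 (Set.Iio 1), c < r := nhdsWithin_le_nhds (lt_mem_nhds hc)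
      filter_upwards [this, self_mem_nhdsWithin] with r h1 h2 using key r h1.le h2)
  have hne : ∀ x : ℂ, ‖p * q‖ < ‖x‖ → ‖x‖ < 1 → ellGamma x p q ≠ 0 := fun x =>
    ellGamma_ne_zero hp1 hq1
  have hpqc : ‖p * q‖ < c := hpq.trans (by simpa using hp5 1 (by norm_num))
  have hrefl : ellGamma (u 1 * c) p q * ellGamma (c * c) p q = 1 := by
    refine ellGamma_reflection hp0 hp1 hq0 hq1 ?_ ?_ ?_
    · simp only [hu]
      field_simp
      simp
    · rw [norm_mul, hcn]; nlinarith [norm_nonneg (u 1)]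
    · rw [norm_mul, hcn]; nlinarith
  have hW1 := hne (u 1 * Complex.I) (by simpa using hu1p) (by simpa using hu11)
  have hW2 := hne (-(u 1 * Complex.I)) (by simpa using hu1p) (by simpa using hu11)
  have hW3 := hne (c * Complex.I) (by simpa [abs_of_pos hc0] using hpqc)
    (by simpa [abs_of_pos hc0] using hc)
  have hW4 := hne (-(c * Complex.I)) (by simpa [abs_of_pos hc0] using hpqc)
    (by simpa [abs_of_pos hc0] using hc)
  have hreg : regGamma p q (-1) ≠ 0 :=
    regGamma_ne_zero hp1 hq1 (by simpa using hpqc.trans hc) (by simp)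
  have hreg1 : regGamma p q 1 ≠ 0 := by
    rw [regGamma_one hp1 hq1]
    exact inv_ne_zero (mul_ne_zero (qPoch_ne_zero hp1) (qPoch_ne_zero hq1))
  have hv : vfac p q (-1) = 4 / regGamma p q (-1) ^ 2 := by
    have := ellGamma_mul_inv (p := p) (q := q) hp1 hq1 (x := -1) (by simp)
    rw [vfac, ← this, inv_neg_one, regGamma_eq hp1 hq1]
    field_simp
    norm_num
  have hgp : ∀ s : ℂ, gpair p q s (-Complex.I) =
      ellGamma (s * Complex.I) p q * ellGamma (-(s * Complex.I)) p q := fun s => by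
    rw [gpair, mul_comm]
    congr 2
    · field_simp
      linear_combination -s * Complex.I_sq
    · ring
  have hc1 : cis 0 = 1 := by simp [cis]
  have hL : regPart p q c (1 : ℝ) (cis 0) = vfac p q (-1) *
      (regGamma p q 1 ^ 2 * regGamma p q (-1) ^ 2) *
      (gpair p q (u 1) (-Complex.I) * gpair p q c (-Complex.I) ^ 3) := by
    simp only [regPart, regFour, hc1, hu, wt, one_pow, mul_one, div_one, Complex.ofReal_one,
      List.map_cons, List.map_nil, List.prod_cons, List.prod_nil]
    ring
  have hR1 : R 1 = κ * (regGamma p q 1 * (ellGamma (u 1 * Complex.I) p q *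
      ellGamma (-(u 1 * Complex.I)) p q * (ellGamma (c * Complex.I) p q *
      ellGamma (-(c * Complex.I)) p q) ^ 3 *
      (ellGamma (u 1 * c) p q * ellGamma (c * c) p q) ^ 3)) := by
    simp only [hR, one_pow, Complex.ofReal_one, one_mul, neg_mul, mul_neg,
      mul_comm Complex.I]
    ring
  rw [hL, hR1, hrefl, hv, hgp, hgp] at hfin
  rw [← regGamma_one hp1 hq1]
  generalize ellGamma (u 1 * Complex.I) p q = a at *
  generalize ellGamma (-(u 1 * Complex.I)) p q = b at *
  generalize ellGamma (c * Complex.I) p q = d at *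
  generalize ellGamma (-(c * Complex.I)) p q = e at *
  field_simp at hfin
  linear_combination -hfin / 2

/-! ### Analytic continuation of the type II evaluation -/

/-- The parameters of an `(m+1)`-dimensional type II integral with coupling `τ ^ 2`. -/
structure Admissible (p q : ℂ) (m : ℕ) (τ : ℂ) (L : List ℂ) : Prop where
  length_eq : L.length = 6
  ne_zero : τ ≠ 0
  norm_lt_one : ‖τ‖ < 1
  norm_lt : ∀ s ∈ L, ‖s‖ < 1
  prod_eq : (τ ^ 2) ^ (2 * m) * L.prod = p * q

/-- The product of elliptic Gamma functions evaluating the type II integral. -/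
noncomputable def typeIIVal (p q : ℂ) (n : ℕ) (τ : ℂ) (L : List ℂ) : ℂ :=
  ∏ j ∈ Finset.range n, ellGamma ((τ ^ 2) ^ (j + 1)) p q *
    pairProd p q (L.map fun a => τ ^ j * a)

lemma Admissible.param_ne_zero (hp0 : p ≠ 0) (hq0 : q ≠ 0) {m : ℕ} {τ : ℂ} {L : List ℂ}
    (h : Admissible p q m τ L) : ∀ s ∈ L, s ≠ 0 := by
  rintro s hs rfl
  have := h.prod_eq
  rw [List.prod_eq_zero hs, mul_zero] at this
  exact mul_ne_zero hp0 hq0 this.symm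

lemma differentiableAt_ellGamma_comp (hp1 : ‖p‖ < 1) (hq1 : ‖q‖ < 1) {f : ℂ → ℂ} {u : ℂ}
    (hf : DifferentiableAt ℂ f u) (h0 : f u ≠ 0) (h1 : ‖f u‖ < 1) :
    DifferentiableAt ℂ (fun u => ellGamma (f u) p q) u :=
  (differentiableAt_ellGamma hp1 hq1 h0 h1).comp u hf

lemma differentiableAt_pairProd (hp1 : ‖p‖ < 1) (hq1 : ‖q‖ < 1) {L : List (ℂ → ℂ)} {u : ℂ}
    (hL : ∀ f ∈ L, DifferentiableAt ℂ f u ∧ f u ≠ 0 ∧ ‖f u‖ < 1) :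
    DifferentiableAt ℂ (fun u => pairProd p q (L.map fun f => f u)) u := by
  induction L with
  | nil => simp [pairProd]
  | cons f L ih =>
    simp only [List.forall_mem_cons] at hL
    obtain ⟨⟨hf, hf0, hf1⟩, hL⟩ := hL
    simp only [List.map_cons, pairProd_cons]
    refine DifferentiableAt.mul ?_ (ih hL)
    clear ih
    induction L with
    | nil => simp
    | cons g L ih =>
      simp only [List.forall_mem_cons] at hL
      obtain ⟨⟨hg, hg0, hg1⟩, hL⟩ := hL
      simp only [List.map_cons, List.prod_cons]
      refine DifferentiableAt.mul (differentiableAt_ellGamma_comp hp1 hq1 (hf.mul hg)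
        (mul_ne_zero hf0 hg0) ?_) (ih hL)
      rw [norm_mul]
      exact mul_lt_one_of_nonneg_of_lt_one_left (norm_nonneg _) hf1 hg1.le

lemma differentiableAt_typeIIVal (hp1 : ‖p‖ < 1) (hq1 : ‖q‖ < 1) (n : ℕ) {τ : ℂ → ℂ}
    {L : List (ℂ → ℂ)} {u : ℂ} (hτ : DifferentiableAt ℂ τ u ∧ τ u ≠ 0 ∧ ‖τ u‖ < 1)
    (hL : ∀ f ∈ L, DifferentiableAt ℂ f u ∧ f u ≠ 0 ∧ ‖f u‖ < 1) :
    DifferentiableAt ℂ (fun u => typeIIVal p q n (τ u) (L.map fun f => f u)) u := by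
  obtain ⟨hτ, hτ0, hτ1⟩ := hτ
  refine DifferentiableAt.fun_finsetProd fun j _ => DifferentiableAt.mul
    (differentiableAt_ellGamma_comp hp1 hq1 ((hτ.pow 2).pow (j + 1)) ?_ ?_) ?_
  · exact pow_ne_zero _ (pow_ne_zero _ hτ0)
  · rw [norm_pow, norm_pow]
    exact pow_lt_one₀ (by positivity) (pow_lt_one₀ (norm_nonneg _) hτ1 two_ne_zero)
      (by omega)
  · have := differentiableAt_pairProd hp1 hq1 (u := u)
      (L := L.map fun f u => τ u ^ j * f u) (by
        simp only [List.forall_mem_map]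
        intro f hf
        obtain ⟨h1, h2, h3⟩ := hL f hf
        refine ⟨(hτ.pow j).mul h1, mul_ne_zero (pow_ne_zero _ hτ0) h2, ?_⟩
        rw [norm_mul, norm_pow]
        exact mul_lt_one_of_nonneg_of_lt_one_right (pow_le_one₀ (norm_nonneg _) hτ1.le)
          (norm_nonneg _) h3)
    simpa [Function.comp_def] using this

lemma differentiableOn_typeII (hp1 : ‖p‖ < 1) (hq1 : ‖q‖ < 1) (n : ℕ) {U : Set ℂ}
    (hU : IsOpen U) {t : ℂ → ℂ} {L : List (ℂ → ℂ)}
    (ht : DifferentiableOn ℂ t U ∧ ∀ u ∈ U, t u ≠ 0 ∧ ‖t u‖ < 1)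
    (hL : ∀ f ∈ L, DifferentiableOn ℂ f U ∧ ∀ u ∈ U, f u ≠ 0 ∧ ‖f u‖ < 1) :
    DifferentiableOn ℂ (fun u => typeII p q n (t u) (L.map fun f => f u)) U := by
  have hz0 : ∀ {z : ℂ}, ‖z‖ = 1 → z ≠ 0 := fun h h' => by simp [h'] at h
  have hLd : ∀ u ∈ U, ∀ f ∈ L, DifferentiableAt ℂ f u ∧ f u ≠ 0 ∧ ‖f u‖ < 1 := fun u hu f hf =>
    ⟨(hL f hf).1.differentiableAt (hU.mem_nhds hu), (hL f hf).2 u hu⟩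
  refine differentiableOn_integral hU (continuousOn_of_forall_continuousAt ?_) fun x u hu => ?_
  · rintro ⟨u, x⟩ ⟨hu, -⟩
    have htc : ContinuousAt (fun w : ℂ × Torus n => t w.1) (u, x) :=
      (ht.1.differentiableAt (hU.mem_nhds hu)).continuousAt.comp
        (x := ((u, x) : ℂ × Torus n)) continuousAt_fst
    have h1 := continuousAt_dens hp1 hq1 (L := L.map fun f (w : ℂ × Torus n) => f w.1)
      (z := fun w => pt w.2) (x₀ := (u, x)) (by
        simp only [List.forall_mem_map]
        exact fun f hf => ⟨(hLd u hu f hf).1.continuousAt.comp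
          (x := ((u, x) : ℂ × Torus n)) continuousAt_fst, (hL f hf).2 u hu⟩)
      (fun i => by fun_prop) (fun i => norm_pt x i)
    have h2 := continuousAt_pairs (X := ℂ × Torus n) (x₀ := (u, x))
      (h := fun w => gpair p q (t w.1)) (z := fun w => pt w.2)
      (fun g hg hg1 => continuousAt_gpair_comp hp1 hq1 htc hg (ht.2 u hu).1 (ht.2 u hu).2 hg1)
      (fun i => by fun_prop) (fun i => norm_pt x i)
    simp only [List.map_map, Function.comp_def] at h1
    exact h2.mul h1
  · refine DifferentiableAt.differentiableWithinAt (DifferentiableAt.mul ?_ ?_)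
    · have hg : ∀ z : ℂ, ‖z‖ = 1 → DifferentiableAt ℂ (fun u => gpair p q (t u) z) u :=
        fun z hz => by
          have htd := ht.1.differentiableAt (hU.mem_nhds hu)
          refine DifferentiableAt.mul (differentiableAt_ellGamma_comp hp1 hq1 (htd.mul_const z)
            (mul_ne_zero (ht.2 u hu).1 (hz0 hz)) ?_) (differentiableAt_ellGamma_comp hp1 hq1
            (htd.div_const z) (div_ne_zero (ht.2 u hu).1 (hz0 hz)) ?_)
          · simpa [hz] using (ht.2 u hu).2
          · simpa [hz] using (ht.2 u hu).2
      refine DifferentiableAt.fun_finsetProd fun i _ => DifferentiableAt.fun_finsetProd fun j _ => ?_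
      split_ifs
      · exact (hg _ (by simp)).mul (hg _ (by simp))
      · exact differentiableAt_const _
    · refine DifferentiableAt.const_mul (DifferentiableAt.fun_finsetProd fun i _ =>
        DifferentiableAt.const_mul ?_ _) _
      exact differentiableAt_wt hp1 hq1 (hLd u hu) (norm_pt x i)

/-- A holomorphic path through `a` reaching modulus `exp (-ε)` at `1`. -/
noncomputable def slide (ε : ℝ) (a l : ℂ) : ℂ :=
  a * Complex.exp (l * ((-ε - Real.log ‖a‖ : ℝ) : ℂ))

lemma norm_mul_exp (a l : ℂ) (d : ℝ) :
    ‖a * Complex.exp (l * d)‖ = ‖a‖ * Real.exp (l.re * d) := by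
  rw [norm_mul, Complex.norm_exp]
  simp

lemma norm_slide_one {ε : ℝ} {a : ℂ} (ha : a ≠ 0) : ‖slide ε a 1‖ = Real.exp (-ε) := by
  rw [slide, norm_mul_exp, Complex.one_re, one_mul, sub_eq_add_neg, Real.exp_add,
    Real.exp_neg (Real.log _), Real.exp_log (norm_pos_iff.2 ha)]
  field_simp [norm_ne_zero_iff.2 ha]

lemma prod_map_slide (ε : ℝ) (l : ℂ) {T : List ℂ} (hT : ∀ a ∈ T, a ≠ 0) :
    (T.map fun a => slide ε a l).prod =
      T.prod * Complex.exp (l * ((-(T.length * ε) - Real.log ‖T.prod‖ : ℝ) : ℂ)) := by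
  induction T with
  | nil => simp
  | cons a T ih =>
    simp only [List.forall_mem_cons] at hT
    have h0 : T.prod ≠ 0 := fun h => hT.2 0 (List.prod_eq_zero_iff.1 h) rfl
    rw [List.map_cons, List.prod_cons, ih hT.2, List.prod_cons, norm_mul,
      Real.log_mul (norm_ne_zero_iff.2 hT.1) (norm_ne_zero_iff.2 h0), slide,
      mul_mul_mul_comm, ← Complex.exp_add]
    congr 2
    push_cast [List.length_cons]
    ring

lemma convex_norm_mul_exp_lt {a : ℂ} (ha : a ≠ 0) (d : ℝ) :
    Convex ℝ {l : ℂ | ‖a * Complex.exp (l * d)‖ < 1} := by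
  have h : {l : ℂ | ‖a * Complex.exp (l * d)‖ < 1} = {l : ℂ | l.re * d < -Real.log ‖a‖} := by
    ext l
    have := norm_pos_iff.2 ha
    rw [Set.mem_ofPred_eq, Set.mem_ofPred_eq, norm_mul_exp, ← Real.log_neg_iff (by positivity),
      Real.log_mul this.ne' (Real.exp_pos _).ne', Real.log_exp]
    constructor <;> intro h <;> linarith
  rw [h]
  refine convex_halfSpace_lt (f := fun l : ℂ => l.re * d) ⟨fun x y => ?_, fun c x => ?_⟩ _
  · simp; ring
  · simp; ring

/-- The type II evaluation extends from parameters with a small first entry to all parameters. -/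
lemma typeII_eq_of_small (hp0 : p ≠ 0) (hp1 : ‖p‖ < 1) (hq0 : q ≠ 0) (hq1 : ‖q‖ < 1) {m : ℕ} {κ : ℂ}
    (h : ∀ τ u T, Admissible p q m τ (u :: T) → ‖u‖ < ‖q‖ * ‖τ‖ →
      typeII p q (m + 1) (τ ^ 2) (u :: T) * ellGamma (τ ^ 2) p q ^ (m + 1) =
        κ * typeIIVal p q (m + 1) τ (u :: T))
    {τ : ℂ} {L : List ℂ} (hA : Admissible p q m τ L) :
    typeII p q (m + 1) (τ ^ 2) L * ellGamma (τ ^ 2) p q ^ (m + 1) =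
      κ * typeIIVal p q (m + 1) τ L := by
  have hne := hA.param_ne_zero hp0 hq0
  obtain ⟨hl, hτ0, hτ1, hlt, hprod⟩ := hA
  match L, hl with
  | u :: T, hl =>
  simp only [List.forall_mem_cons, List.prod_cons, List.length_cons] at hne hlt hprod hl
  have hTl : T.length = 5 := by omega
  obtain ⟨hu0, hT0⟩ := hne
  have hTp : T.prod ≠ 0 := fun h => hT0 0 (List.prod_eq_zero_iff.1 h) rfl
  have hlogp : Real.log ‖p‖ < 0 := Real.log_neg (norm_pos_iff.2 hp0) hp1
  obtain ⟨ε, hε, hε'⟩ : ∃ ε : ℝ, 0 < ε ∧ Real.log ‖p‖ + (4 * m + 6) * ε < 0 :=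
    ⟨-Real.log ‖p‖ / (4 * m + 7), div_pos (by linarith) (by positivity), by
      rw [mul_div_assoc', ← sub_neg_eq_add, ← neg_div, sub_neg, lt_div_iff₀ (by positivity)]
      nlinarith⟩
  set D : ℝ := (4 * m + 5) * ε + 4 * m * Real.log ‖τ‖ + Real.log ‖T.prod‖ with hD
  set fs : List (ℂ → ℂ) := (fun l => u * Complex.exp (l * D)) :: T.map (fun a l => slide ε a l)
    with hfs
  have hfs0 : ∀ f ∈ fs, ∀ l, f l ≠ 0 := by
    simp only [hfs, List.forall_mem_cons, List.forall_mem_map]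
    exact ⟨fun l => mul_ne_zero hu0 (Complex.exp_ne_zero _),
      fun a ha l => mul_ne_zero (hT0 a ha) (Complex.exp_ne_zero _)⟩
  have hsd : ∀ a, Differentiable ℂ (slide ε a) := fun a => by unfold slide; fun_prop
  have hfsd : ∀ f ∈ fs, Differentiable ℂ f := by
    simp only [hfs, List.forall_mem_cons, List.forall_mem_map]
    exact ⟨by fun_prop, fun a _ => hsd a⟩
  set U : Set ℂ := {l | ‖slide ε τ l‖ < 1} ∩ {l | ∀ f ∈ fs, ‖f l‖ < 1} with hU
  have hUo : IsOpen U := by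
    refine (isOpen_lt (hsd τ).continuous.norm continuous_const).inter ?_
    have : {l | ∀ f ∈ fs, ‖f l‖ < 1} = ⋂ f ∈ {f | f ∈ fs}, {l | ‖f l‖ < 1} := by
      ext l; simp
    rw [this]
    exact (List.finite_toSet fs).isOpen_biInter fun f hf =>
      isOpen_lt (hfsd f hf).continuous.norm continuous_const
  have hUc : Convex ℝ U := by
    refine (convex_norm_mul_exp_lt hτ0 _).inter ?_
    have : {l | ∀ f ∈ fs, ‖f l‖ < 1} = ⋂ f ∈ fs, {l | ‖f l‖ < 1} := by
      ext l; simp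
    rw [this]
    refine convex_iInter₂ fun f hf => ?_
    rcases List.mem_cons.1 hf with rfl | hf
    · exact convex_norm_mul_exp_lt hu0 _
    · obtain ⟨a, ha, rfl⟩ := List.mem_map.1 hf
      exact convex_norm_mul_exp_lt (hT0 a ha) _
  have hs0 : ∀ a, slide ε a 0 = a := fun a => by simp [slide]
  have h0 : (0 : ℂ) ∈ U := by
    refine ⟨by simpa [hs0] using hτ1, ?_⟩
    simpa [hfs, hs0] using hlt
  have hτl : ∀ l, (slide ε τ l ^ 2) ^ (2 * m) = (τ ^ 2) ^ (2 * m) *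
      Complex.exp (l * ((4 * m * (-ε - Real.log ‖τ‖) : ℝ) : ℂ)) := fun l => by
    rw [slide, mul_pow, mul_pow, ← Complex.exp_nat_mul, ← Complex.exp_nat_mul]
    congr 2
    push_cast
    ring
  have hadm : ∀ l ∈ U, Admissible p q m (slide ε τ l) (fs.map fun f => f l) := fun l hl => by
    refine ⟨by simp [hfs, hTl], mul_ne_zero hτ0 (Complex.exp_ne_zero _), hl.1, ?_, ?_⟩
    · simpa using hl.2
    · have e : (T.map fun a => slide ε a l).prod = _ := prod_map_slide ε l hT0
      simp only [hfs, List.map_cons, List.map_map, List.prod_cons, Function.comp_def]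
      rw [e, hτl, hTl, ← hprod]
      have : Complex.exp (l * ((4 * m * (-ε - Real.log ‖τ‖) : ℝ) : ℂ)) * (Complex.exp (l * D) *
          Complex.exp (l * ((-((5 : ℕ) * ε) - Real.log ‖T.prod‖ : ℝ) : ℂ))) = 1 := by
        rw [← Complex.exp_add, ← Complex.exp_add, ← mul_add, ← mul_add, ← Complex.ofReal_add,
          ← Complex.ofReal_add, hD]
        convert Complex.exp_zero using 2
        push_cast
        ring
      linear_combination (τ ^ 2) ^ (2 * m) * (u * T.prod) * this
  have hn1 : ‖u * Complex.exp (1 * D)‖ < ‖q‖ * ‖slide ε τ 1‖ := by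
    rw [norm_slide_one hτ0, norm_mul_exp]
    have hq := norm_pos_iff.2 hq0
    have hu := norm_pos_iff.2 hu0
    rw [← Real.log_lt_log_iff (by positivity) (by positivity), Real.log_mul hu.ne'
      (Real.exp_pos _).ne', Real.log_mul hq.ne' (Real.exp_pos _).ne', Real.log_exp, Real.log_exp]
    have := congrArg (fun z : ℂ => Real.log ‖z‖) hprod
    simp only [norm_mul, norm_pow] at this
    rw [Real.log_mul (by simp [hτ0]) (by simp [hu0, hTp]), Real.log_mul (by simp [hu0])
      (by simp [hTp]), Real.log_mul (by simp [hp0]) (by simp [hq0]), Real.log_pow, Real.log_pow]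
      at this
    push_cast at this
    rw [Complex.one_re, hD]
    linarith
  have h1 : (1 : ℂ) ∈ U := by
    have he : Real.exp (-ε) < 1 := by rw [Real.exp_lt_one_iff]; linarith
    refine ⟨by rw [Set.mem_ofPred_eq, norm_slide_one hτ0]; exact he, ?_⟩
    simp only [hfs, Set.mem_ofPred_eq, List.forall_mem_cons, List.forall_mem_map]
    refine ⟨hn1.trans ?_, fun a ha => by rw [norm_slide_one (hT0 a ha)]; exact he⟩
    rw [norm_slide_one hτ0]
    exact mul_lt_one_of_nonneg_of_lt_one_left (norm_nonneg _) hq1 he.le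
  have hτd : DifferentiableOn ℂ (fun l => slide ε τ l ^ 2) U ∧
      ∀ l ∈ U, slide ε τ l ^ 2 ≠ 0 ∧ ‖slide ε τ l ^ 2‖ < 1 :=
    ⟨((hsd τ).pow 2).differentiableOn, fun l hl => ⟨pow_ne_zero 2 (hadm l hl).ne_zero, by
      rw [norm_pow]; exact pow_lt_one₀ (norm_nonneg _) hl.1 two_ne_zero⟩⟩
  have hF : DifferentiableOn ℂ (fun l => typeII p q (m + 1) (slide ε τ l ^ 2) (fs.map fun f => f l) *
      ellGamma (slide ε τ l ^ 2) p q ^ (m + 1)) U :=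
    (differentiableOn_typeII hp1 hq1 _ hUo hτd fun f hf => ⟨(hfsd f hf).differentiableOn,
      fun l hl => ⟨hfs0 f hf l, hl.2 f hf⟩⟩).mul fun l hl =>
      ((differentiableAt_ellGamma_comp hp1 hq1 ((hsd τ).pow 2 l) (hτd.2 l hl).1
        (hτd.2 l hl).2).pow (m + 1)).differentiableWithinAt
  have hG : DifferentiableOn ℂ (fun l => κ * typeIIVal p q (m + 1) (slide ε τ l)
      (fs.map fun f => f l)) U := fun l hl =>
    ((differentiableAt_typeIIVal hp1 hq1 _ ⟨hsd τ l, (hadm l hl).ne_zero, hl.1⟩ fun f hf =>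
      ⟨hfsd f hf l, hfs0 f hf l, hl.2 f hf⟩).const_mul κ).differentiableWithinAt
  have hev : ∀ᶠ l in nhds (1 : ℂ), ‖u * Complex.exp (l * D)‖ < ‖q‖ * ‖slide ε τ l‖ :=
    (isOpen_lt (by fun_prop) (continuous_const.mul (hsd τ).continuous.norm)).mem_nhds hn1
  have key := (hF.analyticOnNhd hUo).eqOn_of_preconnected_of_eventuallyEq (hG.analyticOnNhd hUo)
    hUc.isPreconnected h1 (by
      filter_upwards [hev, hUo.mem_nhds h1] with l hl hlU
      exact h _ _ _ (hadm l hlU) hl) h0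
  have e0 : (fs.map fun f => f 0) = u :: T := by
    simp [hfs, Function.comp_def, hs0]
  simpa only [hs0, e0] using key

/-! ### Induction on the dimension -/

lemma typeIIVal_cons (n : ℕ) (τ u : ℂ) (T : List ℂ) : typeIIVal p q n τ (u :: T) =
    (∏ j ∈ Finset.range n, ellGamma ((τ ^ 2) ^ (j + 1)) p q) *
    (∏ j ∈ Finset.range n, (T.map fun a => ellGamma ((τ ^ 2) ^ j * u * a) p q).prod) *
    ∏ j ∈ Finset.range n, pairProd p q (T.map fun a => τ ^ j * a) := by
  rw [typeIIVal, ← Finset.prod_mul_distrib, ← Finset.prod_mul_distrib]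
  refine Finset.prod_congr rfl fun j _ => ?_
  rw [List.map_cons, pairProd_cons, List.map_map, mul_assoc]
  congr 4
  ext a
  simp only [Function.comp]
  congr 1
  ring

lemma typeIIVal_succ {τ : ℂ} (hτ : τ ≠ 0) (m : ℕ) (u : ℂ) (T : List ℂ) :
    pairProd p q ((τ ^ 2) ^ m * u :: T) * ellGamma ((τ ^ 2) ^ (m + 1)) p q *
      typeIIVal p q m τ (u / τ :: T.map fun a => τ * a) = typeIIVal p q (m + 1) τ (u :: T) := by
  have e1 : ∀ j : ℕ, ∀ a : ℂ, (τ ^ 2) ^ j * (u / τ) * (τ * a) = (τ ^ 2) ^ j * u * a :=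
    fun j a => by field_simp
  have e2 : ∀ j : ℕ, ∀ a : ℂ, τ ^ j * (τ * a) = τ ^ (j + 1) * a := fun j a => by ring
  rw [typeIIVal_cons, typeIIVal_cons, Finset.prod_range_succ, Finset.prod_range_succ,
    Finset.prod_range_succ', pairProd_cons]
  simp only [List.map_map, Function.comp_def, e1, e2, pow_zero, one_mul, List.map_id']
  ring

lemma pairs_one (h : ℂ → ℂ) (z : Fin 1 → ℂ) : pairs h z = 1 := by simp [pairs]

lemma typeII_one (t : ℂ) (L : List ℂ) : typeII p q 1 t L = typeI p q 1 L := by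
  simp [typeII, typeI, pairs_one]

lemma typeII_eq_one (hp0 : p ≠ 0) (hp1 : ‖p‖ < 1) (hq0 : q ≠ 0) (hq1 : ‖q‖ < 1) {κ : ℂ}
    (hκ : ∀ b L, Balanced p q 1 (b :: L) → ‖b‖ < ‖q‖ →
      typeI p q 1 (b :: L) = κ * pairProd p q (b :: L))
    {τ : ℂ} {L : List ℂ} (hA : Admissible p q 0 τ L) :
    typeII p q 1 (τ ^ 2) L * ellGamma (τ ^ 2) p q ^ 1 = κ * typeIIVal p q 1 τ L := by
  refine typeII_eq_of_small hp0 hp1 hq0 hq1 (fun τ u T hA hu => ?_) hA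
  have hu' : ‖u‖ < ‖q‖ :=
    hu.trans_le (mul_le_of_le_one_right (norm_nonneg _) hA.norm_lt_one.le)
  rw [typeII_one, hκ u T ⟨hA.length_eq, by simpa using hA.prod_eq, hA.norm_lt⟩ hu', typeIIVal]
  simp
  ring

lemma typeII_eq_succ (hp0 : p ≠ 0) (hp1 : ‖p‖ < 1) (hq0 : q ≠ 0) (hq1 : ‖q‖ < 1) {m : ℕ} {κ κ' : ℂ}
    (hκ0 : κ ≠ 0)
    (hκ : ∀ b L, Balanced p q (m + 1) (b :: L) → ‖b‖ < ‖q‖ →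
      typeI p q (m + 1) (b :: L) = κ * pairProd p q (b :: L))
    (hκ' : ∀ b L, Balanced p q (m + 1 + 1) (b :: L) → ‖b‖ < ‖q‖ →
      typeI p q (m + 1 + 1) (b :: L) = κ' * pairProd p q (b :: L))
    (ih : ∀ τ L, Admissible p q m τ L →
      typeII p q (m + 1) (τ ^ 2) L * ellGamma (τ ^ 2) p q ^ (m + 1) =
        κ * typeIIVal p q (m + 1) τ L)
    {τ : ℂ} {L : List ℂ} (hA : Admissible p q (m + 1) τ L) :
    typeII p q (m + 1 + 1) (τ ^ 2) L * ellGamma (τ ^ 2) p q ^ (m + 1 + 1) =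
      κ' * typeIIVal p q (m + 1 + 1) τ L := by
  refine typeII_eq_of_small hp0 hp1 hq0 hq1 (fun τ u T hA hu => ?_) hA
  obtain ⟨hl, hτ0, hτ1, hlt, hprod⟩ := hA
  simp only [List.forall_mem_cons, List.prod_cons, List.length_cons] at hlt hprod hl
  have hTl : T.length = 5 := by omega
  have hA' : Admissible p q m τ (u / τ :: T.map fun a => τ * a) := by
    refine ⟨by simp [hTl], hτ0, hτ1, ?_, ?_⟩
    · simp only [List.forall_mem_cons, List.forall_mem_map]
      refine ⟨?_, fun a ha => ?_⟩
      · rw [norm_div, div_lt_one (norm_pos_iff.2 hτ0)]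
        exact hu.trans_le (mul_le_of_le_one_left (norm_nonneg _) hq1.le)
      · rw [norm_mul]
        exact mul_lt_one_of_nonneg_of_lt_one_left (norm_nonneg _) hτ1 (hlt.2 a ha).le
    · have e : (T.map fun a => τ * a).prod = τ ^ 5 * T.prod := by
        rw [List.prod_map_mul, List.map_const', List.prod_replicate, hTl, List.map_id']
      rw [List.prod_cons, e, ← hprod]
      field_simp
      ring
  have h := typeII_succ hp0 hp1 hq0 hq1 (by omega) hκ hκ' hτ0 hτ1 hTl hlt.2 hprod hu
  have h' := ih _ _ hA'
  refine mul_left_cancel₀ hκ0 ?_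
  rw [← typeIIVal_succ hτ0]
  linear_combination h + κ' * h' * pairProd p q ((τ ^ 2) ^ (m + 1) * u :: T) *
    ellGamma ((τ ^ 2) ^ (m + 1 + 1)) p q

/-! ### The degeneration of the coupling constant to `1` -/

/-- The continuous factor of the interaction `Γ(t x^{±1}) / Γ(x^{±1})`. -/
noncomputable def regInter (p q t x : ℂ) : ℂ :=
  regGamma p q (t * x) * regGamma p q (t / x) / (regGamma p q x * regGamma p q x⁻¹)

lemma norm_one_lt_of_norm_eq_one (hp1 : ‖p‖ < 1) (hq1 : ‖q‖ < 1) : ‖p * q‖ < 1 := by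
  rw [norm_mul]
  exact mul_lt_one_of_nonneg_of_lt_one_left (norm_nonneg _) hp1 hq1.le

lemma regGamma_ne_zero_of_norm_eq_one (hp1 : ‖p‖ < 1) (hq1 : ‖q‖ < 1) {x : ℂ} (hx : ‖x‖ = 1) :
    regGamma p q x ≠ 0 :=
  regGamma_ne_zero hp1 hq1 (hx ▸ norm_one_lt_of_norm_eq_one hp1 hq1) hx.le

lemma gpair_mul_vfac (hp1 : ‖p‖ < 1) (hq1 : ‖q‖ < 1) (t : ℂ) {x : ℂ} (hx : ‖x‖ = 1) :
    gpair p q t x * vfac p q x =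
      regInter p q t x * ((1 - x) / (1 - t * x)) * ((1 - x⁻¹) / (1 - t / x)) := by
  rw [vfac, ← ellGamma_mul_inv hp1 hq1 hx, gpair, regGamma_eq hp1 hq1, regGamma_eq hp1 hq1,
    regGamma_eq hp1 hq1, regGamma_eq hp1 hq1, regInter]
  simp only [div_eq_mul_inv, mul_inv, inv_inv]
  ring

lemma continuousAt_regInter (hp1 : ‖p‖ < 1) (hq1 : ‖q‖ < 1) {t : ℝ} (ht0 : 0 < t) (ht1 : t ≤ 1)
    {x : ℂ} (hx : ‖x‖ = 1) :
    ContinuousAt (fun v : ℝ × ℂ => regInter p q v.1 v.2) (t, x) := by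
  have hx0 : x ≠ 0 := by rintro rfl; simp at hx
  have ht : (t : ℂ) ≠ 0 := by exact_mod_cast ht0.ne'
  have h : ∀ f : ℝ × ℂ → ℂ, ContinuousAt f (t, x) → f (t, x) ≠ 0 → ‖f (t, x)‖ ≤ 1 →
      ContinuousAt (fun v => regGamma p q (f v)) (t, x) := fun f hf h0 h1 =>
    (continuousAt_regGamma hp1 hq1 h0 h1).comp hf
  refine ((h _ (by fun_prop) (by simp [ht, hx0]) (by simp [hx, abs_of_pos ht0, ht1])).mul
    (h _ ?_ (by simp [ht, hx0]) (by simp [hx, abs_of_pos ht0, ht1]))).div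
    ((h _ (by fun_prop) (by simp [hx0]) (by simp [hx])).mul
    (h _ ?_ (by simp [hx0]) (by simp [hx]))) ?_
  · exact ContinuousAt.div (by fun_prop) (by fun_prop) hx0
  · exact ContinuousAt.inv₀ (by fun_prop) hx0
  · exact mul_ne_zero (regGamma_ne_zero_of_norm_eq_one hp1 hq1 hx)
      (regGamma_ne_zero_of_norm_eq_one hp1 hq1 (by simp [hx]))

lemma norm_one_sub_div_le {t : ℝ} (ht0 : 0 ≤ t) (ht1 : t ≤ 1) {x : ℂ} (hx : ‖x‖ = 1) :
    ‖(1 - x) / (1 - t * x)‖ ≤ 2 := by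
  rw [norm_div]
  refine div_le_of_le_mul₀ (norm_nonneg _) zero_le_two ?_
  have h1 : ‖(t - 1 : ℂ) * x‖ = 1 - t := by
    rw [norm_mul, hx, mul_one, norm_sub_rev]
    have : ((1 : ℂ) - t) = ((1 - t : ℝ) : ℂ) := by push_cast; ring
    rw [this, Complex.norm_of_nonneg (by linarith)]
  have h2 : 1 - t ≤ ‖1 - t * x‖ := by
    have := norm_sub_norm_le (1 : ℂ) (t * x)
    simpa [hx, abs_of_nonneg ht0] using this
  have h3 : 1 - x = (1 - t * x) + (t - 1) * x := by ring
  have h4 := norm_add_le (1 - t * x) ((t - 1) * x)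
  rw [h3]
  linarith

lemma exists_norm_gpair_mul_vfac_le (hp1 : ‖p‖ < 1) (hq1 : ‖q‖ < 1) {a : ℝ} (ha : 0 < a) :
    ∃ C : ℝ, 1 ≤ C ∧ ∀ t : ℝ, a ≤ t → t ≤ 1 → ∀ x : ℂ, ‖x‖ = 1 →
      ‖gpair p q t x * vfac p q x‖ ≤ C := by
  obtain ⟨C, hC⟩ := ((isCompact_Icc (a := a) (b := 1)).prod
    (isCompact_sphere (0 : ℂ) 1)).exists_bound_of_continuousOn
    (f := fun v : ℝ × ℂ => regInter p q v.1 v.2) (by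
      rintro ⟨t, x⟩ ⟨⟨h1, h2⟩, hx⟩
      exact (continuousAt_regInter hp1 hq1 (ha.trans_le h1) h2 (by simpa using hx)
        ).continuousWithinAt)
  refine ⟨max 1 (C * 2 * 2), le_max_left _ _, fun t h1 h2 x hx => le_max_of_le_right ?_⟩
  have h := hC (t, x) ⟨⟨h1, h2⟩, by simpa using hx⟩
  have hC0 := (norm_nonneg _).trans h
  rw [gpair_mul_vfac hp1 hq1 _ hx, norm_mul, norm_mul]
  have h3 := norm_one_sub_div_le (ha.le.trans h1) h2 hx
  have h4 := norm_one_sub_div_le (ha.le.trans h1) h2 (x := x⁻¹) (by simp [hx])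
  rw [← div_eq_mul_inv] at h4
  gcongr

lemma tendsto_gpair_mul_vfac (hp1 : ‖p‖ < 1) (hq1 : ‖q‖ < 1) {x : ℂ} (hx : ‖x‖ = 1)
    (hx1 : x ≠ 1) :
    Filter.Tendsto (fun t : ℝ => gpair p q t x * vfac p q x) (nhds 1) (nhds 1) := by
  have hx0 : x ≠ 0 := by rintro rfl; simp at hx
  simp only [gpair_mul_vfac hp1 hq1 _ hx]
  have hr := regGamma_ne_zero_of_norm_eq_one hp1 hq1 hx
  have hr' := regGamma_ne_zero_of_norm_eq_one hp1 hq1 (x := x⁻¹) (by simp [hx])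
  have h1 : 1 - x ≠ 0 := sub_ne_zero.2 hx1.symm
  have h2 : 1 - x⁻¹ ≠ 0 := sub_ne_zero.2 (by simpa [eq_comm] using hx1)
  have e : ContinuousAt (fun t : ℝ => regInter p q t x * ((1 - x) / (1 - t * x)) *
      ((1 - x⁻¹) / (1 - t / x))) 1 := by
    have h := ContinuousAt.comp (f := fun t : ℝ => (t, x)) (x := 1)
      (continuousAt_regInter hp1 hq1 one_pos le_rfl hx) (by fun_prop)
    refine (h.mul (ContinuousAt.div (by fun_prop) (by fun_prop) (by simpa))).mul
      (ContinuousAt.div (by fun_prop) (ContinuousAt.sub (by fun_prop)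
        (ContinuousAt.div_const (by fun_prop) _)) (by simpa))
  convert e.tendsto using 2
  simp only [regInter, Complex.ofReal_one, one_mul, one_div]
  rw [div_self (mul_ne_zero hr hr'), div_self h1, div_self h2]
  simp

lemma pairs_mul (h h' : ℂ → ℂ) {n : ℕ} (z : Fin n → ℂ) :
    pairs h z * pairs h' z = pairs (fun x => h x * h' x) z := by
  simp only [pairs, ← Finset.prod_mul_distrib]
  refine Finset.prod_congr rfl fun i _ => Finset.prod_congr rfl fun j _ => ?_
  split_ifs <;> ring

lemma norm_pairs_le {h : ℂ → ℂ} {C : ℝ} (hC : 1 ≤ C) (hh : ∀ x, ‖x‖ = 1 → ‖h x‖ ≤ C) {n : ℕ}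
    {z : Fin n → ℂ} (hz : ∀ i, ‖z i‖ = 1) : ‖pairs h z‖ ≤ ((C * C) ^ n) ^ n := by
  have h1 : ∀ {f : Fin n → ℂ} {B : ℝ}, (∀ i, ‖f i‖ ≤ B) → ‖∏ i, f i‖ ≤ B ^ n := fun {f B} hf => by
    rw [norm_prod]
    calc _ ≤ ∏ _i : Fin n, B := Finset.prod_le_prod (fun _ _ => norm_nonneg _) fun i _ => hf i
      _ = B ^ n := by simp
  refine h1 fun i => h1 fun j => ?_
  split_ifs
  · rw [norm_mul]
    exact mul_le_mul (hh _ (by simp [hz])) (hh _ (by simp [hz])) (norm_nonneg _) (by linarith)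
  · simpa using one_le_mul_of_one_le_of_one_le hC hC

lemma tendsto_pairs {X : Type*} {l : Filter X} {h : X → ℂ → ℂ} {n : ℕ} {z : Fin n → ℂ}
    (hh : ∀ i j, i < j → Filter.Tendsto (fun t => h t (z i * z j)) l (nhds 1) ∧
      Filter.Tendsto (fun t => h t (z i / z j)) l (nhds 1)) :
    Filter.Tendsto (fun t => pairs (h t) z) l (nhds 1) := by
  have h1 : ∀ {f : X → Fin n → ℂ}, (∀ i, Filter.Tendsto (fun t => f t i) l (nhds 1)) →
      Filter.Tendsto (fun t => ∏ i, f t i) l (nhds 1) := fun {f} hf => by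
    simpa using tendsto_finsetProd Finset.univ fun i _ => hf i
  refine h1 fun i => h1 fun j => ?_
  split_ifs with hij
  · simpa using (hh i j hij).1.mul (hh i j hij).2
  · exact tendsto_const_nhds

lemma continuousAt_prod_vfac_mul_wt (hp1 : ‖p‖ < 1) (hq1 : ‖q‖ < 1) {L : List (ℂ → ℂ)} {n : ℕ}
    {v : ℝ × Torus n} (hL : ∀ f ∈ L, ContinuousAt f v.1 ∧ f v.1 ≠ 0 ∧ ‖f v.1‖ < 1) :
    ContinuousAt (fun v : ℝ × Torus n => ∏ i, (vfac p q (pt v.2 i ^ 2) *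
      wt p q (L.map fun f => f v.1) (pt v.2 i))) v := by
  refine tendsto_finsetProd _ fun i _ => ContinuousAt.mul ?_ ?_
  · exact continuousAt_vfac_comp hp1 hq1 (by fun_prop) (by simp)
  · have := continuousAt_wt_comp (x₀ := v) hp1 hq1
      (L := L.map fun f (v : ℝ × Torus n) => f v.1) (g := fun v => pt v.2 i) (by
        simp only [List.forall_mem_map]
        intro f hf
        obtain ⟨h1, h2, h3⟩ := hL f hf
        exact ⟨ContinuousAt.comp (f := fun v : ℝ × Torus n => (v.1 : ℂ)) h1 (by fun_prop),
          h2, h3⟩) (by fun_prop) (by simp)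
    simpa only [List.map_map, Function.comp_def] using this

lemma typeII_integrand_eq (t : ℂ) (L : List ℂ) {n : ℕ} (z : Fin n → ℂ) :
    pairs (gpair p q t) z * dens p q L z =
      pairs (fun x => gpair p q t x * vfac p q x) z *
        ∏ i, (vfac p q (z i ^ 2) * wt p q L (z i)) := by
  rw [dens, ← mul_assoc, pairs_mul]

/-- As the coupling tends to `1`, the variables decouple. -/
lemma tendsto_typeII (hp1 : ‖p‖ < 1) (hq1 : ‖q‖ < 1) {a : ℝ} (ha0 : 0 < a) (ha1 : a < 1)
    {L : List (ℂ → ℂ)}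
    (hL : ∀ τ : ℝ, a ≤ τ → τ ≤ 1 → ∀ f ∈ L, ContinuousAt f τ ∧ f τ ≠ 0 ∧ ‖f τ‖ < 1) (n : ℕ) :
    Filter.Tendsto (fun τ : ℝ => typeII p q n ((τ : ℂ) ^ 2) (L.map fun f => f τ))
      (nhdsWithin 1 (Set.Iio 1)) (nhds (typeI p q 1 (L.map fun f => f 1) ^ n)) := by
  obtain ⟨C, hC1, hC⟩ := exists_norm_gpair_mul_vfac_le hp1 hq1 (a := a ^ 2) (by positivity)
  have hcont : ∀ τ : ℝ, a ≤ τ → τ ≤ 1 → ∀ x : Torus n,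
      ContinuousAt (fun v : ℝ × Torus n => ∏ i, (vfac p q (pt v.2 i ^ 2) *
        wt p q (L.map fun f => f v.1) (pt v.2 i))) (τ, x) := fun τ h1 h2 x =>
    continuousAt_prod_vfac_mul_wt hp1 hq1 (hL τ h1 h2)
  obtain ⟨B, hB⟩ := ((isCompact_Icc (a := a) (b := 1)).prod
    (isCompact_univ (X := Torus n))).exists_bound_of_continuousOn (fun v hv =>
      (hcont v.1 hv.1.1 hv.1.2 v.2).continuousWithinAt)
  have hev : ∀ᶠ τ : ℝ in nhdsWithin 1 (Set.Iio 1), a < τ ∧ τ < 1 :=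
    Filter.Eventually.and (nhdsWithin_le_nhds (lt_mem_nhds ha1)) self_mem_nhdsWithin
  have hlim : typeI p q 1 (L.map fun f => f 1) ^ n = ∫ x, ∏ i, (vfac p q (pt x i ^ 2) *
      wt p q (L.map fun f => f 1) (pt x i)) ∂torusMeasure n := by
    rw [typeI_one]
    have := integral_fintype_prod_eq_pow (ι := Fin n) (μ := circMeasure)
      (fun x => vfac p q (cis x ^ 2) *
      wt p q (L.map fun f => f 1) (cis x))
    rw [Fintype.card_fin] at this
    exact this.symm
  rw [hlim]
  refine tendsto_integral_filter_of_dominated_convergence (fun _ => ((C * C) ^ n) ^ n * B) ?_ ?_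
    (integrable_const _) ?_
  · filter_upwards [hev] with τ hτ
    have hτ0 : 0 < τ := ha0.trans hτ.1
    refine Continuous.aestronglyMeasurable (continuous_iff_continuousAt.2 fun x => ?_)
    refine (continuousAt_pairs (fun u hu hu1 => continuousAt_gpair_comp hp1 hq1
      continuousAt_const hu (by simp [hτ0.ne']) ?_ hu1) (fun i => by fun_prop) (by simp)).mul
      (continuous_dens_pt hp1 hq1 ?_ n).continuousAt
    · rw [norm_pow, Complex.norm_of_nonneg hτ0.le]
      exact pow_lt_one₀ hτ0.le hτ.2 two_ne_zero
    · simp only [List.forall_mem_map]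
      exact fun f hf => (hL τ hτ.1.le hτ.2.le f hf).2
  · filter_upwards [hev] with τ hτ
    refine .of_forall fun x => ?_
    rw [typeII_integrand_eq, norm_mul]
    refine mul_le_mul (norm_pairs_le hC1 (fun u hu => ?_) (by simp))
      (hB (τ, x) ⟨⟨hτ.1.le, hτ.2.le⟩, trivial⟩) (norm_nonneg _) (by positivity)
    have := hC (τ ^ 2) (by gcongr; exact hτ.1.le)
      (pow_le_one₀ (ha0.trans hτ.1).le hτ.2.le) u hu
    simpa using this
  · have hae : ∀ᵐ x ∂torusMeasure n, ∀ i j : Fin n, i < j →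
        pt x i * pt x j ≠ 1 ∧ pt x i / pt x j ≠ 1 := by
      filter_upwards [ae_generic n] with x hx i j hij
      exact ⟨hx.2 i j, fun h => hij.ne (hx.1 ((div_eq_one_iff_eq (pt_ne_zero x j)).1 h))⟩
    filter_upwards [hae] with x hx
    simp only [typeII_integrand_eq]
    have hsq : Filter.Tendsto (fun τ : ℝ => τ ^ 2) (nhdsWithin 1 (Set.Iio 1)) (nhds 1) := by
      have : ContinuousAt (fun τ : ℝ => τ ^ 2) 1 := by fun_prop
      simpa using this.tendsto.mono_left nhdsWithin_le_nhds
    have hg : ∀ u : ℂ, ‖u‖ = 1 → u ≠ 1 → Filter.Tendsto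
        (fun τ : ℝ => gpair p q ((τ : ℂ) ^ 2) u * vfac p q u) (nhdsWithin 1 (Set.Iio 1))
        (nhds 1) := fun u hu hu1 => by
      simpa [Function.comp_def] using (tendsto_gpair_mul_vfac hp1 hq1 hu hu1).comp hsq
    have h2 := (((hcont 1 ha1.le le_rfl x).comp (f := fun τ : ℝ => (τ, x)) (x := 1)
      (by fun_prop)).tendsto.mono_left (nhdsWithin_le_nhds (s := Set.Iio 1)))
    have h1 := tendsto_pairs (l := nhdsWithin (1 : ℝ) (Set.Iio 1))
      (h := fun τ u => gpair p q ((τ : ℂ) ^ 2) u * vfac p q u) (z := pt x) fun i j hij =>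
        ⟨hg _ (by simp) (hx i j hij).1, hg _ (by simp) (hx i j hij).2⟩
    simpa using h1.mul h2

lemma ellGamma_pow_div (hp1 : ‖p‖ < 1) (hq1 : ‖q‖ < 1) {t : ℂ} (ht : t ≠ 1) (j : ℕ) :
    ellGamma (t ^ (j + 1)) p q / ellGamma t p q =
      regGamma p q (t ^ (j + 1)) / (regGamma p q t * ∑ i ∈ Finset.range (j + 1), t ^ i) := by
  have h1 : 1 - t ≠ 0 := sub_ne_zero.2 ht.symm
  rw [regGamma_eq hp1 hq1, regGamma_eq hp1 hq1, ← mul_neg_geom_sum]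
  field_simp

lemma tendsto_ellGamma_pow_div (hp1 : ‖p‖ < 1) (hq1 : ‖q‖ < 1) (j : ℕ) :
    Filter.Tendsto (fun τ : ℝ => ellGamma (((τ : ℂ) ^ 2) ^ (j + 1)) p q /
      ellGamma ((τ : ℂ) ^ 2) p q) (nhdsWithin 1 (Set.Iio 1)) (nhds (((j + 1 : ℕ) : ℂ))⁻¹) := by
  have hr : regGamma p q 1 ≠ 0 := regGamma_ne_zero_of_norm_eq_one hp1 hq1 (by simp)
  have hc : ∀ k : ℕ, ContinuousAt (fun τ : ℝ => regGamma p q (((τ : ℂ) ^ 2) ^ k)) 1 := fun k =>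
    ContinuousAt.comp (g := regGamma p q) (f := fun τ : ℝ => ((τ : ℂ) ^ 2) ^ k)
      (continuousAt_regGamma hp1 hq1 (by simp) (by simp)) (by fun_prop)
  have h : ContinuousAt (fun τ : ℝ => regGamma p q (((τ : ℂ) ^ 2) ^ (j + 1)) /
      (regGamma p q (((τ : ℂ) ^ 2) ^ 1) * ∑ i ∈ Finset.range (j + 1), ((τ : ℂ) ^ 2) ^ i)) 1 :=
    (hc _).div ((hc 1).mul (by fun_prop)) (by
      simp only [Complex.ofReal_one, one_pow, Finset.sum_const, Finset.card_range]
      exact mul_ne_zero hr (by simp; norm_cast))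
  have h' := h.tendsto.mono_left (nhdsWithin_le_nhds (s := Set.Iio 1))
  simp only [Complex.ofReal_one, one_pow, Finset.sum_const, Finset.card_range, pow_one,
    nsmul_eq_mul, mul_one] at h'
  rw [← div_div, div_self hr, one_div] at h'
  refine h'.congr' ?_
  filter_upwards [self_mem_nhdsWithin, nhdsWithin_le_nhds (lt_mem_nhds (zero_lt_one (α := ℝ)))]
    with τ hτ hτ0
  rw [ellGamma_pow_div hp1 hq1]
  have : τ ^ 2 < 1 := pow_lt_one₀ hτ0.le hτ two_ne_zero
  exact_mod_cast this.ne

lemma tendsto_typeIIVal (hp1 : ‖p‖ < 1) (hq1 : ‖q‖ < 1) {L : List (ℂ → ℂ)}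
    (hL : ∀ f ∈ L, DifferentiableAt ℂ f 1 ∧ f 1 ≠ 0 ∧ ‖f 1‖ < 1) (n : ℕ) :
    Filter.Tendsto (fun τ : ℝ => typeIIVal p q n τ (L.map fun f => f τ) /
      ellGamma ((τ : ℂ) ^ 2) p q ^ n) (nhdsWithin 1 (Set.Iio 1))
      (nhds ((n.factorial : ℂ)⁻¹ * pairProd p q (L.map fun f => f 1) ^ n)) := by
  have e : ∀ τ : ℝ, typeIIVal p q n τ (L.map fun f => f τ) / ellGamma ((τ : ℂ) ^ 2) p q ^ n =
      ∏ j ∈ Finset.range n, (ellGamma (((τ : ℂ) ^ 2) ^ (j + 1)) p q /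
        ellGamma ((τ : ℂ) ^ 2) p q *
        pairProd p q ((L.map fun f (u : ℂ) => u ^ j * f u).map fun f => f τ)) := fun τ => by
    have h : ellGamma ((τ : ℂ) ^ 2) p q ^ n =
        ∏ _j ∈ Finset.range n, ellGamma ((τ : ℂ) ^ 2) p q := by simp
    rw [typeIIVal, h, ← Finset.prod_div_distrib]
    refine Finset.prod_congr rfl fun j _ => ?_
    simp only [List.map_map, Function.comp_def]
    ring
  have e' : (n.factorial : ℂ)⁻¹ * pairProd p q (L.map fun f => f 1) ^ n =
      ∏ j ∈ Finset.range n, ((((j + 1 : ℕ) : ℂ))⁻¹ *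
        pairProd p q ((L.map fun f (u : ℂ) => u ^ j * f u).map fun f => f ((1 : ℝ) : ℂ))) := by
    simp only [List.map_map, Function.comp_def, Complex.ofReal_one, one_pow, one_mul]
    rw [Finset.prod_mul_distrib, Finset.prod_inv_distrib, Finset.prod_const, Finset.card_range,
      ← Finset.prod_range_add_one_eq_factorial, Nat.cast_prod]
  simp only [e, e']
  refine tendsto_finsetProd _ fun j _ => (tendsto_ellGamma_pow_div hp1 hq1 j).mul ?_
  have h := differentiableAt_pairProd hp1 hq1 (u := 1) (L := L.map fun f u => u ^ j * f u) (by
    simp only [List.forall_mem_map, one_pow, one_mul]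
    intro f hf
    obtain ⟨h1, h2⟩ := hL f hf
    exact ⟨by fun_prop, h2⟩)
  have hc := h.continuousAt
  rw [← Complex.ofReal_one] at hc
  have h' : ContinuousAt (fun τ : ℝ => pairProd p q
      ((L.map fun f (u : ℂ) => u ^ j * f u).map fun f => f τ)) 1 :=
    hc.comp (f := fun τ : ℝ => (τ : ℂ)) (by fun_prop)
  exact h'.tendsto.mono_left nhdsWithin_le_nhds

/-! ### The evaluation of the type II integral -/

lemma typeII_const_eq (hp0 : p ≠ 0) (hp1 : ‖p‖ < 1) (hq0 : q ≠ 0) (hq1 : ‖q‖ < 1) {m : ℕ}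
    {κ κ' : ℂ}
    (hκ : ∀ b L, Balanced p q 1 (b :: L) → ‖b‖ < ‖q‖ →
      typeI p q 1 (b :: L) = κ * pairProd p q (b :: L))
    (h : ∀ τ L, Admissible p q m τ L →
      typeII p q (m + 1) (τ ^ 2) L * ellGamma (τ ^ 2) p q ^ (m + 1) =
        κ' * typeIIVal p q (m + 1) τ L) :
    κ' = (m + 1).factorial * κ ^ (m + 1) := by
  obtain ⟨c, hc0, hc1, hpc⟩ := exists_norm_lt_pow hp1 5
  have hcC : (c : ℂ) ≠ 0 := by exact_mod_cast hc0.ne'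
  have hcn : ‖(c : ℂ)‖ = c := by simp [hc0.le]
  have hpq : ‖p * q‖ / c ^ 5 < ‖q‖ := by
    rw [norm_mul, div_lt_iff₀ (by positivity), mul_comm]
    gcongr
  obtain ⟨a, ha0, ha1, ha⟩ := exists_norm_lt_pow (p := p * q / c ^ 5)
    (by rw [norm_div, norm_pow, hcn]; exact hpq.trans hq1) (4 * m)
  rw [norm_div, norm_pow, hcn] at ha
  let g : ℂ → ℂ := fun u => p * q / (u ^ (4 * m) * c ^ 5)
  let L : List (ℂ → ℂ) := [g, fun _ => c, fun _ => c, fun _ => c, fun _ => c, fun _ => c]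
  have hg : ∀ τ : ℝ, a ≤ τ → DifferentiableAt ℂ g τ ∧ g τ ≠ 0 ∧ ‖g τ‖ < 1 := fun τ hτ => by
    have hτ0 : 0 < τ := ha0.trans_le hτ
    have hτC : (τ : ℂ) ≠ 0 := by exact_mod_cast hτ0.ne'
    refine ⟨by fun_prop (disch := simp [hcC, hτC]), by simp [g, hp0, hq0, hcC, hτC], ?_⟩
    rw [norm_div, norm_mul (_ ^ _), norm_pow, norm_pow, hcn, Complex.norm_of_nonneg hτ0.le,
      div_lt_one (by positivity)]
    rw [div_lt_iff₀ (by positivity)] at ha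
    exact ha.trans_le (by gcongr)
  have hL : ∀ τ : ℝ, a ≤ τ → ∀ f ∈ L, DifferentiableAt ℂ f τ ∧ f τ ≠ 0 ∧ ‖f τ‖ < 1 :=
    fun τ hτ => by
      have := hg τ hτ
      simp [L, this, hcC, abs_of_pos hc0, hc1]
  have hlhs := tendsto_typeII (p := p) (q := q) hp1 hq1 ha0 ha1 (L := L)
    (fun τ h1 _ f hf => ⟨(hL τ h1 f hf).1.continuousAt, (hL τ h1 f hf).2⟩) (m + 1)
  have hL1 := hL 1 ha1.le
  rw [Complex.ofReal_one] at hL1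
  have hrhs := (tendsto_typeIIVal (p := p) (q := q) hp1 hq1 hL1 (m + 1)).const_mul κ'
  have hev : ∀ᶠ τ : ℝ in nhdsWithin 1 (Set.Iio 1),
      typeII p q (m + 1) ((τ : ℂ) ^ 2) (L.map fun f => f τ) =
      κ' * (typeIIVal p q (m + 1) τ (L.map fun f => f τ) /
        ellGamma ((τ : ℂ) ^ 2) p q ^ (m + 1)) := by
    have hsq : ∀ᶠ τ : ℝ in nhdsWithin 1 (Set.Iio 1), ‖p * q‖ < τ ^ 2 := by
      refine nhdsWithin_le_nhds (ContinuousAt.eventually_lt continuousAt_const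
        (f := fun _ => ‖p * q‖) (g := fun τ : ℝ => τ ^ 2) (by fun_prop) ?_)
      simpa using norm_one_lt_of_norm_eq_one hp1 hq1
    filter_upwards [self_mem_nhdsWithin, nhdsWithin_le_nhds (lt_mem_nhds ha1), hsq]
      with τ hτ1 hτa hτ2
    have hτ0 : 0 < τ := ha0.trans hτa
    have hτC : (τ : ℂ) ≠ 0 := by exact_mod_cast hτ0.ne'
    have hτn : ‖(τ : ℂ)‖ = τ := by simp [hτ0.le]
    have hne : ellGamma ((τ : ℂ) ^ 2) p q ≠ 0 :=
      ellGamma_ne_zero hp1 hq1 (by rwa [norm_pow, hτn])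
        (by rw [norm_pow, hτn]; exact pow_lt_one₀ hτ0.le hτ1 two_ne_zero)
    rw [mul_div_assoc', eq_div_iff (pow_ne_zero _ hne)]
    refine h τ _ ⟨by simp [L], hτC, by rwa [hτn], ?_, ?_⟩
    · simp only [List.forall_mem_map]
      exact fun f hf => (hL τ hτa.le f hf).2.2
    · simp only [L, g, List.map_cons, List.map_nil, List.prod_cons, List.prod_nil]
      field_simp
      ring
  have hlim := tendsto_nhds_unique (hlhs.congr' hev) hrhs
  have hb : Balanced p q 1 (g 1 :: [(c : ℂ), c, c, c, c]) := by
    refine ⟨by simp, ?_, ?_⟩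
    · simp only [g, List.prod_cons, List.prod_nil]
      field_simp
      ring
    · simpa [L] using fun f hf => (hL1 f hf).2.2
  have hg1 : ‖g 1‖ < ‖q‖ := by simpa [g, abs_of_pos hc0] using hpq
  have hne := hb.pairProd_ne_zero hp0 hp1 hq0 hq1
  have hI := hκ _ _ hb hg1
  simp only [L, List.map_cons, List.map_nil] at hlim
  rw [hI, mul_pow, ← mul_assoc] at hlim
  have hlim' := mul_right_cancel₀ (pow_ne_zero _ hne) hlim
  have hf : ((m + 1).factorial : ℂ) ≠ 0 := by exact_mod_cast (Nat.factorial_pos _).ne'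
  rw [hlim']
  field_simp

theorem typeII_eq (hp0 : p ≠ 0) (hp1 : ‖p‖ < 1) (hq0 : q ≠ 0) (hq1 : ‖q‖ < 1) (m : ℕ)
    {τ : ℂ} {L : List ℂ} (hA : Admissible p q m τ L) :
    typeII p q (m + 1) (τ ^ 2) L * ellGamma (τ ^ 2) p q ^ (m + 1) =
      (m + 1).factorial * (2 * (qPoch p * qPoch q)⁻¹) ^ (m + 1) *
        typeIIVal p q (m + 1) τ L := by
  choose κ hκ using fun n => exists_typeI_const (p := p) (q := q) hp0 hp1 hq0 hq1 n
  have hκ1 := typeI_const_one hp0 hp1 hq0 hq1 (hκ 1)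
  have hκ10 : κ 1 ≠ 0 := by
    rw [hκ1]
    exact mul_ne_zero two_ne_zero
      (inv_ne_zero (mul_ne_zero (qPoch_ne_zero hp1) (qPoch_ne_zero hq1)))
  have key : ∀ m, ∀ τ L, Admissible p q m τ L →
      typeII p q (m + 1) (τ ^ 2) L * ellGamma (τ ^ 2) p q ^ (m + 1) =
        κ (m + 1) * typeIIVal p q (m + 1) τ L := by
    intro m
    induction m with
    | zero => exact fun τ L => typeII_eq_one hp0 hp1 hq0 hq1 (hκ 1)
    | succ m ih =>
      refine fun τ L => typeII_eq_succ hp0 hp1 hq0 hq1 ?_ (hκ _) (hκ _) ih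
      rw [typeII_const_eq hp0 hp1 hq0 hq1 (hκ 1) ih]
      exact mul_ne_zero (by exact_mod_cast (Nat.factorial_pos _).ne') (pow_ne_zero _ hκ10)
  rw [key m τ L hA, typeII_const_eq hp0 hp1 hq0 hq1 (hκ 1) (key m), hκ1]

lemma torusInt_eq_integral {n : ℕ} {f : (Fin n → ℂ) → ℂ}
    (hf : Continuous fun x : Torus n => f (pt x)) :
    torusInt n f = ∫ x, f (pt x) ∂torusMeasure n := by
  have hm : MeasurePreserving (fun (θ : Fin n → ℝ) i => (θ i : Circ))
      (volume.restrict (Set.univ.pi fun _ => Set.Icc (0 : ℝ) (2 * π)))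
      (Measure.pi fun _ => (volume : Measure Circ)) := by
    rw [volume_pi, Measure.restrict_pi_pi]
    refine measurePreserving_pi _ _ fun _ => ?_
    have h := AddCircle.measurePreserving_mk (2 * π) 0
    rwa [zero_add, restrict_Ioc_eq_restrict_Icc] at h
  have hs : (Measure.pi fun _ : Fin n => (volume : Measure Circ)) =
      ENNReal.ofReal (2 * π) ^ n • torusMeasure n := by
    refine Measure.pi_eq fun s _ => ?_
    simp [AddCircle.volume_eq_smul_haarAddCircle, Measure.pi_pi, Finset.prod_mul_distrib]
  have hi : ∫ θ in Set.univ.pi fun _ : Fin n => Set.Icc (0 : ℝ) (2 * π),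
      f (fun i => Complex.exp (Complex.I * (θ i))) =
      ∫ x, f (pt x) ∂(Measure.pi fun _ : Fin n => (volume : Measure Circ)) := by
    rw [← hm.map_eq, integral_map hm.measurable.aemeasurable hf.aestronglyMeasurable]
    exact integral_congr_ae (.of_forall fun θ => congrArg f (funext fun i => (cis_coe _).symm))
  rw [torusInt, hi, hs, integral_smul_measure, ENNReal.toReal_pow,
    ENNReal.toReal_ofReal Real.two_pi_pos.le, Complex.real_smul, ← mul_assoc]
  have := Real.two_pi_pos.ne'
  rw [← Complex.ofReal_pow, ← Complex.ofReal_mul, ← mul_pow, one_div_mul_cancel this]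
  simp

lemma pairProd_ofFn {n : ℕ} (f : Fin n → ℂ) : pairProd p q (List.ofFn f) =
    ∏ r, ∏ s, if r < s then ellGamma (f r * f s) p q else 1 := by
  induction n with
  | zero => simp [pairProd]
  | succ n ih =>
    simp [List.ofFn_succ, pairProd_cons, ih, Fin.prod_univ_succ, List.map_ofFn, List.prod_ofFn,
      Fin.succ_pos]

lemma wt_ofFn {n : ℕ} (f : Fin n → ℂ) (x : ℂ) :
    wt p q (List.ofFn f) x = ∏ r, gpair p q (f r) x := by
  simp [wt, List.map_ofFn, List.prod_ofFn]

/-- The integrand of the type II integral in terms of theta functions. -/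
lemma integrand_eq (hp1 : ‖p‖ < 1) (hq1 : ‖q‖ < 1) (t : ℂ) (t' : Fin 6 → ℂ) {n : ℕ}
    {z : Fin n → ℂ} (hz : ∀ i, ‖z i‖ = 1) :
    (∏ i, ∏ j, if i < j then
        (ellGamma (t * z i * z j) p q * ellGamma (t * z i / z j) p q *
          ellGamma (t * z j / z i) p q * ellGamma (t / (z i * z j)) p q) /
        (ellGamma (z i * z j) p q * ellGamma (z i / z j) p q *
          ellGamma (z j / z i) p q * ellGamma (1 / (z i * z j)) p q)
      else 1) *
      ∏ i, (∏ r, ellGamma (t' r * z i) p q * ellGamma (t' r / z i) p q) /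
        (ellGamma (z i ^ 2) p q * ellGamma (1 / z i ^ 2) p q) =
    pairs (gpair p q t) z * dens p q (List.ofFn t') z := by
  have hv : ∀ x : ℂ, ‖x‖ = 1 → vfac p q x = (ellGamma x p q * ellGamma x⁻¹ p q)⁻¹ :=
    fun x hx => (ellGamma_mul_inv hp1 hq1 hx).symm
  rw [typeII_integrand_eq]
  congr 1
  · refine Finset.prod_congr rfl fun i _ => Finset.prod_congr rfl fun j _ => ?_
    split_ifs
    · beta_reduce
      rw [hv _ (by simp [hz]), hv _ (by simp [hz]), inv_div, gpair, gpair, div_div_eq_mul_div,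
        mul_assoc t, mul_div_assoc t, one_div]
      simp only [div_eq_mul_inv, mul_inv]
      ring
    · rfl
  · refine Finset.prod_congr rfl fun i _ => ?_
    rw [hv _ (by simp [hz]), wt_ofFn, one_div, div_eq_mul_inv, mul_comm]
    rfl

end EllipticSelberg

open EllipticSelberg

/-- The Type II (`BC_n`) elliptic Selberg integral of van Diejen and Spiridonov. -/
theorem typeII_integral (n : ℕ) (hn : 1 ≤ n) (p q t : ℂ)
    (hp0 : 0 < ‖p‖) (hp1 : ‖p‖ < 1)
    (hq0 : 0 < ‖q‖) (hq1 : ‖q‖ < 1)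
    (ht0 : 0 < ‖t‖) (ht1 : ‖t‖ < 1)
    (t' : Fin 6 → ℂ) (ht' : ∀ r, ‖t' r‖ < 1)
    (hbal : t ^ (2 * n - 2) * ∏ r, t' r = p * q) :
    (qPoch p * qPoch q * ellGamma t p q) ^ n / ((2 ^ n * n.factorial : ℕ) : ℂ) *
      torusInt n (fun z =>
        (∏ i, ∏ j, if i < j then
            (ellGamma (t * z i * z j) p q * ellGamma (t * z i / z j) p q *
              ellGamma (t * z j / z i) p q * ellGamma (t / (z i * z j)) p q) /
            (ellGamma (z i * z j) p q * ellGamma (z i / z j) p q *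
              ellGamma (z j / z i) p q * ellGamma (1 / (z i * z j)) p q)
          else 1) *
        ∏ i, (∏ r, ellGamma (t' r * z i) p q * ellGamma (t' r / z i) p q) /
          (ellGamma (z i ^ 2) p q * ellGamma (1 / z i ^ 2) p q)) =
      ∏ j ∈ Finset.range n,
        ellGamma (t ^ (j + 1)) p q *
          ∏ r, ∏ s, if r < s then ellGamma (t ^ j * t' r * t' s) p q else 1 := by
  rw [norm_pos_iff] at hp0 hq0 ht0
  obtain ⟨m, rfl⟩ : ∃ m, n = m + 1 := ⟨n - 1, by omega⟩
  obtain ⟨τ, rfl⟩ := IsAlgClosed.exists_pow_nat_eq t (n := 2) two_pos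
  have hτ0 : τ ≠ 0 := fun h => ht0 (by simp [h])
  have hτ1 : ‖τ‖ < 1 := by
    rw [norm_pow] at ht1
    exact (pow_lt_one_iff_of_nonneg (norm_nonneg _) two_ne_zero).1 ht1
  have hA : Admissible p q m τ (List.ofFn t') :=
    ⟨by simp, hτ0, hτ1, List.forall_mem_ofFn_iff.2 ht',
      by rw [List.prod_ofFn, ← hbal]; congr 2⟩
  have hA0 := hA.param_ne_zero hp0 hq0
  have hint := fun x : Torus (m + 1) =>
    integrand_eq hp1 hq1 (τ ^ 2) t' (z := pt x) fun i => norm_pt x i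
  have hc : Continuous fun x : Torus (m + 1) =>
      pairs (gpair p q (τ ^ 2)) (pt x) * dens p q (List.ofFn t') (pt x) := by
    refine continuous_iff_continuousAt.2 fun x => (continuousAt_pairs (fun u hu hu1 =>
      continuousAt_gpair_comp hp1 hq1 continuousAt_const hu ht0 ht1 hu1)
      (fun i => by fun_prop) (by simp)).mul
      (continuous_dens_pt hp1 hq1 (fun s hs => ⟨hA0 s hs, hA.norm_lt s hs⟩) _).continuousAt
  have hV : typeIIVal p q (m + 1) τ (List.ofFn t') = ∏ j ∈ Finset.range (m + 1),
      ellGamma ((τ ^ 2) ^ (j + 1)) p q *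
        ∏ r, ∏ s, if r < s then ellGamma ((τ ^ 2) ^ j * t' r * t' s) p q else 1 := by
    refine Finset.prod_congr rfl fun j _ => ?_
    rw [List.map_ofFn, pairProd_ofFn]
    have e : ∀ a b : ℂ, τ ^ j * a * (τ ^ j * b) = (τ ^ 2) ^ j * a * b := fun a b => by ring
    simp only [Function.comp_apply, e]
  have hP : qPoch p * qPoch q ≠ 0 := mul_ne_zero (qPoch_ne_zero hp1) (qPoch_ne_zero hq1)
  have hf : ((m + 1).factorial : ℂ) ≠ 0 := by exact_mod_cast (Nat.factorial_pos _).ne'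
  have hII := typeII_eq hp0 hp1 hq0 hq1 m hA
  rw [torusInt_eq_integral (by simpa only [hint] using hc)]
  simp only [hint]
  rw [← hV, mul_pow, div_mul_eq_mul_div, mul_assoc, mul_comm (_ ^ _) (∫ _, _ ∂_)]
  change _ * (typeII p q (m + 1) (τ ^ 2) (List.ofFn t') * _) / _ = _
  rw [hII, mul_pow 2, inv_pow]
  push_cast
  field_simp
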